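/- Hausdorff dimension of the multifractal level sets: Let D ⊆ ℝ^d be nonempty, bounded and open, take f ≡ 1, let γ ∈ (0, √(2d)) and q ∈ (0, √(2d)/γ), and let M be the Gaussian multiplicative chaos measure on D. Define the random set K_{γ,q} = { x ∈ D : lim_{ε→0⁺} ln M(B(x,ε)) / ln ε = d + (1/2 − q) γ² }. Then almost surely the Hausdorff dimension of K_{γ,q} equals d − γ² q² / 2. -/

import Mathlib

open MeasureTheory ProbabilityTheory Filter Topology
open scoped ENNReal NNReal

noncomputable section

variable {d : ℕ}

/-- The rescaled mollifier `θ_ε(x) = ε^{-d} θ(x/ε)`. -/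
def mollifierScaled (θ : EuclideanSpace ℝ (Fin d) → ℝ) (ε : ℝ)
    (x : EuclideanSpace ℝ (Fin d)) : ℝ :=
  (ε ^ d)⁻¹ * θ (ε⁻¹ • x)

/-- A nonnegative smooth mollifier: `C^∞`, compactly supported, nonnegative, total integral 1. -/
def IsMollifier (θ : EuclideanSpace ℝ (Fin d) → ℝ) : Prop :=
  ContDiff ℝ (⊤ : ℕ∞) θ ∧ HasCompactSupport θ ∧ (∀ x, 0 ≤ θ x) ∧ (∫ x, θ x) = 1

/-- The kernel of log-type associated to `g`: `K(x,y) = ln₊(1/|x-y|) + g(x,y)` where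
`ln₊ u = max (ln u) 0`. -/
def logKernel (g : EuclideanSpace ℝ (Fin d) → EuclideanSpace ℝ (Fin d) → ℝ)
    (x y : EuclideanSpace ℝ (Fin d)) : ℝ :=
  max (Real.log (dist x y)⁻¹) 0 + g x y

/-- `g` is bounded and (jointly) measurable. -/
def IsBoundedMeasurable (g : EuclideanSpace ℝ (Fin d) → EuclideanSpace ℝ (Fin d) → ℝ) : Prop :=
  Measurable (Function.uncurry g) ∧ ∃ C, ∀ x y, |g x y| ≤ C

/-- The mollified covariance `K_{ε,ε'}(x,y) = ∫∫ θ₁_ε(u) θ₂_{ε'}(v) K(x-u, y-v) du dv`. -/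
def mollifiedCov (K : EuclideanSpace ℝ (Fin d) → EuclideanSpace ℝ (Fin d) → ℝ)
    (θ₁ θ₂ : EuclideanSpace ℝ (Fin d) → ℝ) (ε ε' : ℝ)
    (x y : EuclideanSpace ℝ (Fin d)) : ℝ :=
  ∫ u, ∫ v, mollifierScaled θ₁ ε u * mollifierScaled θ₂ ε' v * K (x - u) (y - v)

/-- `X = (X(ε,x))` is a jointly measurable family whose finite-dimensional distributions are
centered Gaussian with covariance `E[X(ε,x) X(ε',y)] = Km ε ε' x y` (expressed by requiring
every finite real linear combination to have the appropriate centered Gaussian law). -/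
def IsGaussianFamily {Ω : Type*} [MeasurableSpace Ω] (P : Measure Ω)
    (X : ℝ → EuclideanSpace ℝ (Fin d) → Ω → ℝ)
    (Km : ℝ → ℝ → EuclideanSpace ℝ (Fin d) → EuclideanSpace ℝ (Fin d) → ℝ) : Prop :=
  (Measurable fun p : ℝ × EuclideanSpace ℝ (Fin d) × Ω => X p.1 p.2.1 p.2.2) ∧
  ∀ (n : ℕ) (ε : Fin n → ℝ) (x : Fin n → EuclideanSpace ℝ (Fin d)),
    (∀ i, ε i ∈ Set.Ioc (0 : ℝ) 1) → ∀ l : Fin n → ℝ, ∃ v : ℝ≥0,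
      (v : ℝ) = ∑ i, ∑ j, l i * l j * Km (ε i) (ε j) (x i) (x j) ∧
      Measure.map (fun ω => ∑ i, l i * X (ε i) (x i) ω) P = gaussianReal 0 v

/-- The approximate Gaussian multiplicative chaos measure
`M_ε(A) = ∫_A exp(γ X(ε,x) - (γ²/2) Km ε ε x x) f(x) dx`. -/
def approxGMC {Ω : Type*} (γ : ℝ) (X : ℝ → EuclideanSpace ℝ (Fin d) → Ω → ℝ)
    (Km : ℝ → ℝ → EuclideanSpace ℝ (Fin d) → EuclideanSpace ℝ (Fin d) → ℝ)
    (f : EuclideanSpace ℝ (Fin d) → ℝ) (ε : ℝ) (ω : Ω)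
    (A : Set (EuclideanSpace ℝ (Fin d))) : ℝ :=
  ∫ x in A, Real.exp (γ * X ε x ω - γ ^ 2 / 2 * Km ε ε x x) * f x

/-- `M` is the Gaussian multiplicative chaos measure on `D`: a random Radon measure on `D`
such that `M_ε(A) → M(A)` in probability as `ε → 0` for every Borel `A` with compact closure
contained in `D`. -/
def IsGMCMeasure {Ω : Type*} [MeasurableSpace Ω] (P : Measure Ω) (γ : ℝ)
    (X : ℝ → EuclideanSpace ℝ (Fin d) → Ω → ℝ)
    (Km : ℝ → ℝ → EuclideanSpace ℝ (Fin d) → EuclideanSpace ℝ (Fin d) → ℝ)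
    (f : EuclideanSpace ℝ (Fin d) → ℝ) (D : Set (EuclideanSpace ℝ (Fin d)))
    (M : Ω → Measure (EuclideanSpace ℝ (Fin d))) : Prop :=
  (∀ A : Set (EuclideanSpace ℝ (Fin d)), MeasurableSet A → Measurable fun ω => M ω A) ∧
  (∀ ω, ∀ A : Set (EuclideanSpace ℝ (Fin d)), IsCompact (closure A) → closure A ⊆ D →
    M ω A ≠ ⊤) ∧
  (∀ A : Set (EuclideanSpace ℝ (Fin d)), MeasurableSet A → IsCompact (closure A) →
    closure A ⊆ D →
    TendstoInMeasure P (fun ε ω => approxGMC γ X Km f ε ω A) (𝓝[Set.Ioc (0 : ℝ) 1] 0)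
      fun ω => (M ω A).toReal)

/-- The exponential of a real number, as an extended nonnegative real. -/
def eexp (x : ℝ) : ℝ≥0∞ := ENNReal.ofReal (Real.exp x)

lemma eexp_zero : eexp 0 = 1 := by simp [eexp]

lemma eexp_add (x y : ℝ) : eexp (x + y) = eexp x * eexp y := by
  rw [eexp, Real.exp_add, ENNReal.ofReal_mul (Real.exp_pos x).le]; rfl

lemma eexp_ne_top (x : ℝ) : eexp x ≠ ⊤ := ENNReal.ofReal_ne_top

lemma eexp_pos (x : ℝ) : 0 < eexp x := ENNReal.ofReal_pos.2 (Real.exp_pos x)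

lemma eexp_ne_zero (x : ℝ) : eexp x ≠ 0 := (eexp_pos x).ne'

lemma eexp_le {x y : ℝ} (h : x ≤ y) : eexp x ≤ eexp y :=
  ENNReal.ofReal_le_ofReal (Real.exp_le_exp.2 h)

lemma eexp_le_iff {x y : ℝ} : eexp x ≤ eexp y ↔ x ≤ y := by
  rw [eexp, eexp, ENNReal.ofReal_le_ofReal_iff (Real.exp_pos y).le, Real.exp_le_exp]

lemma eexp_toReal (x : ℝ) : (eexp x).toReal = Real.exp x :=
  ENNReal.toReal_ofReal (Real.exp_pos x).le

lemma eexp_rpow (x p : ℝ) : eexp x ^ p = eexp (p * x) := by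
  rw [eexp, ENNReal.ofReal_rpow_of_pos (Real.exp_pos x), ← Real.exp_mul, mul_comm]; rfl

lemma eexp_mul_neg (x : ℝ) : eexp x * eexp (-x) = 1 := by
  rw [← eexp_add, add_neg_cancel, eexp_zero]

lemma measurable_eexp : Measurable eexp :=
  ENNReal.measurable_ofReal.comp Real.measurable_exp

lemma exists_eq_eexp {a : ℝ≥0∞} (h0 : a ≠ 0) (ht : a ≠ ⊤) : ∃ x, a = eexp x := by
  refine ⟨Real.log a.toReal, ?_⟩
  rw [eexp, Real.exp_log (ENNReal.toReal_pos h0 ht), ENNReal.ofReal_toReal ht]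

section GaussField

variable {ι : Type*}

/-- The linear functional on `ι → ℝ` with finitely many coefficients `l`. -/
def linForm (l : ι →₀ ℝ) (x : ι → ℝ) : ℝ := Finsupp.linearCombination ℝ x l

lemma linForm_add (l l' : ι →₀ ℝ) (x : ι → ℝ) :
    linForm (l + l') x = linForm l x + linForm l' x := by simp [linForm]

lemma linForm_sub (l l' : ι →₀ ℝ) (x : ι → ℝ) :
    linForm (l - l') x = linForm l x - linForm l' x := by simp [linForm]

lemma linForm_smul (t : ℝ) (l : ι →₀ ℝ) (x : ι → ℝ) :
    linForm (t • l) x = t * linForm l x := by simp [linForm]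

lemma linForm_single (i : ι) (t : ℝ) (x : ι → ℝ) :
    linForm (Finsupp.single i t) x = t * x i := by simp [linForm]

lemma linForm_zero (x : ι → ℝ) : linForm 0 x = 0 := by simp [linForm]

lemma linForm_eq_sum (l : ι →₀ ℝ) (x : ι → ℝ) :
    linForm l x = ∑ i ∈ l.support, l i * x i := by
  simp [linForm, Finsupp.linearCombination_apply, Finsupp.sum]

lemma linForm_add_right (l : ι →₀ ℝ) (x y : ι → ℝ) :
    linForm l (fun i => x i + y i) = linForm l x + linForm l y := by
  simp [linForm_eq_sum, mul_add, Finset.sum_add_distrib]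

lemma measurable_linForm (l : ι →₀ ℝ) : Measurable (linForm l) := by
  have : linForm l = fun x => ∑ i ∈ l.support, l i * x i := funext (linForm_eq_sum l)
  rw [this]
  fun_prop

/-- The covariance of the linear functionals `l` and `l'` for the covariance kernel `C`. -/
def covForm (C : ι → ι → ℝ) (l l' : ι →₀ ℝ) : ℝ := linForm l fun i => linForm l' (C i)

/-- `μ` is the law of a centered Gaussian field indexed by `ι` with covariance `C`, expressed
through its exponential moments. -/
structure GaussField (μ : Measure (ι → ℝ)) (C : ι → ι → ℝ) : Prop where
  symm : ∀ i j, C i j = C j i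
  mgf : ∀ l : ι →₀ ℝ, ∫⁻ x, eexp (linForm l x) ∂μ = eexp (covForm C l l / 2)

lemma covForm_comm {C : ι → ι → ℝ} (h : ∀ i j, C i j = C j i) (l l' : ι →₀ ℝ) :
    covForm C l l' = covForm C l' l := by
  simp only [covForm, linForm_eq_sum, Finset.mul_sum]
  rw [Finset.sum_comm]
  refine Finset.sum_congr rfl fun i _ => Finset.sum_congr rfl fun j _ => ?_
  rw [h]; ring

lemma covForm_add_left (C : ι → ι → ℝ) (l l' m : ι →₀ ℝ) :
    covForm C (l + l') m = covForm C l m + covForm C l' m := linForm_add _ _ _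

lemma covForm_add_right (C : ι → ι → ℝ) (l m m' : ι →₀ ℝ) :
    covForm C l (m + m') = covForm C l m + covForm C l m' := by
  simp only [covForm, linForm_add, linForm_add_right]

lemma covForm_single_single (C : ι → ι → ℝ) (i j : ι) (s t : ℝ) :
    covForm C (Finsupp.single i s) (Finsupp.single j t) = s * t * C i j := by
  simp only [covForm, linForm_single]; ring

lemma charFunDual_map_of_mgf {E : Type*} [MeasurableSpace E] {μ ν : Measure E}
    [IsFiniteMeasure μ] [IsFiniteMeasure ν] {X : E → ℝ} (hX : Measurable X)
    (h : ∀ t : ℝ, ∫⁻ x, eexp (t * X x) ∂μ = ∫⁻ x, eexp (t * X x) ∂ν)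
    (hfin : ∀ t : ℝ, ∫⁻ x, eexp (t * X x) ∂μ ≠ ⊤) :
    complexMGF X μ = complexMGF X ν := by
  have hint : ∀ (ρ : Measure E), (∀ t : ℝ, ∫⁻ x, eexp (t * X x) ∂ρ ≠ ⊤) →
      ∀ t, Integrable (fun x => Real.exp (t * X x)) ρ := by
    intro ρ hρ t
    refine ⟨by fun_prop, ?_⟩
    rw [hasFiniteIntegral_iff_ofReal (ae_of_all _ fun x => (Real.exp_pos _).le)]
    exact (hρ t).lt_top
  have hmgf : mgf X μ = mgf X ν := by
    ext t
    rw [mgf, mgf, integral_eq_lintegral_of_nonneg_ae (ae_of_all _ fun x => (Real.exp_pos _).le)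
      (by fun_prop), integral_eq_lintegral_of_nonneg_ae
      (ae_of_all _ fun x => (Real.exp_pos _).le) (by fun_prop)]
    exact congrArg _ (h t)
  have h0 : μ = 0 ↔ ν = 0 := by
    rw [← Measure.measure_univ_eq_zero, ← Measure.measure_univ_eq_zero]
    have := h 0
    simp only [zero_mul, eexp_zero, lintegral_one] at this
    rw [this]
  have huniv : integrableExpSet X μ = Set.univ := by
    ext t; simpa [integrableExpSet] using hint μ hfin t
  ext z
  exact eqOn_complexMGF_of_mgf' hmgf h0 (by simp [huniv])

/-- Exponential moments of finite linear combinations determine a finite measure on `ι → ℝ`. -/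
lemma ext_of_lintegral_eexp {μ ν : Measure (ι → ℝ)} [IsFiniteMeasure μ] [IsFiniteMeasure ν]
    (h : ∀ l : ι →₀ ℝ, ∫⁻ x, eexp (linForm l x) ∂μ = ∫⁻ x, eexp (linForm l x) ∂ν)
    (hfin : ∀ l : ι →₀ ℝ, ∫⁻ x, eexp (linForm l x) ∂μ ≠ ⊤) : μ = ν := by
  classical
  have key : ∀ I : Finset ι, μ.map I.restrict = ν.map I.restrict := by
    intro I
    apply Measure.ext_of_charFunDual
    ext L
    have hr : Measurable (I.restrict : (ι → ℝ) → (I → ℝ)) := by fun_prop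
    rw [charFunDual_apply, charFunDual_apply, integral_map hr.aemeasurable (by fun_prop),
      integral_map hr.aemeasurable (by fun_prop)]
    set l : ι →₀ ℝ := ∑ i : I, Finsupp.single (i : ι) (L (Pi.single i 1)) with hl
    have hL : ∀ x : ι → ℝ, L (I.restrict x) = linForm l x := by
      intro x
      have h1 : (I.restrict x) = ∑ i : I, x i • (Pi.single i (1 : ℝ) : I → ℝ) := by
        ext j
        simp [Finset.sum_apply, Pi.single_apply]
      rw [h1, map_sum]
      simp only [map_smul, smul_eq_mul, hl, linForm, map_sum, Finsupp.linearCombination_single]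
      exact Finset.sum_congr rfl fun i _ => mul_comm _ _
    have hc := charFunDual_map_of_mgf (μ := μ) (ν := ν) (measurable_linForm l)
      (fun t => by simpa [linForm_smul] using h (t • l))
      (fun t => by simpa [linForm_smul] using hfin (t • l))
    have := congrFun hc Complex.I
    simp only [complexMGF] at this
    simp only [hL]
    simpa [mul_comm] using this
  have : ∀ I : Finset ι, IsFiniteMeasure (μ.map I.restrict) := fun I => inferInstance
  exact IsProjectiveLimit.unique (P := fun I => μ.map I.restrict) (fun I => rfl)
    (fun I => (key I).symm)

variable {μ : Measure (ι → ℝ)} {C : ι → ι → ℝ}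

lemma GaussField.isProbabilityMeasure (h : GaussField μ C) : IsProbabilityMeasure μ := by
  have := h.mgf 0
  simp only [linForm_zero, eexp_zero, lintegral_one, covForm] at this
  exact ⟨by simpa [eexp_zero] using this⟩

/-- The Cameron–Martin shift associated with the linear functional `l`. -/
def cmShift (C : ι → ι → ℝ) (l : ι →₀ ℝ) (i : ι) : ℝ := linForm l (C i)

lemma measurable_eexp_linForm (l : ι →₀ ℝ) : Measurable fun x : ι → ℝ => eexp (linForm l x) :=
  measurable_eexp.comp (measurable_linForm l)

/-- Girsanov's theorem for finite linear combinations of a Gaussian field. -/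
lemma GaussField.girsanov (h : GaussField μ C) (l : ι →₀ ℝ) {F : (ι → ℝ) → ℝ≥0∞}
    (hF : Measurable F) :
    ∫⁻ x, eexp (linForm l x) * F x ∂μ =
      eexp (covForm C l l / 2) * ∫⁻ x, F (fun i => x i + cmShift C l i) ∂μ := by
  have := h.isProbabilityMeasure
  have hme : Measurable fun x : ι → ℝ => eexp (linForm l x) := measurable_eexp_linForm l
  have hsh : Measurable fun (x : ι → ℝ) i => x i + cmShift C l i := by fun_prop
  set μ1 := μ.withDensity fun x => eexp (linForm l x)
  set μ2 := eexp (covForm C l l / 2) • μ.map fun x i => x i + cmShift C l i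
  have : IsFiniteMeasure μ1 := isFiniteMeasure_withDensity (by rw [h.mgf]; exact eexp_ne_top _)
  have : IsFiniteMeasure μ2 :=
    ⟨by simp only [μ2, Measure.smul_apply, smul_eq_mul]
        exact ENNReal.mul_lt_top (eexp_ne_top _).lt_top (measure_lt_top _ _)⟩
  have h1 : ∀ l', ∫⁻ x, eexp (linForm l' x) ∂μ1 = eexp (covForm C (l + l') (l + l') / 2) := by
    intro l'
    rw [lintegral_withDensity_eq_lintegral_mul _ hme (measurable_eexp_linForm l'), ← h.mgf]
    simp [linForm_add, eexp_add]
  have h12 : μ1 = μ2 := by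
    apply ext_of_lintegral_eexp
    · intro l'
      rw [h1, lintegral_smul_measure, lintegral_map (measurable_eexp_linForm l') hsh]
      simp only [linForm_add_right, eexp_add]
      rw [lintegral_mul_const _ (measurable_eexp_linForm l'), h.mgf, smul_eq_mul,
        ← eexp_add, ← eexp_add]
      congr 1
      have : linForm l' (cmShift C l) = covForm C l' l := rfl
      rw [this, covForm_add_left, covForm_add_right, covForm_add_right, covForm_comm h.symm l' l]
      ring
    · intro l'
      rw [h1]; exact eexp_ne_top _
  calc ∫⁻ x, eexp (linForm l x) * F x ∂μ = ∫⁻ x, F x ∂μ1 :=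
        (lintegral_withDensity_eq_lintegral_mul _ hme hF).symm
    _ = ∫⁻ x, F x ∂μ2 := by rw [h12]
    _ = _ := by rw [lintegral_smul_measure, lintegral_map hF hsh, smul_eq_mul]

/-- A zero-one law: an event which is invariant under all Cameron–Martin shifts is trivial. -/
lemma GaussField.zero_one (h : GaussField μ C) {A : Set (ι → ℝ)} (hA : MeasurableSet A)
    (hinv : ∀ l x, x ∈ A → (fun i => x i + cmShift C l i) ∈ A) (h0 : μ A ≠ 0) : μ Aᶜ = 0 := by
  have := h.isProbabilityMeasure
  have hinv' : ∀ l x, (fun i => x i + cmShift C l i) ∈ A ↔ x ∈ A := by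
    refine fun l x => ⟨fun hx => ?_, hinv l x⟩
    have := hinv (-l) _ hx
    have h2 : ∀ i, cmShift C (-l) i = - cmShift C l i := by
      intro i; simp [cmShift, linForm]
    simpa [h2] using this
  have hfin : IsFiniteMeasure ((μ A) • μ) :=
    ⟨by simp⟩
  have key : ((μ A) • μ) = μ.restrict A := by
    apply ext_of_lintegral_eexp
    · intro l
      rw [lintegral_smul_measure, h.mgf, smul_eq_mul, ← lintegral_indicator hA]
      have : ∀ x, A.indicator (fun x => eexp (linForm l x)) x =
          eexp (linForm l x) * A.indicator 1 x := by
        intro x; by_cases hx : x ∈ A <;> simp [hx]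
      simp only [this]
      rw [h.girsanov l (measurable_one.indicator hA)]
      have : ∀ x, A.indicator (1 : (ι → ℝ) → ℝ≥0∞) (fun i => x i + cmShift C l i) =
          A.indicator 1 x := by
        intro x
        by_cases hx : x ∈ A
        · simp [hx, (hinv' l x).2 hx]
        · have := (hinv' l x).not.2 hx
          simp [hx, this]
      simp only [this]
      rw [lintegral_indicator_one hA, mul_comm]
    · intro l
      rw [lintegral_smul_measure, h.mgf]
      exact ENNReal.mul_ne_top (measure_ne_top _ _) (eexp_ne_top _)
  have h2 := congrArg (fun ρ => ρ Aᶜ) key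
  simp only [Measure.smul_apply, smul_eq_mul, Measure.restrict_apply hA.compl,
    Set.compl_inter_self, measure_empty, mul_eq_zero] at h2
  exact h2.resolve_left h0

end GaussField

section DyadicEstimates

lemma log_two_pos : 0 < Real.log 2 := Real.log_pos one_lt_two

/-- The dyadic radius `2^{-n}`. -/
def rad (n : ℕ) : ℝ := (1 / 2) ^ n

lemma rad_pos (n : ℕ) : 0 < rad n := by unfold rad; positivity

lemma rad_anti {n m : ℕ} (h : n ≤ m) : rad m ≤ rad n :=
  pow_le_pow_of_le_one (by norm_num) (by norm_num) h

lemma rad_succ (n : ℕ) : rad (n + 1) = rad n / 2 := by unfold rad; rw [pow_succ]; ring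

lemma rad_zero : rad 0 = 1 := by simp [rad]

lemma rad_eq_exp (n : ℕ) : rad n = Real.exp (-(n * Real.log 2)) := by
  rw [rad, Real.exp_neg, mul_comm, Real.exp_mul, Real.exp_log two_pos, Real.rpow_natCast]
  simp

/-- Geometric sums are bounded. -/
lemma exists_sum_eexp_le {κ : ℝ} (hκ : 0 < κ) :
    ∃ G : ℝ, ∀ n N : ℕ, ∑ j ∈ Finset.Icc n N, eexp (-((j : ℝ) - n) * κ) ≤ eexp G := by
  set r : ℝ≥0∞ := eexp (-κ) with hr
  have hr1 : r < 1 := by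
    rw [hr, ← eexp_zero, lt_iff_not_ge, eexp_le_iff]; linarith
  have hne : (1 - r)⁻¹ ≠ ⊤ := by
    simpa [ENNReal.inv_eq_top, tsub_eq_zero_iff_le] using hr1
  obtain ⟨G, hG⟩ := exists_eq_eexp (a := (1 - r)⁻¹)
    (ENNReal.inv_ne_zero.2 (ENNReal.sub_ne_top ENNReal.one_ne_top)) hne
  refine ⟨G, fun n N => ?_⟩
  rw [← hG, ← ENNReal.tsum_geometric]
  calc ∑ j ∈ Finset.Icc n N, eexp (-((j : ℝ) - n) * κ)
      = ∑ j ∈ Finset.Icc n N, r ^ (j - n) := by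
        refine Finset.sum_congr rfl fun j hj => ?_
        rw [hr, ← ENNReal.rpow_natCast, eexp_rpow, Nat.cast_sub (Finset.mem_Icc.1 hj).1]
        congr 1; ring
    _ = ∑ i ∈ (Finset.Icc n N).image (· - n), r ^ i := by
        rw [Finset.sum_image]
        intro a ha b hb hab
        simp only [Finset.coe_Icc, Set.mem_Icc] at ha hb hab
        omega
    _ ≤ ∑' i, r ^ i := ENNReal.sum_le_tsum _

/-- A weighted form of the power mean inequality, valid for all positive exponents. -/
lemma sum_rpow_le {s : ℝ} (hs : 0 < s) {J : Type*} (T : Finset J) (a : J → ℝ≥0∞) (c : J → ℝ) :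
    (∑ j ∈ T, a j) ^ s ≤ (∑ j ∈ T, eexp (c j)) ^ s * ∑ j ∈ T, eexp (-(s * c j)) * a j ^ s := by
  rcases T.eq_empty_or_nonempty with rfl | hT
  · simp [hs]
  obtain ⟨k, hk, hmax⟩ := T.exists_max_image (fun j => eexp (-c j) * a j) hT
  have h1 : ∑ j ∈ T, a j ≤ (∑ j ∈ T, eexp (c j)) * (eexp (-c k) * a k) := by
    rw [Finset.sum_mul]
    refine Finset.sum_le_sum fun j hj => ?_
    calc a j = eexp (c j) * (eexp (-c j) * a j) := by
          rw [← mul_assoc, eexp_mul_neg, one_mul]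
      _ ≤ _ := mul_le_mul_right (hmax j hj) _
  calc (∑ j ∈ T, a j) ^ s ≤ ((∑ j ∈ T, eexp (c j)) * (eexp (-c k) * a k)) ^ s :=
        ENNReal.rpow_le_rpow h1 hs.le
    _ = (∑ j ∈ T, eexp (c j)) ^ s * (eexp (-(s * c k)) * a k ^ s) := by
        rw [ENNReal.mul_rpow_of_nonneg _ _ hs.le, ENNReal.mul_rpow_of_nonneg _ _ hs.le, eexp_rpow]
        congr 3; ring
    _ ≤ _ := mul_le_mul_right
        (Finset.single_le_sum (f := fun j => eexp (-(s * c j)) * a j ^ s)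
          (fun _ _ => zero_le) hk) _

/-- Summation of moment estimates over dyadic scales. -/
lemma exists_lintegral_sum_rpow_le {s ξ b : ℝ} (hs : 0 < s) (h : 0 < ξ - b * s) :
    ∃ G : ℝ, ∀ {E : Type} [MeasurableSpace E] (ρ : Measure E) (c : ℝ) (n N : ℕ)
      (A : ℕ → E → ℝ≥0∞), (∀ j, Measurable (A j)) →
      (∀ j ∈ Finset.Icc n N, ∫⁻ x, A j x ^ s ∂ρ ≤ eexp (c - j * ξ * Real.log 2)) →
      ∫⁻ x, (∑ j ∈ Finset.Icc n N, eexp (b * (j * Real.log 2)) * A j x) ^ s ∂ρ ≤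
        eexp (G + c - n * (ξ - b * s) * Real.log 2) := by
  set κ := (ξ - b * s) / 2 * Real.log 2 with hκ
  have hκ0 : 0 < κ := by have := log_two_pos; positivity
  obtain ⟨G1, hG1⟩ := exists_sum_eexp_le (κ := κ / s) (by positivity)
  obtain ⟨G2, hG2⟩ := exists_sum_eexp_le hκ0
  refine ⟨s * G1 + G2, fun {E} _ ρ c n N A hA hAs => ?_⟩
  calc ∫⁻ x, (∑ j ∈ Finset.Icc n N, eexp (b * (j * Real.log 2)) * A j x) ^ s ∂ρ
      ≤ ∫⁻ x, eexp (s * G1) * ∑ j ∈ Finset.Icc n N,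
          eexp (((j : ℝ) - n) * κ + s * (b * (j * Real.log 2))) * A j x ^ s ∂ρ := by
        refine lintegral_mono fun x => ?_
        refine (sum_rpow_le hs _ _ (fun j : ℕ => -((j : ℝ) - n) * (κ / s))).trans ?_
        rw [← eexp_rpow]
        refine mul_le_mul' (ENNReal.rpow_le_rpow (hG1 n N) hs.le)
          (Finset.sum_le_sum fun j _ => le_of_eq ?_)
        rw [ENNReal.mul_rpow_of_nonneg _ _ hs.le, eexp_rpow, ← mul_assoc, ← eexp_add]
        congr 2
        field_simp
    _ = eexp (s * G1) * ∑ j ∈ Finset.Icc n N,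
          eexp (((j : ℝ) - n) * κ + s * (b * (j * Real.log 2))) * ∫⁻ x, A j x ^ s ∂ρ := by
        have hm : ∀ j, Measurable fun x => A j x ^ s := fun j => (hA j).pow_const s
        rw [lintegral_const_mul _ (by fun_prop), lintegral_finsetSum _ (by fun_prop)]
        congr 1
        exact Finset.sum_congr rfl fun j _ => lintegral_const_mul _ (hm j)
    _ ≤ eexp (s * G1) * ∑ j ∈ Finset.Icc n N,
          eexp (c - n * (ξ - b * s) * Real.log 2) * eexp (-((j : ℝ) - n) * κ) := by
        refine mul_le_mul_right (Finset.sum_le_sum fun j hj => ?_) _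
        refine (mul_le_mul_right (hAs j hj) _).trans (le_of_eq ?_)
        rw [← eexp_add, ← eexp_add, hκ]
        congr 1; ring
    _ ≤ eexp (s * G1) * (eexp (c - n * (ξ - b * s) * Real.log 2) * eexp G2) := by
        rw [← Finset.mul_sum]
        gcongr
        exact hG2 n N
    _ = _ := by
        rw [← eexp_add, ← eexp_add]; congr 1; ring

end DyadicEstimates

section Chaos

/-- The index set of the discretised field: a level `n` (scale `2^{-n}`) and a point. -/
abbrev Site (d : ℕ) := ℕ × EuclideanSpace ℝ (Fin d)

/-- Quantitative logarithmic bounds for a covariance kernel indexed by scales and points. -/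
structure KernelBound (C : Site d → Site d → ℝ) (C₀ : ℝ) : Prop where
  low : ∀ i j, -C₀ ≤ C i j
  near : ∀ (n m m' : ℕ) (x y), dist x y ≤ rad n → n ≤ m → n ≤ m' →
    n * Real.log 2 - C₀ ≤ C (m, x) (m', y)
  far : ∀ (n m m' : ℕ) (x y), (rad n ≤ dist x y ∨ m ≤ n ∨ m' ≤ n) →
    C (m, x) (m', y) ≤ n * Real.log 2 + C₀

/-- The points of `S` at distance at most `2^{-n}` from `x`. -/
def nbhd (S : Finset (EuclideanSpace ℝ (Fin d))) (x : EuclideanSpace ℝ (Fin d)) (n : ℕ) :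
    Finset (EuclideanSpace ℝ (Fin d)) := S.filter fun y => dist y x ≤ rad n

lemma mem_nbhd {S : Finset (EuclideanSpace ℝ (Fin d))} {x y : EuclideanSpace ℝ (Fin d)} {n : ℕ} :
    y ∈ nbhd S x n ↔ y ∈ S ∧ dist y x ≤ rad n := by simp [nbhd]

/-- A finite set of points with weight `w`, which is upper regular down to scale `2^{-N}`. -/
structure UpperGrid (S : Finset (EuclideanSpace ℝ (Fin d))) (w : ℝ≥0∞) (N : ℕ) (C₁ : ℝ) :
    Prop where
  dist_le : ∀ x ∈ S, ∀ y ∈ S, dist x y ≤ 1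
  reg : ∀ x ∈ S, ∀ n ≤ N, w * ((nbhd S x n).card : ℝ≥0∞) ≤ eexp (C₁ - n * d * Real.log 2)

/-- The density of the chaos measure with parameter `γ` at level `N`. -/
def dens (C : Site d → Site d → ℝ) (γ : ℝ) (N : ℕ) (φ : Site d → ℝ)
    (y : EuclideanSpace ℝ (Fin d)) : ℝ≥0∞ :=
  eexp (γ * φ (N, y) - γ ^ 2 / 2 * C (N, y) (N, y))

/-- The mass given by the discretised chaos at level `N` to a finite set of points. -/
def mass (C : Site d → Site d → ℝ) (γ : ℝ) (w : ℝ≥0∞) (N : ℕ) (φ : Site d → ℝ)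
    (T : Finset (EuclideanSpace ℝ (Fin d))) : ℝ≥0∞ := ∑ y ∈ T, w * dens C γ N φ y

variable {C : Site d → Site d → ℝ} {C₀ C₁ γ : ℝ} {w : ℝ≥0∞} {N : ℕ}
  {S : Finset (EuclideanSpace ℝ (Fin d))} {μ : Measure (Site d → ℝ)}

lemma measurable_dens (C : Site d → Site d → ℝ) (γ : ℝ) (N : ℕ)
    (y : EuclideanSpace ℝ (Fin d)) : Measurable fun φ => dens C γ N φ y :=
  measurable_eexp.comp (by fun_prop)

lemma measurable_mass (C : Site d → Site d → ℝ) (γ : ℝ) (w : ℝ≥0∞) (N : ℕ)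
    (T : Finset (EuclideanSpace ℝ (Fin d))) : Measurable fun φ => mass C γ w N φ T :=
  Finset.measurable_sum _ fun y _ => (measurable_dens C γ N y).const_mul w

lemma mass_mono {T T' : Finset (EuclideanSpace ℝ (Fin d))} (h : T ⊆ T') (φ : Site d → ℝ) :
    mass C γ w N φ T ≤ mass C γ w N φ T' :=
  Finset.sum_le_sum_of_subset h

lemma nbhd_subset_nbhd {x y : EuclideanSpace ℝ (Fin d)} {n m : ℕ}
    (h : dist x y + rad n ≤ rad m) : nbhd S x n ⊆ nbhd S y m := by
  intro z hz
  rw [mem_nbhd] at hz ⊢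
  exact ⟨hz.1, by linarith [dist_triangle z x y]⟩

lemma UpperGrid.nbhd_subset_pred (h : UpperGrid S w N C₁) {x y : EuclideanSpace ℝ (Fin d)} {n : ℕ}
    (hy : y ∈ nbhd S x n) : nbhd S x n ⊆ nbhd S y (n - 1) := by
  rcases n with _ | n
  · intro z hz
    rw [mem_nbhd] at hz hy ⊢
    exact ⟨hz.1, by simpa [rad_zero] using h.dist_le z hz.1 y hy.1⟩
  · apply nbhd_subset_nbhd
    rw [mem_nbhd, dist_comm] at hy
    have := rad_succ n
    simp only [Nat.add_sub_cancel]
    linarith [hy.2]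

/-- Girsanov's theorem for the density of the chaos. -/
lemma GaussField.lintegral_dens_mul (hμ : GaussField μ C) (y : EuclideanSpace ℝ (Fin d))
    {F : (Site d → ℝ) → ℝ≥0∞} (hF : Measurable F) :
    ∫⁻ φ, dens C γ N φ y * F φ ∂μ = ∫⁻ φ, F (fun i => φ i + γ * C i (N, y)) ∂μ := by
  have h := hμ.girsanov (Finsupp.single (N, y) γ) hF
  simp only [linForm_single, covForm_single_single, cmShift] at h
  have h2 : ∀ φ, dens C γ N φ y =
      eexp (-(γ ^ 2 / 2 * C (N, y) (N, y))) * eexp (γ * φ (N, y)) := by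
    intro φ; rw [dens, ← eexp_add]; congr 1; ring
  simp only [h2, mul_assoc]
  have hm : Measurable fun φ : Site d → ℝ => eexp (γ * φ (N, y)) :=
    measurable_eexp.comp (by fun_prop)
  rw [lintegral_const_mul _ (by fun_prop), h, ← mul_assoc, ← eexp_add]
  rw [show -(γ ^ 2 / 2 * C (N, y) (N, y)) + γ * γ * C (N, y) (N, y) / 2 = 0 by ring, eexp_zero,
    one_mul]

lemma dens_shift (φ : Site d → ℝ) (b : ℝ) (i : Site d) (z : EuclideanSpace ℝ (Fin d)) :
    dens C γ N (fun j => φ j + b * C j i) z = eexp (γ * b * C (N, z) i) * dens C γ N φ z := by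
  rw [dens, dens, ← eexp_add]; congr 1; ring

lemma GaussField.lintegral_eexp_mul (hμ : GaussField μ C) (i : Site d) (t : ℝ) :
    ∫⁻ φ, eexp (t * φ i) ∂μ = eexp (t ^ 2 / 2 * C i i) := by
  have := hμ.mgf (Finsupp.single i t)
  simp only [linForm_single, covForm_single_single] at this
  rw [this]; congr 1; ring

/-- Decomposition over dyadic shells. -/
lemma KernelBound.sum_nbhd_le (hC : KernelBound C C₀) {b : ℝ} (hb : 0 ≤ b) (m : ℕ)
    (x : EuclideanSpace ℝ (Fin d)) {n : ℕ} (hn : n ≤ N) (f : EuclideanSpace ℝ (Fin d) → ℝ≥0∞) :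
    ∑ y ∈ nbhd S x n, eexp (b * C (N, y) (m, x)) * f y ≤
      eexp (b * (Real.log 2 + C₀)) *
        ∑ j ∈ Finset.Icc n N, eexp (b * (j * Real.log 2)) * ∑ y ∈ nbhd S x j, f y := by
  have key : ∀ y ∈ nbhd S x n, ∃ j ∈ Finset.Icc n N, dist y x ≤ rad j ∧
      C (N, y) (m, x) ≤ (j + 1) * Real.log 2 + C₀ := by
    intro y hy
    rw [mem_nbhd] at hy
    by_cases hN : dist y x ≤ rad N
    · refine ⟨N, Finset.mem_Icc.2 ⟨hn, le_rfl⟩, hN, ?_⟩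
      have := hC.far N N m y x (Or.inr (Or.inl le_rfl))
      linarith [log_two_pos]
    · have hex : ∃ j, n ≤ j ∧ ¬ dist y x ≤ rad j := ⟨N, hn, hN⟩
      classical
      obtain ⟨hj1, hj2⟩ := Nat.find_spec hex
      set j := Nat.find hex
      have hjN : j ≤ N := Nat.find_min' hex ⟨hn, hN⟩
      have hjn : n < j := lt_of_le_of_ne hj1 fun h => hj2 (h ▸ hy.2)
      obtain ⟨k, hk⟩ : ∃ k, j = k + 1 := ⟨j - 1, by omega⟩
      have hk2 : dist y x ≤ rad k := by
        by_contra h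
        have := Nat.find_min hex (m := k) (by omega)
        exact this ⟨by omega, h⟩
      refine ⟨k, Finset.mem_Icc.2 ⟨by omega, by omega⟩, hk2, ?_⟩
      have := hC.far j N m y x (Or.inl (not_le.1 hj2).le)
      rw [hk] at this
      push_cast at this
      exact this
  calc ∑ y ∈ nbhd S x n, eexp (b * C (N, y) (m, x)) * f y
      ≤ ∑ y ∈ nbhd S x n, ∑ j ∈ Finset.Icc n N,
          if dist y x ≤ rad j then eexp (b * (Real.log 2 + C₀)) *
            (eexp (b * (j * Real.log 2)) * f y) else 0 := by
        refine Finset.sum_le_sum fun y hy => ?_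
        obtain ⟨j, hj, hj1, hj2⟩ := key y hy
        refine le_trans ?_ (Finset.single_le_sum (f := fun j : ℕ =>
          if dist y x ≤ rad j then eexp (b * (Real.log 2 + C₀)) *
            (eexp (b * (j * Real.log 2)) * f y) else 0) (fun _ _ => zero_le) hj)
        simp only [hj1, if_true]
        rw [← mul_assoc, ← eexp_add]
        refine mul_le_mul_left (eexp_le ?_) _
        nlinarith
    _ = eexp (b * (Real.log 2 + C₀)) * ∑ j ∈ Finset.Icc n N, ∑ y ∈ nbhd S x n,
          if dist y x ≤ rad j then (eexp (b * (j * Real.log 2)) * f y) else 0 := by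
        rw [Finset.sum_comm]
        simp only [Finset.mul_sum, mul_ite, mul_zero]
    _ ≤ _ := by
        refine mul_le_mul_right (Finset.sum_le_sum fun j hj => ?_) _
        rw [← Finset.sum_filter, ← Finset.mul_sum]
        refine mul_le_mul_right (Finset.sum_le_sum_of_subset fun y hy => ?_) _
        simp only [Finset.mem_filter, mem_nbhd] at hy ⊢
        exact ⟨hy.1.1, hy.2⟩

/-- The exponent of the moment of order `p` of the chaos. -/
def momExp (d : ℕ) (γ p : ℝ) : ℝ := (d + γ ^ 2 / 2) * p - γ ^ 2 / 2 * p ^ 2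

/-- Moments of a tilted mass, given the moments of the masses. -/
lemma KernelBound.exists_lintegral_tilted_le (hC : KernelBound C C₀) {s ξ b c : ℝ} (hs : 0 < s)
    (hb : 0 ≤ b) (h : 0 < ξ - b * s) :
    ∃ c' : ℝ, ∀ (μ : Measure (Site d → ℝ)) (S : Finset (EuclideanSpace ℝ (Fin d)))
      (w : ℝ≥0∞) (N : ℕ) (x : EuclideanSpace ℝ (Fin d)) (n m : ℕ), n ≤ N →
      (∀ j ≤ N, ∫⁻ φ, mass C γ w N φ (nbhd S x j) ^ s ∂μ ≤ eexp (c - j * ξ * Real.log 2)) →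
      ∫⁻ φ, (∑ y ∈ nbhd S x n, eexp (b * C (N, y) (m, x)) * (w * dens C γ N φ y)) ^ s ∂μ ≤
        eexp (c' - n * (ξ - b * s) * Real.log 2) := by
  obtain ⟨G, hG⟩ := exists_lintegral_sum_rpow_le hs h
  refine ⟨s * (b * (Real.log 2 + C₀)) + (G + c), fun μ S w N x n m hn hmom => ?_⟩
  have := hG μ c n N (fun j φ => mass C γ w N φ (nbhd S x j))
    (fun j => measurable_mass C γ w N _) (fun j hj => hmom j (Finset.mem_Icc.1 hj).2)
  calc _ ≤ ∫⁻ φ, eexp (s * (b * (Real.log 2 + C₀))) * (∑ j ∈ Finset.Icc n N,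
          eexp (b * (j * Real.log 2)) * mass C γ w N φ (nbhd S x j)) ^ s ∂μ := by
        refine lintegral_mono fun φ => ?_
        refine (ENNReal.rpow_le_rpow (hC.sum_nbhd_le hb m x hn _) hs.le).trans ?_
        rw [ENNReal.mul_rpow_of_nonneg _ _ hs.le, eexp_rpow]
        rfl
    _ ≤ _ := by
        have hm := fun T => measurable_mass C γ w N T
        rw [lintegral_const_mul _ (by fun_prop)]
        refine (mul_le_mul_right this _).trans (le_of_eq ?_)
        rw [← eexp_add]; congr 1; ring

/-- Small moments of the masses. -/
lemma exists_lintegral_mass_rpow_le_of_le_one (hC : KernelBound C C₀) (C₁ : ℝ) (hγ : 0 ≤ γ) {t : ℝ}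
    (ht : 0 < t) (ht1 : t ≤ 1) :
    ∃ c : ℝ, ∀ (μ : Measure (Site d → ℝ)), GaussField μ C →
        ∀ (S : Finset (EuclideanSpace ℝ (Fin d)))
      (w : ℝ≥0∞) (N : ℕ), UpperGrid S w N C₁ → ∀ x ∈ S, ∀ n ≤ N,
      ∫⁻ φ, mass C γ w N φ (nbhd S x n) ^ t ∂μ ≤ eexp (c - n * momExp d γ t * Real.log 2) := by
  have h0 : 0 ≤ 1 - t := by linarith
  set b := γ * (1 - t) with hb
  have hb0 : 0 ≤ b := by positivity
  refine ⟨t * (b ^ 2 / 2 * C₀ + γ * b * C₀ + C₁) + (1 - t) * ((t * γ) ^ 2 / 2 * C₀),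
    fun μ hμ S w N hS x hx n hn => ?_⟩
  have hvar : C (n, x) (n, x) ≤ n * Real.log 2 + C₀ := hC.far n n n x x (Or.inr (Or.inl le_rfl))
  have hmm := measurable_mass C γ w N (nbhd S x n)
  have hm1 : ∀ s : ℝ, Measurable fun φ : Site d → ℝ => eexp (s * φ (n, x)) :=
    fun s => measurable_eexp.comp (by fun_prop)
  have e1 : ∫⁻ φ, eexp (-b * φ (n, x)) * mass C γ w N φ (nbhd S x n) ∂μ ≤
      eexp (b ^ 2 / 2 * (n * Real.log 2 + C₀) - γ * b * (n * Real.log 2 - C₀)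
        + (C₁ - n * d * Real.log 2)) := by
    simp only [mass, Finset.mul_sum]
    have hd := fun y => measurable_dens C γ N y
    have := hm1 (-b)
    rw [lintegral_finsetSum _ (by fun_prop)]
    calc _ ≤ ∑ y ∈ nbhd S x n, w * eexp (b ^ 2 / 2 * (n * Real.log 2 + C₀) -
            γ * b * (n * Real.log 2 - C₀)) := by
          refine Finset.sum_le_sum fun y hy => ?_
          rw [mem_nbhd] at hy
          have e2 : ∀ φ, eexp (-b * φ (n, x)) * (w * dens C γ N φ y) =
              w * (dens C γ N φ y * eexp (-b * φ (n, x))) := fun φ => by ring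
          simp only [e2]
          rw [lintegral_const_mul _ (by fun_prop), hμ.lintegral_dens_mul y (hm1 _)]
          simp only [mul_add, eexp_add]
          rw [lintegral_mul_const _ (hm1 _), hμ.lintegral_eexp_mul, ← eexp_add]
          refine mul_le_mul_right (eexp_le ?_) _
          have := hC.near n n N x y (by rw [dist_comm]; exact hy.2) le_rfl hn
          have h1 : γ * b * (n * Real.log 2 - C₀) ≤ γ * b * C (n, x) (N, y) :=
            mul_le_mul_of_nonneg_left this (by positivity)
          have h2 : b ^ 2 / 2 * C (n, x) (n, x) ≤ b ^ 2 / 2 * (n * Real.log 2 + C₀) :=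
            mul_le_mul_of_nonneg_left hvar (by positivity)
          nlinarith
      _ = (w * (nbhd S x n).card) * eexp (b ^ 2 / 2 * (n * Real.log 2 + C₀) -
            γ * b * (n * Real.log 2 - C₀)) := by
          rw [Finset.sum_const, nsmul_eq_mul]; ring
      _ ≤ _ := by
          refine (mul_le_mul_left (hS.reg x hx n hn) _).trans (le_of_eq ?_)
          rw [← eexp_add]; congr 1; ring
  calc ∫⁻ φ, mass C γ w N φ (nbhd S x n) ^ t ∂μ
      = ∫⁻ φ, (eexp (-b * φ (n, x)) * mass C γ w N φ (nbhd S x n)) ^ t *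
          eexp (t * γ * φ (n, x)) ^ (1 - t) ∂μ := by
        refine lintegral_congr fun φ => ?_
        rw [ENNReal.mul_rpow_of_nonneg _ _ ht.le, eexp_rpow, eexp_rpow, mul_right_comm, ← eexp_add,
          show t * (-b * φ (n, x)) + (1 - t) * (t * γ * φ (n, x)) = 0 by rw [hb]; ring,
          eexp_zero, one_mul]
    _ ≤ (∫⁻ φ, eexp (-b * φ (n, x)) * mass C γ w N φ (nbhd S x n) ∂μ) ^ t *
          (∫⁻ φ, eexp (t * γ * φ (n, x)) ∂μ) ^ (1 - t) := by
        have := hm1 (-b)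
        exact ENNReal.lintegral_mul_norm_pow_le (by fun_prop) (hm1 _).aemeasurable ht.le h0
            (by ring)
    _ ≤ eexp (t * (b ^ 2 / 2 * (n * Real.log 2 + C₀) - γ * b * (n * Real.log 2 - C₀)
        + (C₁ - n * d * Real.log 2)))
        * eexp ((1 - t) * ((t * γ) ^ 2 / 2 * (n * Real.log 2 + C₀))) := by
        refine mul_le_mul' ((ENNReal.rpow_le_rpow e1 ht.le).trans (eexp_rpow _ _).le) ?_
        rw [hμ.lintegral_eexp_mul, eexp_rpow]
        exact eexp_le (mul_le_mul_of_nonneg_left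
          (mul_le_mul_of_nonneg_left hvar (by positivity)) h0)
    _ = _ := by
        rw [← eexp_add, momExp]; congr 1; rw [hb]; ring

/-- Moments of the masses below the critical order. -/
lemma exists_lintegral_mass_rpow_le (hC : KernelBound C C₀) (C₁ : ℝ) (hγ : 0 ≤ γ) {p : ℝ}
    (hp : 0 < p) (hp1 : p ≤ 1 ∨ γ ^ 2 * p < 2 * d) :
    ∃ c : ℝ, ∀ (μ : Measure (Site d → ℝ)), GaussField μ C →
        ∀ (S : Finset (EuclideanSpace ℝ (Fin d)))
      (w : ℝ≥0∞) (N : ℕ), UpperGrid S w N C₁ → ∀ x ∈ S, ∀ n ≤ N,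
      ∫⁻ φ, mass C γ w N φ (nbhd S x n) ^ p ∂μ ≤ eexp (c - n * momExp d γ p * Real.log 2) := by
  obtain ⟨k, hk⟩ := exists_nat_ge p
  induction k generalizing p with
  | zero => exact absurd hk (by simpa using hp)
  | succ k ih =>
    by_cases hle : p ≤ 1
    · exact exists_lintegral_mass_rpow_le_of_le_one hC C₁ hγ hp hle
    have hpd : γ ^ 2 * p < 2 * d := hp1.resolve_left hle
    rw [not_le] at hle
    have hp' : 0 < p - 1 := by linarith
    obtain ⟨c, hc⟩ := ih hp' (Or.inr (by nlinarith [sq_nonneg γ])) (by push_cast at hk; linarith)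
    have hξ : momExp d γ (p - 1) - γ ^ 2 * (p - 1) = momExp d γ p - d := by
      simp only [momExp]; ring
    have hξ0 : 0 < momExp d γ (p - 1) - γ ^ 2 * (p - 1) := by
      rw [show momExp d γ (p - 1) - γ ^ 2 * (p - 1) = (p - 1) * (2 * d - γ ^ 2 * p) / 2 by
        simp only [momExp]; ring]
      have : 0 < 2 * d - γ ^ 2 * p := by linarith
      positivity
    obtain ⟨c', hc'⟩ := hC.exists_lintegral_tilted_le (γ := γ) (c := c) hp' (sq_nonneg γ) hξ0
    refine ⟨C₁ + c' + (momExp d γ (p - 1) - γ ^ 2 * (p - 1)) * Real.log 2,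
      fun μ hμ S w N hS x hx n hn => ?_⟩
    have hd := fun y => measurable_dens C γ N y
    have hm := measurable_mass C γ w N (nbhd S x n)
    calc ∫⁻ φ, mass C γ w N φ (nbhd S x n) ^ p ∂μ
        = ∫⁻ φ, ∑ y ∈ nbhd S x n, w * (dens C γ N φ y *
            mass C γ w N φ (nbhd S x n) ^ (p - 1)) ∂μ := by
          refine lintegral_congr fun φ => ?_
          rw [show p = 1 + (p - 1) by ring, ENNReal.rpow_add_of_nonneg _ _ zero_le_one hp'.le,
            ENNReal.rpow_one, show 1 + (p - 1) - 1 = p - 1 by ring]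
          conv_lhs => rw [mass, Finset.sum_mul]
          simp only [mul_assoc]
          rfl
      _ = ∑ y ∈ nbhd S x n, w * ∫⁻ φ, mass C γ w N (fun i => φ i + γ * C i (N, y))
            (nbhd S x n) ^ (p - 1) ∂μ := by
          rw [lintegral_finsetSum _ (by fun_prop)]
          refine Finset.sum_congr rfl fun y _ => ?_
          rw [lintegral_const_mul _ (by fun_prop), hμ.lintegral_dens_mul y (by fun_prop)]
      _ ≤ ∑ y ∈ nbhd S x n, w * eexp (c' - (n - 1 : ℕ) *
            (momExp d γ (p - 1) - γ ^ 2 * (p - 1)) * Real.log 2) := by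
          refine Finset.sum_le_sum fun y hy => mul_le_mul_right ?_ _
          have hyS : y ∈ S := (mem_nbhd.1 hy).1
          refine le_trans (lintegral_mono fun φ => ENNReal.rpow_le_rpow ?_ hp'.le)
            (hc' μ S w N y (n - 1) N (by omega) fun j hj => hc μ hμ S w N hS y hyS j hj)
          refine (mass_mono (hS.nbhd_subset_pred hy) _).trans (le_of_eq ?_)
          rw [mass]
          refine Finset.sum_congr rfl fun z _ => ?_
          rw [dens_shift, sq]; ring
      _ = (w * (nbhd S x n).card) * eexp (c' - (n - 1 : ℕ) *
            (momExp d γ (p - 1) - γ ^ 2 * (p - 1)) * Real.log 2) := by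
          rw [Finset.sum_const, nsmul_eq_mul]; ring
      _ ≤ eexp (C₁ - n * d * Real.log 2) * eexp (c' - (n - 1) *
            (momExp d γ (p - 1) - γ ^ 2 * (p - 1)) * Real.log 2) := by
          refine mul_le_mul' (hS.reg x hx n hn) (eexp_le ?_)
          have h1 : (n : ℝ) - 1 ≤ (n - 1 : ℕ) := by
            rw [sub_le_iff_le_add]; exact_mod_cast (by omega : n ≤ n - 1 + 1)
          have := mul_nonneg hξ0.le log_two_pos.le
          nlinarith
      _ = _ := by
          rw [← eexp_add, hξ]; congr 1; ring

end Chaos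

section Concentration

open scoped ContDiff InnerProductSpace Pointwise

lemma ofReal_sq_integral_le {h : ℝ → ℝ} (hc : Continuous h) {T : ℝ} (hT : 0 ≤ T) :
    ENNReal.ofReal ((∫ θ in (0 : ℝ)..T, h θ) ^ 2) ≤
      ENNReal.ofReal T * ∫⁻ θ in Set.Ioc 0 T, ENNReal.ofReal (h θ ^ 2) := by
  have e1 : ENNReal.ofReal ((∫ θ in (0 : ℝ)..T, h θ) ^ 2) ≤
      (∫⁻ θ in Set.Ioc 0 T, ‖h θ‖ₑ) ^ (2 : ℝ) := by
    rw [← sq_abs, ENNReal.ofReal_pow (abs_nonneg _), ← Real.enorm_eq_ofReal_abs,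
      intervalIntegral.integral_of_le hT, ← ENNReal.rpow_two]
    exact ENNReal.rpow_le_rpow (enorm_integral_le_lintegral_enorm _) zero_le_two
  refine e1.trans ?_
  have e2 := ENNReal.lintegral_mul_le_Lp_mul_Lq (volume.restrict (Set.Ioc 0 T))
    Real.HolderConjugate.two_two (f := fun θ => ‖h θ‖ₑ) (g := fun _ => 1)
    hc.enorm.measurable.aemeasurable aemeasurable_const
  simp only [Pi.mul_apply, mul_one, ENNReal.one_rpow, lintegral_const, MeasurableSet.univ,
    Measure.restrict_apply, Set.univ_inter, Real.volume_Ioc, sub_zero, one_mul] at e2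
  refine (ENNReal.rpow_le_rpow e2 zero_le_two).trans (le_of_eq ?_)
  rw [ENNReal.mul_rpow_of_nonneg _ _ zero_le_two, ← ENNReal.rpow_mul, ← ENNReal.rpow_mul]
  norm_num
  rw [mul_comm]
  congr 1
  refine lintegral_congr fun θ => ?_
  rw [Real.enorm_eq_ofReal_abs, ← ENNReal.ofReal_pow (abs_nonneg _), sq_abs]

lemma exists_contDiff_lipschitz_approx {E : Type*} [NormedAddCommGroup E] [InnerProductSpace ℝ E]
    [FiniteDimensional ℝ E] {f : E → ℝ} (hf : LipschitzWith 1 f) {ε : ℝ} (hε : 0 < ε) :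
    ∃ g : E → ℝ, ContDiff ℝ 1 g ∧ LipschitzWith 1 g ∧ ∀ x, |g x - f x| ≤ ε := by
  borelize E
  set ψ : ContDiffBump (0 : E) := ⟨ε / 2, ε, half_pos hε, half_lt_self hε⟩
  set ρ : Measure E := Measure.addHaar
  set g : E → ℝ := convolution (ψ.normed ρ) f (ContinuousLinearMap.lsmul ℝ ℝ) ρ with hg
  have hcd : ContDiff ℝ 1 g := ψ.hasCompactSupport_normed.contDiff_convolution_left _
    ψ.contDiff_normed hf.continuous.locallyIntegrable
  refine ⟨g, hcd, ?_, fun x => ?_⟩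
  · refine LipschitzWith.of_dist_le_mul fun x y => ?_
    have hi : ∀ x, Integrable (fun t => ψ.normed ρ t • f (x - t)) ρ := fun x =>
      (ψ.continuous_normed.smul (hf.continuous.comp (by fun_prop))).integrable_of_hasCompactSupport
        ψ.hasCompactSupport_normed.smul_right
    have h1 : ∀ x, g x = ∫ t, ψ.normed ρ t • f (x - t) ∂ρ := fun x => by
      simp [hg, convolution]
    rw [Real.dist_eq, h1, h1, ← integral_sub (hi x) (hi y)]
    have h2 : ∀ t, ‖ψ.normed ρ t • f (x - t) - ψ.normed ρ t • f (y - t)‖ ≤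
        ψ.normed ρ t * dist x y := by
      intro t
      rw [← smul_sub, norm_smul, Real.norm_of_nonneg (ψ.nonneg_normed t)]
      refine mul_le_mul_of_nonneg_left ?_ (ψ.nonneg_normed t)
      simpa [dist_eq_norm] using hf.dist_le_mul (x - t) (y - t)
    refine (norm_integral_le_of_norm_le (ψ.integrable_normed.mul_const _) (ae_of_all _ h2)).trans ?_
    rw [integral_mul_const, ψ.integral_normed]
    simp
  · have := ψ.dist_normed_convolution_le (μ := ρ) (x₀ := x) (ε := ε) (g := f)
      hf.continuous.aestronglyMeasurable (fun y hy => by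
        have := hf.dist_le_mul y x
        simp only [NNReal.coe_one, one_mul] at this
        exact this.trans (Metric.mem_ball.1 hy).le)
    simpa [Real.dist_eq] using this

variable {E : Type*} [NormedAddCommGroup E] [InnerProductSpace ℝ E] [FiniteDimensional ℝ E]
  [MeasurableSpace E] [BorelSpace E]

lemma lintegral_sq_dual_stdGaussian (L : StrongDual ℝ E) :
    ∫⁻ x, ENNReal.ofReal (L x ^ 2) ∂stdGaussian E = ENNReal.ofReal (‖L‖ ^ 2) := by
  have hv := variance_dual_stdGaussian L
  have hm : MemLp L 2 (stdGaussian E) := IsGaussian.memLp_dual _ L 2 (by simp)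
  rw [← ofReal_integral_eq_lintegral_ofReal hm.integrable_sq (ae_of_all _ fun x => sq_nonneg _)]
  rw [variance_of_integral_eq_zero hm.aestronglyMeasurable.aemeasurable
    (integral_strongDual_stdGaussian L)] at hv
  rw [hv]

lemma lintegral_sub_sq_le_of_contDiff {f : E → ℝ} (hf : ContDiff ℝ 1 f) (hL : LipschitzWith 1 f) :
    ∫⁻ p, ENNReal.ofReal ((f p.1 - f p.2) ^ 2) ∂((stdGaussian E).prod (stdGaussian E)) ≤
      ENNReal.ofReal (Real.pi / 2) ^ 2 := by
  set ν := (stdGaussian E).prod (stdGaussian E)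
  set H := fun (p : E × E) => fderiv ℝ f p.1 p.2 with hH
  have hdf : Continuous fun x => fderiv ℝ f x := hf.continuous_fderiv (by norm_num)
  have hHc : Continuous H := by
    have : Continuous fun p : E × E => fderiv ℝ f p.1 := hdf.comp continuous_fst
    exact this.clm_apply continuous_snd
  have hcont : ∀ p : E × E, Continuous fun θ : ℝ => H (ContinuousLinearMap.rotation θ p) := by
    intro p
    have : Continuous fun θ : ℝ => ContinuousLinearMap.rotation θ p := by
      simp only [ContinuousLinearMap.rotation_apply]
      fun_prop
    exact hHc.comp this
  have hFTC : ∀ p : E × E, f p.2 - f p.1 =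
      ∫ θ in (0 : ℝ)..(Real.pi / 2), H (ContinuousLinearMap.rotation θ p) := by
    intro p
    have hder : ∀ θ : ℝ, HasDerivAt (fun θ : ℝ => f (Real.cos θ • p.1 + Real.sin θ • p.2))
        (H (ContinuousLinearMap.rotation θ p)) θ := by
      intro θ
      have h1 : HasDerivAt (fun θ : ℝ => Real.cos θ • p.1 + Real.sin θ • p.2)
          (-Real.sin θ • p.1 + Real.cos θ • p.2) θ :=
        ((Real.hasDerivAt_cos θ).smul_const p.1).add ((Real.hasDerivAt_sin θ).smul_const p.2)
      exact ((hf.differentiable (by norm_num)).differentiableAt.hasFDerivAt).comp_hasDerivAt θ h1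
    rw [intervalIntegral.integral_eq_sub_of_hasDerivAt (fun θ _ => hder θ)]
    · simp
    · exact (hcont p).intervalIntegrable _ _
  have hpi : 0 ≤ Real.pi / 2 := by positivity
  have hbound : ∀ p : E × E, ENNReal.ofReal ((f p.1 - f p.2) ^ 2) ≤
      ENNReal.ofReal (Real.pi / 2) * ∫⁻ θ in Set.Ioc 0 (Real.pi / 2),
        ENNReal.ofReal (H (ContinuousLinearMap.rotation θ p) ^ 2) := by
    intro p
    have := ofReal_sq_integral_le (hcont p) hpi
    rw [← hFTC p] at this
    rwa [show (f p.1 - f p.2) ^ 2 = (f p.2 - f p.1) ^ 2 by ring]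
  have hmeas : Measurable fun q : (E × E) × ℝ =>
      ENNReal.ofReal (H (ContinuousLinearMap.rotation q.2 q.1) ^ 2) := by
    have h1 : Continuous fun q : (E × E) × ℝ => ContinuousLinearMap.rotation q.2 q.1 := by
      simp only [ContinuousLinearMap.rotation_apply]
      fun_prop
    have h2 : Continuous fun q : (E × E) × ℝ => H (ContinuousLinearMap.rotation q.2 q.1) :=
      hHc.comp h1
    exact (h2.pow 2).measurable.ennreal_ofReal
  have hrot : ∀ θ : ℝ, ∫⁻ p, ENNReal.ofReal (H (ContinuousLinearMap.rotation θ p) ^ 2) ∂ν ≤ 1 := by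
    intro θ
    have hmap := IsGaussian.map_rotation_eq_self_of_forall_strongDual_eq_zero (μ := stdGaussian E)
      integral_strongDual_stdGaussian θ
    have hm2 : Measurable fun p => ENNReal.ofReal (H p ^ 2) :=
      (hHc.pow 2).measurable.ennreal_ofReal
    calc ∫⁻ p, ENNReal.ofReal (H (ContinuousLinearMap.rotation θ p) ^ 2) ∂ν
        = ∫⁻ p, ENNReal.ofReal (H p ^ 2) ∂(ν.map (ContinuousLinearMap.rotation θ)) :=
          (lintegral_map hm2 (by fun_prop)).symm
      _ = ∫⁻ p, ENNReal.ofReal (H p ^ 2) ∂ν := by rw [hmap]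
      _ = ∫⁻ x, ∫⁻ y, ENNReal.ofReal (fderiv ℝ f x y ^ 2) ∂stdGaussian E ∂stdGaussian E :=
          lintegral_prod _ hm2.aemeasurable
      _ ≤ ∫⁻ _, 1 ∂stdGaussian E := by
          refine lintegral_mono fun x => ?_
          simp only []
          rw [lintegral_sq_dual_stdGaussian]
          have := norm_fderiv_le_of_lipschitz ℝ hL (x₀ := x)
          simp only [NNReal.coe_one] at this
          refine ENNReal.ofReal_le_one.2 ?_
          exact pow_le_one₀ (norm_nonneg _) this
      _ = 1 := by simp
  calc _ ≤ ∫⁻ p, ENNReal.ofReal (Real.pi / 2) * (∫⁻ θ in Set.Ioc 0 (Real.pi / 2),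
        ENNReal.ofReal (H (ContinuousLinearMap.rotation θ p) ^ 2)) ∂ν := lintegral_mono hbound
    _ = ENNReal.ofReal (Real.pi / 2) * ∫⁻ θ in Set.Ioc 0 (Real.pi / 2), (∫⁻ p,
        ENNReal.ofReal (H (ContinuousLinearMap.rotation θ p) ^ 2) ∂ν) := by
        rw [lintegral_const_mul _ hmeas.lintegral_prod_right',
          lintegral_lintegral_swap hmeas.aemeasurable]
    _ ≤ ENNReal.ofReal (Real.pi / 2) * ∫⁻ θ in Set.Ioc 0 (Real.pi / 2), 1 := by
        gcongr with θ; exact hrot θ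
    _ = _ := by
        simp [sq]

lemma lintegral_sub_sq_le {f : E → ℝ} (hf : LipschitzWith 1 f) :
    ∫⁻ p, ENNReal.ofReal ((f p.1 - f p.2) ^ 2) ∂((stdGaussian E).prod (stdGaussian E)) ≤ 16 := by
  obtain ⟨g, hg, hgl, hgf⟩ := exists_contDiff_lipschitz_approx hf (ε := 1 / 2) (by norm_num)
  have h1 := lintegral_sub_sq_le_of_contDiff hg hgl
  have h2 : ∀ p : E × E, ENNReal.ofReal ((f p.1 - f p.2) ^ 2) ≤
      2 * ENNReal.ofReal ((g p.1 - g p.2) ^ 2) + 2 := by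
    intro p
    have : (f p.1 - f p.2) ^ 2 ≤ 2 * (g p.1 - g p.2) ^ 2 + 2 := by
      have h3 := abs_le.1 (hgf p.1)
      have h4 := abs_le.1 (hgf p.2)
      nlinarith [sq_nonneg ((f p.1 - f p.2) - 2 * (g p.1 - g p.2)),
        sq_nonneg (g p.1 - f p.1 - (g p.2 - f p.2))]
    refine (ENNReal.ofReal_le_ofReal this).trans (le_of_eq ?_)
    rw [ENNReal.ofReal_add (by positivity) (by norm_num), ENNReal.ofReal_mul (by norm_num)]
    norm_num
  have hm : Measurable fun p : E × E => ENNReal.ofReal ((g p.1 - g p.2) ^ 2) := by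
    have := hg.continuous.measurable
    fun_prop
  refine (lintegral_mono h2).trans ?_
  rw [lintegral_add_right _ measurable_const, lintegral_const_mul _ hm]
  simp only [lintegral_const, measure_univ, mul_one]
  calc 2 * _ + (2 : ℝ≥0∞) ≤ 2 * ENNReal.ofReal (Real.pi / 2) ^ 2 + 2 := by gcongr
    _ ≤ 2 * ENNReal.ofReal 2 ^ 2 + 2 := by
        gcongr; linarith [Real.pi_le_four]
    _ ≤ 16 := by norm_num

/-- Concentration of the standard Gaussian measure around sets of positive measure. -/
lemma stdGaussian_infDist_le (A : Set E) {t : ℝ} (ht : 0 < t) :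
    stdGaussian E A * stdGaussian E {x | t ≤ Metric.infDist x A} ≤ ENNReal.ofReal (16 / t ^ 2) := by
  have h := lintegral_sub_sq_le (E := E) (Metric.lipschitz_infDist_pt A)
  rw [← Measure.prod_prod]
  have hsub : A ×ˢ {x | t ≤ Metric.infDist x A} ⊆ {p : E × E | ENNReal.ofReal (t ^ 2) ≤
      ENNReal.ofReal ((Metric.infDist p.1 A - Metric.infDist p.2 A) ^ 2)} := by
    rintro ⟨x, y⟩ ⟨hx, hy⟩
    simp only [Set.mem_ofPred_eq] at hx hy ⊢
    rw [Metric.infDist_zero_of_mem hx]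
    refine ENNReal.ofReal_le_ofReal ?_
    nlinarith
  refine (measure_mono hsub).trans ?_
  have hm : Measurable fun p : E × E =>
      ENNReal.ofReal ((Metric.infDist p.1 A - Metric.infDist p.2 A) ^ 2) := by
    have := (Metric.continuous_infDist_pt A).measurable
    fun_prop
  refine (meas_ge_le_lintegral_div hm.aemeasurable
    (ENNReal.ofReal_pos.2 (by positivity)).ne' ENNReal.ofReal_ne_top).trans ?_
  rw [ENNReal.ofReal_div_of_pos (by positivity)]
  gcongr
  simpa using h

lemma lintegral_eexp_gaussianReal (v : ℝ≥0) :
    ∫⁻ x, eexp x ∂gaussianReal 0 v = eexp (v / 2) := by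
  have h := mgf_id_gaussianReal (μ := 0) (v := v)
  have h1 := congrFun h 1
  simp only [mgf, id, one_mul, one_pow, mul_one, zero_add] at h1
  simp only [eexp]
  rw [← h1, ofReal_integral_eq_lintegral_ofReal _ (ae_of_all _ fun x => (Real.exp_pos x).le)]
  simpa using integrable_exp_mul_gaussianReal (μ := 0) (v := v) 1

lemma lintegral_eexp_dual_stdGaussian (L : StrongDual ℝ E) :
    ∫⁻ x, eexp (L x) ∂stdGaussian E = eexp (‖L‖ ^ 2 / 2) := by
  have h := IsGaussian.map_eq_gaussianReal (μ := stdGaussian E) L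
  rw [integral_strongDual_stdGaussian, variance_dual_stdGaussian] at h
  rw [← lintegral_map measurable_eexp (by fun_prop), h, lintegral_eexp_gaussianReal,
    Real.coe_toNNReal _ (by positivity)]

variable {ι : Type*} {μ : Measure (ι → ℝ)} {C : ι → ι → ℝ}

lemma linForm_finset_sum {J : Type*} (s : Finset J) (l : J → ι →₀ ℝ) (x : ι → ℝ) :
    linForm (∑ j ∈ s, l j) x = ∑ j ∈ s, linForm (l j) x := by simp [linForm]

lemma GaussField.covForm_self_nonneg (hμ : GaussField μ C) (l : ι →₀ ℝ) :
    0 ≤ covForm C l l := by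
  have := hμ.isProbabilityMeasure
  have h1 := hμ.mgf l
  have h2 := hμ.mgf (-l)
  have h3 : covForm C (-l) (-l) = covForm C l l := by simp [covForm, linForm_eq_sum]
  rw [h3] at h2
  have h4 : (2 : ℝ≥0∞) ≤ eexp (covForm C l l / 2) + eexp (covForm C l l / 2) := by
    rw [← h1]
    nth_rewrite 2 [h1]
    rw [← h2, ← lintegral_add_left (measurable_eexp_linForm l)]
    calc (2 : ℝ≥0∞) = ∫⁻ _, 2 ∂μ := by simp
      _ ≤ _ := by
        refine lintegral_mono fun x => ?_
        have : linForm (-l) x = - linForm l x := by simp [linForm]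
        rw [this, eexp, eexp, ← ENNReal.ofReal_add (Real.exp_pos _).le (Real.exp_pos _).le,
          ← ENNReal.ofReal_ofNat]
        refine ENNReal.ofReal_le_ofReal ?_
        have := Real.add_one_le_exp (linForm l x)
        have := Real.add_one_le_exp (-linForm l x)
        linarith
  rw [← two_mul] at h4
  have h5 : eexp 0 ≤ eexp (covForm C l l / 2) := by
    rw [eexp_zero]
    by_contra h
    rw [not_le] at h
    have := ENNReal.mul_lt_mul_right (a := 2) (by norm_num) (by norm_num) h
    rw [mul_one] at this
    exact absurd h4 (not_le.2 this)
  have := eexp_le_iff.1 h5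
  linarith

/-- Concentration for finitely many linear functionals of a Gaussian field: with high probability
they are close, in the Cameron–Martin sense, to a given set of positive probability. -/
lemma GaussField.concentration (hμ : GaussField μ C) {A : Type*} [Fintype A] (l : A → ι →₀ ℝ)
    {T : Set (A → ℝ)} (hT : MeasurableSet T) {t : ℝ} (ht : 0 < t) :
    μ {x | (fun a => linForm (l a) x) ∈ T} * μ {x | ∀ v ∈ T, ∃ m : A → ℝ,
      t * √(∑ a, ∑ b, m a * m b * covForm C (l a) (l b)) < |∑ a, m a * (linForm (l a) x - v a)|} ≤
    ENNReal.ofReal (16 / t ^ 2) := by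
  classical
  have := hμ.isProbabilityMeasure
  set Q : (A → ℝ) → ℝ := fun m => ∑ a, ∑ b, m a * m b * covForm C (l a) (l b) with hQ
  have hQcov : ∀ m : A → ℝ, Q m = covForm C (∑ a, m a • l a) (∑ a, m a • l a) := by
    intro m
    have e : ∀ p : ι →₀ ℝ, covForm C (∑ a, m a • l a) p = ∑ a, m a * covForm C (l a) p := by
      intro p; simp only [covForm, linForm_finset_sum, linForm_smul]
    rw [e]
    refine Finset.sum_congr rfl fun a _ => ?_
    rw [covForm_comm hμ.symm, e, Finset.mul_sum]
    refine Finset.sum_congr rfl fun b _ => ?_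
    rw [covForm_comm hμ.symm]; ring
  have hpsd : (Matrix.of fun a b => covForm C (l a) (l b)).PosSemidef := by
    refine Matrix.PosSemidef.of_dotProduct_mulVec_nonneg ?_ fun m => ?_
    · ext a b
      simp [Matrix.conjTranspose_apply, covForm_comm hμ.symm (l b) (l a)]
    · have : star m ⬝ᵥ (Matrix.of fun a b => covForm C (l a) (l b)).mulVec m = Q m := by
        simp only [hQ, dotProduct, Matrix.mulVec, Finset.mul_sum, Matrix.of_apply, star_trivial]
        exact Finset.sum_congr rfl fun a _ => Finset.sum_congr rfl fun b _ => by ring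
      rw [this, hQcov]
      exact hμ.covForm_self_nonneg _
  obtain ⟨k, v, hv⟩ := Matrix.posSemidef_iff_eq_sum_vecMulVec.1 hpsd
  set u : A → EuclideanSpace ℝ (Fin k) := fun a => WithLp.toLp 2 fun i => v i a with hu
  have hin : ∀ a b, inner ℝ (u a) (u b) = covForm C (l a) (l b) := by
    intro a b
    have := congrFun (congrFun hv a) b
    simp only [Matrix.of_apply, Matrix.sum_apply, Matrix.vecMulVec_apply, star_trivial] at this
    rw [this, hu, EuclideanSpace.inner_eq_star_dotProduct]
    simp [dotProduct, mul_comm]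
  have hnorm : ∀ m : A → ℝ, ‖∑ a, m a • u a‖ ^ 2 = Q m := by
    intro m
    rw [← real_inner_self_eq_norm_sq]
    simp only [sum_inner, inner_sum, real_inner_smul_left, real_inner_smul_right, hin, hQ]
    refine Finset.sum_congr rfl fun a _ => Finset.sum_congr rfl fun b _ => ?_
    rw [covForm_comm hμ.symm]; ring
  set Y : (ι → ℝ) → A → ℝ := fun x a => linForm (l a) x with hY
  have hYm : Measurable Y := measurable_pi_lambda _ fun a => measurable_linForm (l a)
  set Z : EuclideanSpace ℝ (Fin k) → A → ℝ := fun X a => inner ℝ (u a) X with hZ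
  have hZm : Measurable Z := by fun_prop
  have hlaw : μ.map Y = (stdGaussian (EuclideanSpace ℝ (Fin k))).map Z := by
    have e1 : ∀ m : A →₀ ℝ, ∫⁻ y, eexp (linForm m y) ∂(μ.map Y) = eexp (Q m / 2) := by
      intro m
      rw [lintegral_map (measurable_eexp_linForm m) hYm, hQcov, ← hμ.mgf]
      refine lintegral_congr fun x => ?_
      rw [linForm_finset_sum, linForm_eq_sum, Finset.sum_subset (Finset.subset_univ _)]
      · simp [linForm_smul, hY]
      · intro a _ ha
        simp [Finsupp.notMem_support_iff.1 ha]
    have e2 : ∀ m : A →₀ ℝ, ∫⁻ y, eexp (linForm m y)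
        ∂((stdGaussian (EuclideanSpace ℝ (Fin k))).map Z) = eexp (Q m / 2) := by
      intro m
      rw [lintegral_map (measurable_eexp_linForm m) hZm, ← hnorm, ← innerSL_apply_norm ℝ,
        ← lintegral_eexp_dual_stdGaussian]
      refine lintegral_congr fun X => ?_
      rw [linForm_eq_sum, Finset.sum_subset (Finset.subset_univ _)]
      · simp [hZ]
      · intro a _ ha
        simp [Finsupp.notMem_support_iff.1 ha]
    refine ext_of_lintegral_eexp (fun m => (e1 m).trans (e2 m).symm) fun m => ?_
    rw [e1]; exact eexp_ne_top _
  refine ENNReal.mul_le_of_forall_lt fun r hr r' hr' => ?_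
  have hr1 : r < μ.map Y T := by rwa [Measure.map_apply hYm hT]
  obtain ⟨K, hKT, hK, hrK⟩ := hT.exists_lt_isCompact hr1
  set B : Set (A → ℝ) := {y | ∀ m : A → ℝ, |∑ a, m a * y a| ≤ t * √(Q m)} with hB
  have hBc : IsClosed B := by
    simp only [hB, Set.ofPred_forall]
    exact isClosed_iInter fun m => isClosed_le (by fun_prop) (by fun_prop)
  have hV : MeasurableSet (K + B)ᶜ := (hBc.add_left_of_isCompact hK).measurableSet.compl
  have hsub : {x | ∀ v ∈ T, ∃ m : A → ℝ, t * √(Q m) < |∑ a, m a * (Y x a - v a)|} ⊆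
      Y ⁻¹' (K + B)ᶜ := by
    rintro x hx ⟨v, hv, b, hb, hvb⟩
    obtain ⟨m, hm⟩ := hx v (hKT hv)
    refine absurd (hb m) (not_le.2 ?_)
    have : ∀ a, Y x a - v a = b a := fun a => by rw [← hvb]; simp
    simpa only [this] using hm
  have hsub2 : Z ⁻¹' (K + B)ᶜ ⊆ {X | t ≤ Metric.infDist X (Z ⁻¹' K)} := by
    intro X hX
    by_contra hlt
    rw [Set.mem_ofPred_eq, not_le] at hlt
    have hne : (Z ⁻¹' K).Nonempty := by
      by_contra hne
      rw [Set.not_nonempty_iff_eq_empty] at hne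
      rw [hlaw, Measure.map_apply hZm hK.measurableSet, hne] at hrK
      simp at hrK
    obtain ⟨X', hX', hd⟩ := (Metric.infDist_lt_iff hne).1 hlt
    refine hX ⟨Z X', hX', Z (X - X'), fun m => ?_, ?_⟩
    · have e3 : ∑ a, m a * Z (X - X') a = inner ℝ (∑ a, m a • u a) (X - X') := by
        simp [hZ, sum_inner, real_inner_smul_left]
      rw [e3, ← hnorm, Real.sqrt_sq (norm_nonneg _)]
      refine (abs_real_inner_le_norm _ _).trans ?_
      rw [mul_comm, ← dist_eq_norm]
      exact mul_le_mul_of_nonneg_right hd.le (norm_nonneg _)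
    · ext a; simp [hZ, inner_sub_right]
  calc r * r' ≤ μ.map Y K * μ (Y ⁻¹' (K + B)ᶜ) :=
        mul_le_mul' hrK.le (hr'.le.trans (measure_mono hsub))
    _ = stdGaussian _ (Z ⁻¹' K) * stdGaussian _ (Z ⁻¹' (K + B)ᶜ) := by
        rw [← Measure.map_apply hYm hV, hlaw, Measure.map_apply hZm hV,
          Measure.map_apply hZm hK.measurableSet]
    _ ≤ _ := (mul_le_mul_right (measure_mono hsub2) _).trans (stdGaussian_infDist_le _ ht)

end Concentration

section LowerTail

lemma two_mul_eexp_sub_one_le (a : ℝ) : 2 * eexp (a - 1) ≤ eexp a := by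
  have h : (2 : ℝ≥0∞) ≤ eexp 1 := by
    rw [eexp, show (2 : ℝ≥0∞) = ENNReal.ofReal 2 by simp]
    exact ENNReal.ofReal_le_ofReal (by linarith [Real.add_one_le_exp (1 : ℝ)])
  calc 2 * eexp (a - 1) ≤ eexp 1 * eexp (a - 1) := mul_le_mul_left h _
    _ = eexp a := by rw [← eexp_add]; congr 1; ring

/-- If `f` exceeds the level `eexp a` in mean and has a controlled moment of order above one, it
exceeds a comparable level with probability bounded below. -/
lemma exists_le_measure_of_moment {t : ℝ} (ht : 0 < t) (a b : ℝ) :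
    ∃ c, ∀ {E : Type} [MeasurableSpace E] (ρ : Measure E) [IsProbabilityMeasure ρ]
      {f h : E → ℝ≥0∞}, Measurable f → Measurable h → (∀ x, f x ≤ h x) →
      eexp a ≤ ∫⁻ x, f x ∂ρ → ∫⁻ x, f x * h x ^ t ∂ρ ≤ eexp b →
      eexp c ≤ ρ {x | eexp (a - 2) ≤ f x} := by
  set L := (b - a + 2) / t with hL
  have htL : t * L = b - a + 2 := by rw [hL]; field_simp
  refine ⟨a - 2 - L, fun {E} _ ρ _ f h hf hh hfh ha hb => ?_⟩
  have hm : MeasurableSet {x | eexp (a - 2) ≤ f x} := measurableSet_le measurable_const hf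
  have e1 : ∀ x, f x ≤ eexp (a - 2) + eexp L * {x | eexp (a - 2) ≤ f x}.indicator 1 x +
      eexp (-(t * L)) * (f x * h x ^ t) := by
    intro x
    by_cases h1 : eexp (a - 2) ≤ f x
    · by_cases h2 : f x ≤ eexp L
      · refine le_add_right (le_add_left ?_)
        rw [Set.indicator_of_mem (by exact h1)]; simpa using h2
      · refine le_add_left ?_
        have h3 : eexp (t * L) ≤ h x ^ t := by
          rw [← eexp_rpow]
          exact ENNReal.rpow_le_rpow ((not_le.1 h2).le.trans (hfh x)) ht.le
        calc f x = eexp (-(t * L)) * (f x * eexp (t * L)) := by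
              rw [mul_left_comm, ← eexp_add, neg_add_cancel, eexp_zero, mul_one]
          _ ≤ _ := by gcongr
    · exact le_add_right (le_add_right (not_le.1 h1).le)
  have e2 : eexp a ≤ eexp (a - 2) + eexp L * ρ {x | eexp (a - 2) ≤ f x} + eexp (a - 2) := by
    refine ha.trans ((lintegral_mono e1).trans ?_)
    rw [lintegral_add_left (by fun_prop), lintegral_add_left measurable_const,
      lintegral_const_mul _ (measurable_one.indicator hm), lintegral_indicator_one hm,
      lintegral_const_mul _ (by fun_prop), lintegral_const, measure_univ, mul_one]
    gcongr
    calc _ ≤ eexp (-(t * L)) * eexp b := by gcongr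
      _ = _ := by rw [← eexp_add, htL]; congr 1; ring
  have e3 : eexp (a - 2) ≤ eexp L * ρ {x | eexp (a - 2) ≤ f x} := by
    have h4 : eexp (a - 2) + eexp (a - 2) + eexp (a - 2) ≤ eexp a := by
      have := two_mul_eexp_sub_one_le a
      have h5 := two_mul_eexp_sub_one_le (a - 1)
      rw [show a - 1 - 1 = a - 2 by ring] at h5
      refine le_trans ?_ ((mul_le_mul_right h5 2).trans this)
      calc _ = 3 * eexp (a - 2) := by ring
        _ ≤ 4 * eexp (a - 2) := by gcongr; norm_num
        _ = _ := by ring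
    have h6 := h4.trans e2
    rw [add_right_comm, add_comm (eexp (a - 2)) (eexp (a - 2)), add_right_comm (eexp (a-2))] at h6
    refine (ENNReal.add_le_add_iff_left (a := eexp (a - 2) + eexp (a - 2)) (by
      simp [eexp_ne_top])).1 ?_
    refine h4.trans (e2.trans (le_of_eq ?_))
    ring
  calc eexp (a - 2 - L) = eexp (-L) * eexp (a - 2) := by rw [← eexp_add]; congr 1; ring
    _ ≤ eexp (-L) * (eexp L * ρ {x | eexp (a - 2) ≤ f x}) := by gcongr
    _ = _ := by rw [← mul_assoc, ← eexp_add, neg_add_cancel, eexp_zero, one_mul]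

lemma mul_exp_mean_le_sum_mul_exp {A : Type*} [Fintype A] {m Δ : A → ℝ} (hm : ∀ a, 0 ≤ m a)
    (hZ : 0 < ∑ a, m a) :
    (∑ a, m a) * Real.exp ((∑ a, m a * Δ a) / ∑ a, m a) ≤ ∑ a, m a * Real.exp (Δ a) := by
  set Z := ∑ a, m a with hZd
  set s := (∑ a, m a * Δ a) / Z with hs
  have e1 : ∑ a, m a * (Real.exp s * (Δ a - s + 1)) = Z * Real.exp s := by
    have h1 : ∑ a, m a * Δ a = s * Z := by rw [hs]; field_simp
    calc _ = Real.exp s * (∑ a, m a * Δ a - s * ∑ a, m a + ∑ a, m a) := by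
          rw [Finset.mul_sum, ← Finset.sum_sub_distrib, ← Finset.sum_add_distrib, Finset.mul_sum]
          exact Finset.sum_congr rfl fun a _ => by ring
      _ = _ := by rw [h1, ← hZd]; ring
  rw [← e1]
  refine Finset.sum_le_sum fun a _ => mul_le_mul_of_nonneg_left ?_ (hm a)
  calc Real.exp s * (Δ a - s + 1) ≤ Real.exp s * Real.exp (Δ a - s) :=
        mul_le_mul_of_nonneg_left (Real.add_one_le_exp _) (Real.exp_pos _).le
    _ = Real.exp (Δ a) := by rw [← Real.exp_add]; congr 1; ring

/-- Lower tail of an exponential sum: a point of the concentration set near the configuration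
`y` forces `∑ r e^{γ y}` to be large by convexity of the exponential. -/
lemma le_sum_eexp_of_dual_dist_le {A : Type*} [Fintype A] {γ : ℝ} (hγ : 0 < γ) {r : A → ℝ≥0}
    {k Q : A → A → ℝ} (hk : ∀ a b, Q a b ≤ Real.exp (k a b)) {a₁ Λ s : ℝ} (hs : 0 ≤ s)
    {y v : A → ℝ} {G : Set A}
    (hG : ∀ a ∈ G, ∑ b, eexp (k a b) * (r b * eexp (γ * v b)) ≤ eexp Λ)
    (hv : eexp a₁ ≤ ∑ a, G.indicator (fun a => r a * eexp (γ * v a)) a)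
    (hy : ∀ m : A → ℝ, |∑ a, m a * (y a - v a)| ≤ s * √(∑ a, ∑ b, m a * m b * Q a b)) :
    eexp (a₁ - γ * s * Real.exp ((Λ - a₁) / 2)) ≤ ∑ a, r a * eexp (γ * y a) := by
  classical
  set m : A → ℝ := G.indicator (fun a => r a * Real.exp (γ * v a)) with hm
  have hR : ∀ a (x : ℝ), (r a : ℝ≥0∞) * eexp x = ENNReal.ofReal (r a * Real.exp x) := fun a x => by
    rw [eexp, ENNReal.ofReal_mul (r a).coe_nonneg, ENNReal.ofReal_coe_nnreal]
  have hm0 : ∀ a, 0 ≤ m a := fun a => Set.indicator_nonneg (fun a _ => by positivity) a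
  have hmR : ∀ a, m a ≤ r a * Real.exp (γ * v a) := fun a =>
    Set.indicator_le_self' (fun a _ => by positivity) a
  have hZ : Real.exp a₁ ≤ ∑ a, m a := by
    have e1 : ∑ a, G.indicator (fun a => r a * eexp (γ * v a)) a = ENNReal.ofReal (∑ a, m a) := by
      rw [ENNReal.ofReal_sum_of_nonneg fun a _ => hm0 a]
      refine Finset.sum_congr rfl fun a _ => ?_
      by_cases ha : a ∈ G <;> simp [hm, ha, hR]
    rw [e1, eexp] at hv
    exact (ENNReal.ofReal_le_ofReal_iff (Finset.sum_nonneg fun a _ => hm0 a)).1 hv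
  have hZ0 : 0 < ∑ a, m a := (Real.exp_pos _).trans_le hZ
  have hQ : ∑ a, ∑ b, m a * m b * Q a b ≤ Real.exp Λ * ∑ a, m a := by
    rw [Finset.mul_sum]
    refine Finset.sum_le_sum fun a _ => ?_
    by_cases ha : a ∈ G
    · have e2 := hG a ha
      have e3 : ∑ b, eexp (k a b) * (r b * eexp (γ * v b)) =
          ENNReal.ofReal (∑ b, Real.exp (k a b) * (r b * Real.exp (γ * v b))) := by
        rw [ENNReal.ofReal_sum_of_nonneg fun a _ => by positivity]
        refine Finset.sum_congr rfl fun b _ => ?_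
        rw [hR, eexp, ENNReal.ofReal_mul (Real.exp_pos _).le]
      rw [e3, eexp, ENNReal.ofReal_le_ofReal_iff (Real.exp_pos _).le] at e2
      calc ∑ b, m a * m b * Q a b
          ≤ ∑ b, m a * (Real.exp (k a b) * (r b * Real.exp (γ * v b))) := by
            refine Finset.sum_le_sum fun b _ => ?_
            rw [mul_assoc]
            refine mul_le_mul_of_nonneg_left ?_ (hm0 a)
            rw [mul_comm]
            calc Q a b * m b ≤ Real.exp (k a b) * m b :=
                  mul_le_mul_of_nonneg_right (hk a b) (hm0 b)
              _ ≤ _ := mul_le_mul_of_nonneg_left (hmR b) (Real.exp_pos _).le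
        _ ≤ Real.exp Λ * m a := by
            rw [← Finset.mul_sum, mul_comm]
            exact mul_le_mul_of_nonneg_right e2 (hm0 a)
    · simp [hm, ha]
  set Z := ∑ a, m a with hZd
  have hmean : -(s * Real.exp ((Λ - a₁) / 2)) ≤ (∑ a, m a * (y a - v a)) / Z := by
    rw [le_div_iff₀ hZ0]
    have h1 := neg_le_of_abs_le (hy m)
    refine le_trans ?_ h1
    have h2 : √(∑ a, ∑ b, m a * m b * Q a b) ≤ Real.exp ((Λ - a₁) / 2) * Z := by
      refine Real.sqrt_le_iff.2 ⟨by positivity, hQ.trans ?_⟩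
      have h3 : Real.exp ((Λ - a₁) / 2) ^ 2 = Real.exp Λ * (Real.exp a₁)⁻¹ := by
        rw [← Real.exp_nat_mul, ← Real.exp_neg, ← Real.exp_add]; congr 1; push_cast; ring
      rw [mul_pow, h3, sq Z, mul_assoc]
      refine mul_le_mul_of_nonneg_left ?_ (Real.exp_pos _).le
      rw [← mul_assoc]
      refine le_mul_of_one_le_left hZ0.le ?_
      rw [inv_mul_eq_div, le_div_iff₀ (Real.exp_pos _), one_mul]
      exact hZ
    have := mul_le_mul_of_nonneg_left h2 hs
    nlinarith
  have hfin : Real.exp (a₁ - γ * s * Real.exp ((Λ - a₁) / 2)) ≤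
      ∑ a, r a * Real.exp (γ * y a) := by
    calc _ = Real.exp a₁ * Real.exp (γ * -(s * Real.exp ((Λ - a₁) / 2))) := by
          rw [← Real.exp_add]; congr 1; ring
      _ ≤ Z * Real.exp ((∑ a, m a * (γ * (y a - v a))) / Z) := by
          refine mul_le_mul hZ (Real.exp_le_exp.2 ?_) (Real.exp_pos _).le hZ0.le
          refine (mul_le_mul_of_nonneg_left hmean hγ.le).trans (le_of_eq ?_)
          rw [← mul_div_assoc, Finset.mul_sum]
          congr 1
          exact Finset.sum_congr rfl fun a _ => by ring
      _ ≤ ∑ a, m a * Real.exp (γ * (y a - v a)) := mul_exp_mean_le_sum_mul_exp hm0 hZ0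
      _ ≤ _ := by
          refine Finset.sum_le_sum fun a _ => ?_
          calc _ ≤ r a * Real.exp (γ * v a) * Real.exp (γ * (y a - v a)) :=
                mul_le_mul_of_nonneg_right (hmR a) (Real.exp_pos _).le
            _ = _ := by rw [mul_assoc, ← Real.exp_add]; congr 2; ring
  simp only [hR]
  rw [← ENNReal.ofReal_sum_of_nonneg fun a _ => by positivity, eexp]
  exact ENNReal.ofReal_le_ofReal hfin

lemma exists_lower_tail_of_moment {t γ : ℝ} (ht : 0 < t) (hγ : 0 < γ) (a₀ b₀ c₀ : ℝ) :
    ∃ a₁ K, ∀ {ι A : Type} [Fintype A] {μ : Measure (ι → ℝ)} {C : ι → ι → ℝ},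
      GaussField μ C → ∀ (l : A → ι →₀ ℝ) (r : A → ℝ≥0) (k : A → A → ℝ),
      (∀ a b, covForm C (l a) (l b) ≤ Real.exp (k a b)) → (∀ a b, c₀ ≤ k a b) →
      eexp a₀ ≤ ∫⁻ φ, ∑ a, r a * eexp (γ * linForm (l a) φ) ∂μ →
      ∫⁻ φ, ∑ a, r a * eexp (γ * linForm (l a) φ) *
        (∑ b, eexp (k a b) * (r b * eexp (γ * linForm (l b) φ))) ^ t ∂μ ≤ eexp b₀ →
      ∀ u > 0, μ {φ | ∑ a, r a * eexp (γ * linForm (l a) φ) < eexp (a₁ - u)} ≤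
        ENNReal.ofReal (K / u ^ 2) := by
  set Λ := (b₀ - a₀ + 1) / t with hΛ
  have htΛ : t * Λ = b₀ - a₀ + 1 := by rw [hΛ]; field_simp
  obtain ⟨c, hc⟩ := exists_le_measure_of_moment ht (a₀ - 1) (b₀ - t * c₀)
  set a₁ := a₀ - 1 - 2 with ha₁
  set Dd := γ * Real.exp ((Λ - a₁) / 2) with hD
  have hD0 : 0 < Dd := by positivity
  refine ⟨a₁, 16 * Dd ^ 2 * Real.exp (-c), fun {ι A} _ {μ C} hμ l r k hk hk0 hE1 hE2 u hu => ?_⟩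
  have := hμ.isProbabilityMeasure
  have mw : ∀ a, Measurable fun v : A → ℝ => ∑ b, eexp (k a b) * ((r b : ℝ≥0∞) * eexp (γ * v b)) :=
    fun a => by
      have := measurable_eexp
      fun_prop
  set G : (A → ℝ) → Set A := fun v =>
    {a | ∑ b, eexp (k a b) * (r b * eexp (γ * v b)) ≤ eexp Λ} with hG
  set T' : (A → ℝ) → ℝ≥0∞ := fun v => ∑ a, (G v).indicator (fun a => r a * eexp (γ * v a)) a
    with hT'
  have hT'm : Measurable T' := by
    refine Finset.measurable_sum _ fun a _ => ?_
    have : (fun v : A → ℝ => (G v).indicator (fun a => (r a : ℝ≥0∞) * eexp (γ * v a)) a) =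
        {v | ∑ b, eexp (k a b) * (r b * eexp (γ * v b)) ≤ eexp Λ}.indicator
          (fun v => r a * eexp (γ * v a)) := by
      ext v; by_cases h : a ∈ G v
      · rw [Set.indicator_of_mem h, Set.indicator_of_mem (by exact h)]
      · rw [Set.indicator_of_notMem h, Set.indicator_of_notMem (by exact h)]
    rw [this]
    have := measurable_eexp
    exact Measurable.indicator (by fun_prop) (measurableSet_le (mw a) measurable_const)
  set Y : (ι → ℝ) → A → ℝ := fun φ a => linForm (l a) φ with hY
  have hYm : Measurable Y := measurable_pi_lambda _ fun a => measurable_linForm _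
  have hTY : Measurable fun φ => T' (Y φ) := hT'm.comp hYm
  set F : (A → ℝ) → ℝ≥0∞ := fun v => ∑ a, r a * eexp (γ * v a) with hF
  have hFm : Measurable F := by have := measurable_eexp; fun_prop
  have hTF : ∀ v, T' v ≤ F v := fun v => Finset.sum_le_sum fun a _ => Set.indicator_le_self _ _ _
  have h1 : eexp (a₀ - 1) ≤ ∫⁻ φ, T' (Y φ) ∂μ := by
    have e1 : ∀ v, F v ≤ T' v + eexp (-(t * Λ)) * ∑ a, r a * eexp (γ * v a) *
        (∑ b, eexp (k a b) * (r b * eexp (γ * v b))) ^ t := by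
      intro v
      rw [Finset.mul_sum, ← Finset.sum_add_distrib]
      refine Finset.sum_le_sum fun a _ => ?_
      by_cases h : a ∈ G v
      · rw [Set.indicator_of_mem h]; exact le_self_add
      · refine le_add_left ?_
        have h' : eexp (t * Λ) ≤ (∑ b, eexp (k a b) * (r b * eexp (γ * v b))) ^ t := by
          rw [← eexp_rpow]
          exact ENNReal.rpow_le_rpow (not_le.1 h).le ht.le
        calc _ = eexp (-(t * Λ)) * (r a * eexp (γ * v a) * eexp (t * Λ)) := by
              rw [mul_left_comm (eexp (-(t * Λ))), ← eexp_add, neg_add_cancel, eexp_zero, mul_one]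
          _ ≤ _ := mul_le_mul_right (mul_le_mul_right h' _) _
    have e2 : eexp a₀ ≤ ∫⁻ φ, T' (Y φ) ∂μ + eexp (a₀ - 1) := by
      refine hE1.trans ((lintegral_mono fun φ => e1 (Y φ)).trans ?_)
      rw [lintegral_add_left hTY, lintegral_const_mul']
      · gcongr
        refine (mul_le_mul_right hE2 _).trans (le_of_eq ?_)
        rw [← eexp_add, htΛ]; congr 1; ring
      · exact eexp_ne_top _
    refine (ENNReal.add_le_add_iff_right (a := eexp (a₀ - 1)) (eexp_ne_top _)).1
      (le_trans ?_ e2)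
    rw [← two_mul]; exact two_mul_eexp_sub_one_le _
  have h2 : ∫⁻ φ, T' (Y φ) * F (Y φ) ^ t ∂μ ≤ eexp (b₀ - t * c₀) := by
    have e1 : ∀ v, T' v * F v ^ t ≤ eexp (-(t * c₀)) * ∑ a, r a * eexp (γ * v a) *
        (∑ b, eexp (k a b) * (r b * eexp (γ * v b))) ^ t := by
      intro v
      refine (mul_le_mul_left (hTF v) _).trans ?_
      rw [hF, Finset.sum_mul, Finset.mul_sum]
      refine Finset.sum_le_sum fun a _ => ?_
      rw [mul_left_comm]
      refine mul_le_mul_right ?_ _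
      rw [← mul_neg, ← eexp_rpow, ← ENNReal.mul_rpow_of_nonneg _ _ ht.le]
      refine ENNReal.rpow_le_rpow ?_ ht.le
      rw [Finset.mul_sum]
      refine Finset.sum_le_sum fun b _ => ?_
      rw [← mul_assoc (eexp (-c₀)), ← eexp_add]
      refine le_mul_of_one_le_left zero_le ?_
      rw [← eexp_zero]; exact eexp_le (by linarith [hk0 a b])
    refine (lintegral_mono fun φ => e1 (Y φ)).trans ?_
    rw [lintegral_const_mul' _ _ (eexp_ne_top _)]
    refine (mul_le_mul_right hE2 _).trans (le_of_eq ?_)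
    rw [← eexp_add]; congr 1; ring
  have h3 : eexp c ≤ (μ.map Y) {v | eexp a₁ ≤ T' v} := by
    have : IsProbabilityMeasure (μ.map Y) := Measure.isProbabilityMeasure_map hYm.aemeasurable
    refine hc (μ.map Y) hT'm hFm hTF ?_ ?_
    · rwa [lintegral_map hT'm hYm]
    · rwa [lintegral_map (by fun_prop) hYm]
  set s := u / Dd with hs
  have hs0 : 0 < s := by positivity
  have hTm : MeasurableSet {v | eexp a₁ ≤ T' v} := measurableSet_le measurable_const hT'm
  have h4 := hμ.concentration l hTm hs0
  have h5 : {φ | ∑ a, r a * eexp (γ * linForm (l a) φ) < eexp (a₁ - u)} ⊆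
      {φ | ∀ v ∈ {v | eexp a₁ ≤ T' v}, ∃ m : A → ℝ,
        s * √(∑ a, ∑ b, m a * m b * covForm C (l a) (l b)) <
          |∑ a, m a * (linForm (l a) φ - v a)|} := by
    intro φ hφ v hv
    by_contra hcon
    push Not at hcon
    have := le_sum_eexp_of_dual_dist_le hγ hk hs0.le (G := G v) (fun a ha => ha) hv hcon
    rw [show γ * s * Real.exp ((Λ - a₁) / 2) = u by rw [hs, hD]; field_simp] at this
    exact absurd hφ (not_lt.2 this)
  rw [Measure.map_apply hYm hTm] at h3
  have h6 : eexp c * μ {φ | ∑ a, r a * eexp (γ * linForm (l a) φ) < eexp (a₁ - u)} ≤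
      ENNReal.ofReal (16 / s ^ 2) :=
    (mul_le_mul' h3 (measure_mono h5)).trans h4
  calc _ = eexp (-c) * (eexp c *
        μ {φ | ∑ a, r a * eexp (γ * linForm (l a) φ) < eexp (a₁ - u)}) := by
        rw [← mul_assoc, ← eexp_add, neg_add_cancel, eexp_zero, one_mul]
    _ ≤ eexp (-c) * ENNReal.ofReal (16 / s ^ 2) := by gcongr
    _ = _ := by
        rw [eexp, ← ENNReal.ofReal_mul (Real.exp_pos _).le]
        congr 1; rw [hs]; field_simp

end LowerTail

section MassLowerTail

variable {C : Site d → Site d → ℝ} {C₀ C₁ γ : ℝ} {w : ℝ≥0∞} {N : ℕ}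
  {S : Finset (EuclideanSpace ℝ (Fin d))} {μ : Measure (Site d → ℝ)}

lemma GaussField.lintegral_eexp_mul_mul (hμ : GaussField μ C) (i : Site d) (s : ℝ)
    {F : (Site d → ℝ) → ℝ≥0∞} (hF : Measurable F) :
    ∫⁻ φ, eexp (s * φ i) * F φ ∂μ =
      eexp (s ^ 2 / 2 * C i i) * ∫⁻ φ, F (fun j => φ j + s * C j i) ∂μ := by
  have := hμ.girsanov (Finsupp.single i s) hF
  simp only [linForm_single, covForm_single_single, cmShift] at this
  rw [this]; congr 2; ring

lemma GaussField.lintegral_dens_mul_eexp_mul (hμ : GaussField μ C) (z : EuclideanSpace ℝ (Fin d))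
    (i : Site d) (s : ℝ) {F : (Site d → ℝ) → ℝ≥0∞} (hF : Measurable F) :
    ∫⁻ φ, dens C γ N φ z * (eexp (-s * φ i) * F φ) ∂μ =
      eexp (s ^ 2 / 2 * C i i - s * γ * C i (N, z)) *
        ∫⁻ φ, F (fun j => φ j + (γ * C j (N, z) - s * C j i)) ∂μ := by
  have hm := measurable_eexp
  have hF' : ∀ v : Site d → ℝ, Measurable fun φ : Site d → ℝ => F (fun j => φ j + v j) :=
    fun v => hF.comp (by fun_prop)
  rw [hμ.lintegral_dens_mul z (by fun_prop)]
  calc _ = ∫⁻ φ, eexp (-(s * γ * C i (N, z))) *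
        (eexp (-s * φ i) * F (fun j => φ j + γ * C j (N, z))) ∂μ := by
        refine lintegral_congr fun φ => ?_
        rw [← mul_assoc, ← eexp_add]; congr 2; ring
    _ = _ := by
        rw [lintegral_const_mul' _ _ (eexp_ne_top _), hμ.lintegral_eexp_mul_mul i (-s) (hF' _),
          ← mul_assoc, ← eexp_add]
        congr 2
        · ring
        · ext φ; congr 1; ext j; ring

/-- The mass of a ball around `x` is unlikely to be much smaller than its typical size given the
value of the field at the scale of the ball. -/
lemma exists_mass_lower_tail (hC : KernelBound C C₀) (C₁ c₁ : ℝ) (hγ : 0 < γ)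
    (hγd : γ ^ 2 < 2 * d) :
    ∃ a₁ K, ∀ (μ : Measure (Site d → ℝ)), GaussField μ C →
      ∀ (S : Finset (EuclideanSpace ℝ (Fin d))) (w : ℝ≥0∞) (N : ℕ), UpperGrid S w N C₁ →
      ∀ x ∈ S, ∀ n ≤ N, eexp (c₁ - n * d * Real.log 2) ≤ w * (nbhd S x n).card →
      ∀ u > 0, μ {φ | mass C γ w N φ (nbhd S x n) <
        eexp (γ * φ (n, x) - n * (d + γ ^ 2 / 2) * Real.log 2 + a₁ - u)} ≤
          ENNReal.ofReal (K / u ^ 2) := by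
  set δ₀ := d - γ ^ 2 / 2 with hδ
  have hδ0 : 0 < δ₀ := by rw [hδ]; linarith
  set κ := δ₀ / 4 with hκ
  have hκ0 : 0 < κ := by positivity
  set t := min 1 (δ₀ / (2 * γ ^ 2)) with ht
  have ht0 : 0 < t := lt_min one_pos (by positivity)
  have ht1 : t ≤ 1 := min_le_left _ _
  have htγ : γ ^ 2 * t ≤ δ₀ / 2 := by
    have : t ≤ δ₀ / (2 * γ ^ 2) := min_le_right _ _
    rw [le_div_iff₀ (by positivity)] at this
    linarith
  set b := γ ^ 2 + κ with hb
  have hξ : 0 < momExp d γ t - b * t := by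
    rw [show momExp d γ t - b * t = t * (δ₀ - γ ^ 2 * t / 2 - κ) by
      rw [momExp, hb, hδ]; ring]
    apply mul_pos ht0
    rw [hκ]; linarith
  have hC0 : 0 ≤ C₀ := by
    have h1 := hC.near 0 0 0 0 0 (by simp [rad_zero]) le_rfl le_rfl
    have h2 := hC.far 0 0 0 0 0 (by simp)
    push_cast at h1 h2
    linarith
  obtain ⟨c, hc⟩ := exists_lintegral_mass_rpow_le hC C₁ hγ.le ht0 (Or.inl ht1)
  obtain ⟨c', hc'⟩ := hC.exists_lintegral_tilted_le (γ := γ) (c := c) ht0 (by positivity) hξ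
  set Ca := 3 * κ * C₀ - Real.log κ + (1 + t) * γ ^ 2 * C₀ with hCa
  obtain ⟨a₁, K, hK⟩ := exists_lower_tail_of_moment ht0 hγ (c₁ - 3 / 2 * γ ^ 2 * C₀)
    (C₁ + ((1 + t) ^ 2 / 2 + (1 + t)) * γ ^ 2 * C₀ + t * Ca + c' +
      (momExp d γ t - b * t) * Real.log 2)
    (κ * (2 * C₀ - Real.log 2) - Real.log κ)
  refine ⟨a₁, K, fun μ hμ S w N hS x hx n hn hlow u hu => ?_⟩
  have hm := measurable_eexp
  have hmd := fun z => measurable_dens C γ N z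
  have hxn : x ∈ nbhd S x n := mem_nbhd.2 ⟨hx, by simp [(rad_pos n).le]⟩
  have hw : w ≠ ⊤ := by
    rintro rfl
    have := hS.reg x hx n hn
    rw [ENNReal.top_mul (by simpa using Finset.ne_empty_of_mem hxn), top_le_iff] at this
    exact eexp_ne_top _ this
  set A := {z // z ∈ nbhd S x n} with hA
  have hcard : Fintype.card A = (nbhd S x n).card := Fintype.card_coe _
  set ξ : Site d := (n, x) with hξd
  set l : A → Site d →₀ ℝ := fun z => Finsupp.single (N, z.1) 1 - Finsupp.single ξ 1 with hl
  set r : A → ℝ≥0 := fun z => (w * eexp (n * (d + γ ^ 2 / 2) * Real.log 2 -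
    γ ^ 2 / 2 * C (N, z.1) (N, z.1))).toNNReal with hr
  set k : A → A → ℝ := fun z y =>
    κ * (C (N, y.1) (N, z.1) - n * Real.log 2 + 3 * C₀) - Real.log κ with hk
  have hR : ∀ (z : A) φ, r z * eexp (γ * linForm (l z) φ) =
      eexp (n * (d + γ ^ 2 / 2) * Real.log 2) * (w * (dens C γ N φ z * eexp (-γ * φ ξ))) := by
    intro z φ
    rw [hr, ENNReal.coe_toNNReal (ENNReal.mul_ne_top hw (eexp_ne_top _)), hl, linForm_sub,
      linForm_single, linForm_single, dens, ← eexp_add, mul_left_comm, ← eexp_add, mul_assoc,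
      ← eexp_add]
    congr 2; ring
  have hCξξ : n * Real.log 2 - C₀ ≤ C ξ ξ ∧ C ξ ξ ≤ n * Real.log 2 + C₀ :=
    ⟨hC.near n n n x x (by simp [(rad_pos n).le]) le_rfl le_rfl, hC.far n n n x x (by simp)⟩
  have hCξ : ∀ z : A, n * Real.log 2 - C₀ ≤ C ξ (N, z.1) ∧ C ξ (N, z.1) ≤ n * Real.log 2 + C₀ :=
    fun z => ⟨hC.near n n N x z (by rw [dist_comm]; exact (mem_nbhd.1 z.2).2) le_rfl hn,
      hC.far n n N x z (by simp)⟩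
  have hsymm : ∀ i j, C i j = C j i := hμ.symm
  have hCzy : ∀ z y : A, n * Real.log 2 - Real.log 2 - C₀ ≤ C (N, y.1) (N, z.1) := by
    intro z y
    have h1 := (mem_nbhd.1 (hS.nbhd_subset_pred z.2 y.2)).2
    have h2 := hC.near (n - 1) N N y z h1 (by omega) (by omega)
    have h3 : (n : ℝ) - 1 ≤ (n - 1 : ℕ) := by
      rw [sub_le_iff_le_add]; exact_mod_cast (by omega : n ≤ n - 1 + 1)
    have := mul_le_mul_of_nonneg_right h3 log_two_pos.le
    linarith
  have key := hK hμ l r k ?_ ?_ ?_ ?_ u hu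
  · refine le_trans (measure_mono fun φ hφ => ?_) key
    rw [Set.mem_ofPred_eq] at hφ ⊢
    simp only [hR]
    rw [Finset.sum_coe_sort (nbhd S x n) fun z => eexp (n * (d + γ ^ 2 / 2) * Real.log 2) *
      (w * (dens C γ N φ z * eexp (-γ * φ ξ)))]
    calc _ = eexp (n * (d + γ ^ 2 / 2) * Real.log 2 - γ * φ ξ) *
          mass C γ w N φ (nbhd S x n) := by
          rw [mass, Finset.mul_sum]
          refine Finset.sum_congr rfl fun z _ => ?_
          rw [sub_eq_add_neg, eexp_add, neg_mul]; ring
      _ < eexp (n * (d + γ ^ 2 / 2) * Real.log 2 - γ * φ ξ) *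
          eexp (γ * φ (n, x) - n * (d + γ ^ 2 / 2) * Real.log 2 + a₁ - u) :=
          ENNReal.mul_lt_mul_right (eexp_ne_zero _) (eexp_ne_top _) hφ
      _ = _ := by rw [← eexp_add]; congr 1; ring
  · intro z y
    have e1 : covForm C (l z) (l y) =
        C (N, y.1) (N, z.1) - C ξ (N, z.1) - C ξ (N, y.1) + C ξ ξ := by
      simp only [hl, sub_eq_add_neg, ← neg_one_smul ℝ (Finsupp.single ξ (1 : ℝ)),
        Finsupp.smul_single, covForm_add_left, covForm_add_right, covForm_single_single]
      rw [hsymm (N, z.1) ξ, hsymm (N, z.1)]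
      simp; ring
    rw [e1, hk, Real.exp_sub, Real.exp_log hκ0, le_div_iff₀ hκ0]
    have := Real.add_one_le_exp (κ * (C (N, y.1) (N, z.1) - n * Real.log 2 + 3 * C₀))
    have h2 : C (N, y.1) (N, z.1) - C ξ (N, z.1) - C ξ (N, y.1) + C ξ ξ ≤
        C (N, y.1) (N, z.1) - n * Real.log 2 + 3 * C₀ := by
      linarith [(hCξ z).1, (hCξ y).1, hCξξ.2]
    have := mul_le_mul_of_nonneg_left h2 hκ0.le
    linarith
  · intro z y
    have := mul_le_mul_of_nonneg_left (hCzy z y) hκ0.le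
    simp only [hk]
    linarith
  · have e1 : ∀ z : A, eexp (-(n * (γ ^ 2 / 2) * Real.log 2) - 3 / 2 * γ ^ 2 * C₀) ≤
        ∫⁻ φ, dens C γ N φ z * eexp (-γ * φ ξ) ∂μ := by
      intro z
      have h1 := hμ.lintegral_dens_mul_eexp_mul (γ := γ) (N := N) z.1 ξ γ
        (F := fun _ => 1) measurable_const
      have := hμ.isProbabilityMeasure
      simp only [mul_one, lintegral_const, measure_univ] at h1
      rw [h1]
      refine eexp_le ?_
      have h2 := mul_le_mul_of_nonneg_left hCξξ.1 (sq_nonneg γ)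
      have h3 := mul_le_mul_of_nonneg_left (hCξ z).2 (sq_nonneg γ)
      linarith
    simp only [hR]
    rw [lintegral_finsetSum _ (by fun_prop)]
    calc eexp (c₁ - 3 / 2 * γ ^ 2 * C₀)
        = eexp (c₁ - n * d * Real.log 2) * (eexp (n * (d + γ ^ 2 / 2) * Real.log 2) *
          eexp (-(n * (γ ^ 2 / 2) * Real.log 2) - 3 / 2 * γ ^ 2 * C₀)) := by
          rw [← eexp_add, ← eexp_add]; congr 1; ring
      _ ≤ w * (nbhd S x n).card * _ := mul_le_mul_left hlow _
      _ = ∑ z : A, eexp (n * (d + γ ^ 2 / 2) * Real.log 2) * (w *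
          eexp (-(n * (γ ^ 2 / 2) * Real.log 2) - 3 / 2 * γ ^ 2 * C₀)) := by
          rw [Finset.sum_const, nsmul_eq_mul, Finset.card_univ, hcard]; ring
      _ ≤ _ := by
          refine Finset.sum_le_sum fun z _ => ?_
          rw [lintegral_const_mul _ (by fun_prop), lintegral_const_mul _ (by fun_prop)]
          exact mul_le_mul_right (mul_le_mul_right (e1 z) _) _
  · set a := (d + γ ^ 2 / 2) * Real.log 2 with ha
    set V : A → (Site d → ℝ) → ℝ≥0∞ := fun z φ =>
      (∑ y ∈ nbhd S x n, eexp (κ * (C (N, y) (N, z.1) - n * Real.log 2 + 3 * C₀) - Real.log κ) *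
        (w * dens C γ N φ y)) ^ t with hV
    have hVm : ∀ z, Measurable (V z) := fun z => by fun_prop
    have e0 : ∀ (z : A) φ, r z * eexp (γ * linForm (l z) φ) *
        (∑ y, eexp (k z y) * (r y * eexp (γ * linForm (l y) φ))) ^ t =
        eexp (n * (1 + t) * a) * (w *
          (dens C γ N φ z * (eexp (-((1 + t) * γ) * φ ξ) * V z φ))) := by
      intro z φ
      have h1 : ∑ y, eexp (k z y) * (r y * eexp (γ * linForm (l y) φ)) =
          eexp (n * a - γ * φ ξ) * ∑ y ∈ nbhd S x n,
            eexp (κ * (C (N, y) (N, z.1) - n * Real.log 2 + 3 * C₀) - Real.log κ) *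
              (w * dens C γ N φ y) := by
        rw [← Finset.sum_coe_sort (nbhd S x n), Finset.mul_sum]
        refine Finset.sum_congr rfl fun y _ => ?_
        rw [hR, sub_eq_add_neg, eexp_add, ha, neg_mul, mul_assoc (n : ℝ)]; ring
      rw [h1, hR, ENNReal.mul_rpow_of_nonneg _ _ ht0.le, eexp_rpow, mul_assoc (n : ℝ), ← ha]
      have h2 : eexp (t * (n * a - γ * φ ξ)) = eexp (n * t * a) * eexp (-(t * γ) * φ ξ) := by
        rw [← eexp_add]; congr 1; ring
      have h3 : eexp (n * (1 + t) * a) = eexp (n * a) * eexp (n * t * a) := by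
        rw [← eexp_add]; congr 1; ring
      have h4 : eexp (-((1 + t) * γ) * φ ξ) = eexp (-γ * φ ξ) * eexp (-(t * γ) * φ ξ) := by
        rw [← eexp_add]; congr 1; ring
      rw [h2, h3, h4]; ring
    have e1 : ∀ z : A, ∫⁻ φ, V z (fun j => φ j + (γ * C j (N, z.1) - (1 + t) * γ * C j ξ)) ∂μ ≤
        eexp (t * (Ca - κ * n * Real.log 2 - (1 + t) * γ ^ 2 * n * Real.log 2)) *
          eexp (c' - (n - 1 : ℕ) * (momExp d γ t - b * t) * Real.log 2) := by
      intro z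
      have hzS : z.1 ∈ S := (mem_nbhd.1 z.2).1
      refine le_trans (lintegral_mono fun φ => ?_) ((lintegral_const_mul' _ _
        (eexp_ne_top _)).le.trans (mul_le_mul_right (hc' μ S w N z (n - 1) N (by omega)
          fun j hj => hc μ hμ S w N hS z hzS j hj) _))
      rw [← eexp_rpow, ← ENNReal.mul_rpow_of_nonneg _ _ ht0.le]
      refine ENNReal.rpow_le_rpow ?_ ht0.le
      rw [Finset.mul_sum]
      refine le_trans (Finset.sum_le_sum fun y hy => ?_)
        (Finset.sum_le_sum_of_subset (hS.nbhd_subset_pred z.2))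
      have h1 : dens C γ N (fun j => φ j + (γ * C j (N, z.1) - (1 + t) * γ * C j ξ)) y =
          eexp (γ ^ 2 * C (N, y) (N, z.1) - (1 + t) * γ ^ 2 * C ξ (N, y)) * dens C γ N φ y := by
        rw [dens, dens, ← eexp_add, hsymm ξ (N, y)]; congr 1; ring
      rw [h1, mul_left_comm w, ← mul_assoc, ← eexp_add,
        ← mul_assoc (eexp (Ca - _ - _)), ← eexp_add]
      refine mul_le_mul_left (eexp_le ?_) _
      have h5 := mul_le_mul_of_nonneg_left (hCξ ⟨y, hy⟩).1
        (by positivity : 0 ≤ (1 + t) * γ ^ 2)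
      simp only at h5
      rw [hCa, hb]
      linarith
    simp only [e0]
    rw [lintegral_finsetSum _ (by fun_prop)]
    calc _ ≤ ∑ z : A, eexp (n * (1 + t) * a) * (w *
          (eexp ((1 + t) ^ 2 / 2 * γ ^ 2 * (n * Real.log 2 + C₀) -
            (1 + t) * γ ^ 2 * (n * Real.log 2 - C₀)) *
          (eexp (t * (Ca - κ * n * Real.log 2 - (1 + t) * γ ^ 2 * n * Real.log 2)) *
          eexp (c' - (n - 1 : ℕ) * (momExp d γ t - b * t) * Real.log 2)))) := by
          refine Finset.sum_le_sum fun z _ => ?_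
          rw [lintegral_const_mul _ (by fun_prop), lintegral_const_mul _ (by fun_prop),
            hμ.lintegral_dens_mul_eexp_mul z.1 ξ ((1 + t) * γ) (hVm z)]
          refine mul_le_mul_right (mul_le_mul_right (mul_le_mul' (eexp_le ?_) (e1 z)) _) _
          have h2 := mul_le_mul_of_nonneg_left hCξξ.2
            (by positivity : 0 ≤ (1 + t) ^ 2 / 2 * γ ^ 2)
          have h3 := mul_le_mul_of_nonneg_left (hCξ z).1
            (by positivity : 0 ≤ (1 + t) * γ ^ 2)
          linarith
      _ = w * (nbhd S x n).card * (eexp (n * (1 + t) * a) *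
          (eexp ((1 + t) ^ 2 / 2 * γ ^ 2 * (n * Real.log 2 + C₀) -
            (1 + t) * γ ^ 2 * (n * Real.log 2 - C₀)) *
          (eexp (t * (Ca - κ * n * Real.log 2 - (1 + t) * γ ^ 2 * n * Real.log 2)) *
          eexp (c' - (n - 1 : ℕ) * (momExp d γ t - b * t) * Real.log 2)))) := by
          rw [Finset.sum_const, nsmul_eq_mul, Finset.card_univ, hcard]; ring
      _ ≤ _ := by
          refine (mul_le_mul_left (hS.reg x hx n hn) _).trans ?_
          simp only [← eexp_add]
          refine eexp_le ?_
          have h1 : (n : ℝ) - 1 ≤ (n - 1 : ℕ) := by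
            rw [sub_le_iff_le_add]; exact_mod_cast (by omega : n ≤ n - 1 + 1)
          have h2 := mul_le_mul_of_nonneg_right h1 (mul_pos hξ log_two_pos).le
          have h3 : momExp d γ t - b * t = (d + γ ^ 2 / 2) * t - γ ^ 2 / 2 * t ^ 2 -
            (γ ^ 2 + κ) * t := by rw [momExp, hb]
          rw [ha]
          rw [h3] at h2 ⊢
          nlinarith

end MassLowerTail

section Tilted

variable {C : Site d → Site d → ℝ} {C₀ C₁ γ β : ℝ} {w : ℝ≥0∞} {N : ℕ}
  {S : Finset (EuclideanSpace ℝ (Fin d))} {μ : Measure (Site d → ℝ)}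

lemma GaussField.lintegral_dens_mul_indicator (hμ : GaussField μ C) (y : EuclideanSpace ℝ (Fin d))
    {A : Set (Site d → ℝ)} (hA : MeasurableSet A) :
    ∫⁻ φ, dens C β N φ y * A.indicator 1 φ ∂μ = μ {φ | (fun i => φ i + β * C i (N, y)) ∈ A} := by
  rw [hμ.lintegral_dens_mul y (measurable_one.indicator hA), ← lintegral_indicator_one]
  · rfl
  · exact measurableSet_preimage (by fun_prop) hA

lemma mass_shift (φ : Site d → ℝ) (b : ℝ) (i : Site d) (T : Finset (EuclideanSpace ℝ (Fin d))) :
    mass C γ w N (fun j => φ j + b * C j i) T =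
      ∑ z ∈ T, eexp (γ * b * C (N, z) i) * (w * dens C γ N φ z) := by
  rw [mass]
  refine Finset.sum_congr rfl fun z _ => ?_
  rw [dens_shift]; ring

/-- Under the measure tilted by the chaos of parameter `β`, the balls around a typical point are
not much heavier than `r ^ (d + γ² / 2 - γ β)`. -/
lemma exists_tilted_upper (hC : KernelBound C C₀) (C₁ : ℝ) (hγ : 0 < γ) (hβ : 0 ≤ β)
    (hα : 0 < d + γ ^ 2 / 2 - γ * β) {δ : ℝ} (hδ : 0 < δ) (M : ℝ) :
    ∃ L₀, ∀ L ≥ L₀, ∀ (μ : Measure (Site d → ℝ)), GaussField μ C →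
      ∀ (S : Finset (EuclideanSpace ℝ (Fin d))) (w : ℝ≥0∞) (N : ℕ), UpperGrid S w N C₁ →
      ∀ y ∈ S, ∫⁻ φ, dens C β N φ y * {φ | ∃ n ≤ N,
        eexp (L - n * (d + γ ^ 2 / 2 - γ * β - δ) * Real.log 2) <
          mass C γ w N φ (nbhd S y n)}.indicator 1 φ ∂μ ≤ eexp (-M) := by
  set α := d + γ ^ 2 / 2 - γ * β with hαd
  set t := min 1 (min (δ / γ ^ 2) (α / γ ^ 2)) with ht
  have ht0 : 0 < t := lt_min one_pos (lt_min (by positivity) (by positivity))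
  have ht1 : t ≤ 1 := min_le_left _ _
  have htδ : γ ^ 2 * t ≤ δ := by
    have : t ≤ δ / γ ^ 2 := (min_le_right _ _).trans (min_le_left _ _)
    rw [le_div_iff₀ (by positivity)] at this
    linarith
  have htα : γ ^ 2 * t ≤ α := by
    have : t ≤ α / γ ^ 2 := (min_le_right _ _).trans (min_le_right _ _)
    rw [le_div_iff₀ (by positivity)] at this
    linarith
  have hξ : momExp d γ t - γ * β * t = t * (α - γ ^ 2 * t / 2) := by
    rw [momExp, hαd]; ring
  have hξ0 : 0 < momExp d γ t - γ * β * t := by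
    rw [hξ]; exact mul_pos ht0 (by linarith)
  obtain ⟨c, hc⟩ := exists_lintegral_mass_rpow_le hC C₁ hγ.le ht0 (Or.inl ht1)
  obtain ⟨c', hc'⟩ := hC.exists_lintegral_tilted_le (γ := γ) (c := c) ht0 (by positivity) hξ0
  obtain ⟨G, hG⟩ := exists_sum_eexp_le (κ := t * (δ / 2) * Real.log 2)
    (mul_pos (by positivity) log_two_pos)
  refine ⟨(c' + G + M) / t, fun L hL μ hμ S w N hS y hy => ?_⟩
  have hL : c' + G + M ≤ t * L := by
    rw [ge_iff_le, div_le_iff₀ ht0] at hL; linarith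
  have hmm := fun T => measurable_mass C γ w N T
  have hmd := fun z => measurable_dens C γ N z
  have hmeas : MeasurableSet {φ | ∃ n ≤ N, eexp (L - n * (α - δ) * Real.log 2) <
      mass C γ w N φ (nbhd S y n)} := by
    have : {φ | ∃ n ≤ N, eexp (L - n * (α - δ) * Real.log 2) < mass C γ w N φ (nbhd S y n)} =
        ⋃ n : ℕ, ⋃ _ : n ≤ N, {φ | eexp (L - n * (α - δ) * Real.log 2) <
          mass C γ w N φ (nbhd S y n)} := by ext; simp
    rw [this]
    exact MeasurableSet.iUnion fun n => MeasurableSet.iUnion fun _ =>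
      measurableSet_lt measurable_const (hmm _)
  rw [hμ.lintegral_dens_mul_indicator y hmeas]
  set Wn : ℕ → (Site d → ℝ) → ℝ≥0∞ := fun n φ =>
    ∑ z ∈ nbhd S y n, eexp (γ * β * C (N, z) (N, y)) * (w * dens C γ N φ z) with hWn
  have hWm : ∀ n, Measurable (Wn n) := fun n => by fun_prop
  have e1 : ∀ n ≤ N, μ {φ | eexp (L - n * (α - δ) * Real.log 2) < Wn n φ} ≤
      eexp (c' - t * L) * eexp (-((n : ℝ) - (0 : ℕ)) * (t * (δ / 2) * Real.log 2)) := by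
    intro n hn
    have h1 := hc' μ S w N y n N hn fun j hj => hc μ hμ S w N hS y hy j hj
    have h2 := meas_ge_le_lintegral_div ((hWm n).pow_const t).aemeasurable
      (eexp_ne_zero (t * (L - n * (α - δ) * Real.log 2))) (eexp_ne_top _) (μ := μ)
    refine (measure_mono fun φ hφ => ?_).trans (h2.trans ?_)
    · rw [Set.mem_ofPred_eq] at hφ ⊢
      rw [← eexp_rpow]
      exact ENNReal.rpow_le_rpow hφ.le ht0.le
    · refine ENNReal.div_le_of_le_mul (h1.trans ?_)
      rw [← eexp_add, ← eexp_add, hξ]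
      refine eexp_le ?_
      have h4 : (0 : ℝ) ≤ n * Real.log 2 := mul_nonneg (Nat.cast_nonneg _) log_two_pos.le
      have h5 := mul_le_mul_of_nonneg_left htδ (mul_nonneg ht0.le h4)
      push_cast
      nlinarith
  calc _ ≤ μ (⋃ n ∈ Finset.Icc 0 N, {φ | eexp (L - n * (α - δ) * Real.log 2) < Wn n φ}) := by
        refine measure_mono fun φ hφ => ?_
        obtain ⟨n, hn, hlt⟩ := hφ
        rw [mass_shift] at hlt
        simp only [Set.mem_iUnion]
        exact ⟨n, by simpa using hn, hlt⟩
    _ ≤ ∑ n ∈ Finset.Icc 0 N, μ {φ | eexp (L - n * (α - δ) * Real.log 2) < Wn n φ} :=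
        measure_biUnion_finset_le _ _
    _ ≤ ∑ n ∈ Finset.Icc 0 N,
        eexp (c' - t * L) * eexp (-((n : ℝ) - (0 : ℕ)) * (t * (δ / 2) * Real.log 2)) :=
        Finset.sum_le_sum fun n hn => e1 n (Finset.mem_Icc.1 hn).2
    _ ≤ eexp (c' - t * L) * eexp G := by
        rw [← Finset.mul_sum]; exact mul_le_mul_right (hG 0 N) _
    _ ≤ _ := by rw [← eexp_add]; exact eexp_le (by linarith)

lemma sum_inv_sq_le {δ L : ℝ} (hδ : 0 < δ) (hL : δ < L) (m : ℕ) :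
    ∑ n ∈ Finset.range m, 1 / (n * δ + L) ^ 2 ≤ 1 / (δ * (L - δ)) := by
  have key : ∑ n ∈ Finset.range m, 1 / (n * δ + L) ^ 2 ≤
      1 / (δ * (L - δ)) - 1 / (δ * (m * δ + L - δ)) := by
    induction m with
    | zero => simp
    | succ m ih =>
      rw [Finset.sum_range_succ]
      have h0 : (0 : ℝ) ≤ m * δ := by positivity
      have h1 : 0 < m * δ + L - δ := by linarith
      have h2 : 0 < m * δ + L := by linarith
      have h3 : 1 / (m * δ + L) ^ 2 ≤
          1 / (δ * (m * δ + L - δ)) - 1 / (δ * ((m + 1 : ℕ) * δ + L - δ)) := by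
        have h4 : ((m + 1 : ℕ) : ℝ) * δ + L - δ = m * δ + L := by push_cast; ring
        rw [h4, div_sub_div _ _ (by positivity) (by positivity),
          div_le_div_iff₀ (by positivity) (by positivity)]
        have : δ ^ 2 * ((m * δ + L - δ) * (m * δ + L)) ≤ δ ^ 2 * (m * δ + L) ^ 2 :=
          mul_le_mul_of_nonneg_left (by nlinarith) (by positivity)
        nlinarith
      linarith
  have h5 : (0 : ℝ) ≤ 1 / (δ * (m * δ + L - δ)) := by
    have h0 : (0 : ℝ) ≤ m * δ := by positivity
    have : 0 < m * δ + L - δ := by linarith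
    positivity
  linarith

lemma GaussField.measure_lt_neg_le (hμ : GaussField μ C) (i : Site d) (u : ℝ) {θ : ℝ}
    (hθ : 0 < θ) : μ {φ | φ i < -u} ≤ eexp (θ ^ 2 / 2 * C i i - θ * u) := by
  have hm := measurable_eexp
  have h1 := hμ.lintegral_eexp_mul i (-θ)
  have h2 := meas_ge_le_lintegral_div (f := fun φ : Site d → ℝ => eexp (-θ * φ i))
    (hm.comp (by fun_prop)).aemeasurable (eexp_ne_zero (θ * u)) (eexp_ne_top _) (μ := μ)
  refine (measure_mono fun φ hφ => ?_).trans (h2.trans ?_)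
  · rw [Set.mem_ofPred_eq] at hφ ⊢
    exact eexp_le (by nlinarith)
  · rw [h1]
    refine ENNReal.div_le_of_le_mul ?_
    rw [← eexp_add]; exact eexp_le (by linarith)

/-- Under the measure tilted by the chaos of parameter `β`, the balls around a typical point are
not much lighter than `r ^ (d + γ² / 2 - γ β)`. -/
lemma exists_tilted_lower (hC : KernelBound C C₀) (C₁ c₁ : ℝ) (hγ : 0 < γ) (hγd : γ ^ 2 < 2 * d)
    (hβ : 0 ≤ β) {δ : ℝ} (hδ : 0 < δ) (M : ℝ) :
    ∃ L₀, ∀ L ≥ L₀, ∀ (μ : Measure (Site d → ℝ)), GaussField μ C →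
      ∀ (S : Finset (EuclideanSpace ℝ (Fin d))) (w : ℝ≥0∞) (N : ℕ), UpperGrid S w N C₁ →
      ∀ (n₀ : ℕ), ∀ y ∈ S,
      (∀ n, n₀ ≤ n → n ≤ N → eexp (c₁ - n * d * Real.log 2) ≤ w * (nbhd S y n).card) →
      ∫⁻ φ, dens C β N φ y * {φ | ∃ n, n₀ ≤ n ∧ n ≤ N ∧ mass C γ w N φ (nbhd S y n) <
        eexp (-L - n * (d + γ ^ 2 / 2 - γ * β + δ) * Real.log 2)}.indicator 1 φ ∂μ ≤
          eexp (-M) := by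
  obtain ⟨a₁, K, hK⟩ := exists_mass_lower_tail hC C₁ c₁ hγ hγd
  set θ := δ / (2 * γ ^ 2) with hθ
  have hθ0 : 0 < θ := by positivity
  have hθγ : θ * γ ^ 2 = δ / 2 := by rw [hθ]; field_simp
  set δ' := δ * Real.log 2 with hδ'
  have hδ'0 : 0 < δ' := mul_pos hδ log_two_pos
  obtain ⟨G, hG⟩ := exists_sum_eexp_le (κ := θ * δ' / 4) (by positivity)
  set K' := max K 0 with hK'
  set L₁ := max (δ' + 4 * K' / δ' * Real.exp (M + 1) + 1)
    (2 / θ * (θ * δ / 4 * C₀ + G + M + 1)) with hL₁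
  refine ⟨L₁ + γ * β * C₀ - a₁, fun L hL μ hμ S w N hS n₀ y hy hlow => ?_⟩
  set P := L - γ * β * C₀ + a₁ with hP
  have hP1 : L₁ ≤ P := by linarith
  have hP2 : δ' + 4 * K' / δ' * Real.exp (M + 1) + 1 ≤ P := (le_max_left _ _).trans hP1
  have hP3 : θ * δ / 4 * C₀ + G + M + 1 ≤ θ * P / 2 := by
    have := (le_max_right _ _).trans hP1
    calc θ * δ / 4 * C₀ + G + M + 1 =
        θ / 2 * (2 / θ * (θ * δ / 4 * C₀ + G + M + 1)) := by field_simp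
      _ ≤ θ / 2 * P := by gcongr
      _ = _ := by ring
  have hP0 : δ' < P := by
    have : 0 ≤ 4 * K' / δ' * Real.exp (M + 1) := by positivity
    linarith
  have hmm := fun T => measurable_mass C γ w N T
  have hmeas : MeasurableSet {φ | ∃ n, n₀ ≤ n ∧ n ≤ N ∧ mass C γ w N φ (nbhd S y n) <
      eexp (-L - n * (d + γ ^ 2 / 2 - γ * β + δ) * Real.log 2)} := by
    simp only [Set.ofPred_exists, Set.ofPred_and]
    exact MeasurableSet.iUnion fun n => (MeasurableSet.const _).inter
      ((MeasurableSet.const _).inter (measurableSet_lt (hmm _) measurable_const))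
  rw [hμ.lintegral_dens_mul_indicator y hmeas]
  set u : ℕ → ℝ := fun n => (n * δ' + P) / 2 with hu
  have hu0 : ∀ n, 0 < u n := fun n => by
    have : (0 : ℝ) ≤ n * δ' := by positivity
    simp only [hu]; linarith
  set E₁ : ℕ → Set (Site d → ℝ) := fun n => {φ | n₀ ≤ n ∧ mass C γ w N φ (nbhd S y n) <
    eexp (γ * φ (n, y) - n * (d + γ ^ 2 / 2) * Real.log 2 + a₁ - u n)} with hE₁
  set E₂ : ℕ → Set (Site d → ℝ) := fun n => {φ | φ (n, y) < -(u n / γ)} with hE₂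
  have b1 : ∀ n ≤ N, μ (E₁ n) ≤ ENNReal.ofReal (4 * K' * (1 / (n * δ' + P) ^ 2)) := by
    intro n hn
    by_cases h0 : n₀ ≤ n
    · refine (measure_mono fun φ hφ => hφ.2).trans
        ((hK μ hμ S w N hS y hy n hn (hlow n h0 hn) (u n) (hu0 n)).trans ?_)
      refine ENNReal.ofReal_le_ofReal ?_
      have h1 : u n ^ 2 = (n * δ' + P) ^ 2 / 4 := by simp only [hu]; ring
      rw [h1, div_div_eq_mul_div, mul_one_div, mul_comm K]
      have := hu0 n
      gcongr
      exact le_max_left _ _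
    · simp [hE₁, h0]
  have b2 : ∀ n ≤ N, μ (E₂ n) ≤ eexp (θ * δ / 4 * C₀ - θ * P / 2) *
      eexp (-((n : ℝ) - (0 : ℕ)) * (θ * δ' / 4)) := by
    intro n hn
    refine (hμ.measure_lt_neg_le (n, y) (u n / γ) (θ := θ * γ) (by positivity)).trans ?_
    rw [← eexp_add]
    refine eexp_le ?_
    have h1 : C (n, y) (n, y) ≤ n * Real.log 2 + C₀ := hC.far n n n y y (by simp)
    have h2 : (θ * γ) ^ 2 / 2 = θ * δ / 4 := by
      rw [mul_pow, sq θ, mul_assoc, hθγ]; ring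
    have h3 : θ * γ * (u n / γ) = θ * (n * δ' + P) / 2 := by
      simp only [hu]; field_simp
    rw [h2, h3]
    have := mul_le_mul_of_nonneg_left h1 (by positivity : 0 ≤ θ * δ / 4)
    rw [hδ']
    push_cast
    nlinarith
  have hsub : {φ | (fun i => φ i + β * C i (N, y)) ∈ {φ | ∃ n, n₀ ≤ n ∧ n ≤ N ∧
      mass C γ w N φ (nbhd S y n) <
        eexp (-L - n * (d + γ ^ 2 / 2 - γ * β + δ) * Real.log 2)}} ⊆
      (⋃ n ∈ Finset.Icc 0 N, E₁ n) ∪ ⋃ n ∈ Finset.Icc 0 N, E₂ n := by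
    rintro φ ⟨n, h0, hn, hlt⟩
    have hlt2 : mass C γ w N φ (nbhd S y n) <
        eexp (-L - n * (d + γ ^ 2 / 2 + δ) * Real.log 2 + γ * β * C₀) := by
      rw [mass_shift] at hlt
      have h1 : eexp (γ * β * (n * Real.log 2 - C₀)) * mass C γ w N φ (nbhd S y n) ≤
          ∑ z ∈ nbhd S y n, eexp (γ * β * C (N, z) (N, y)) * (w * dens C γ N φ z) := by
        rw [mass, Finset.mul_sum]
        refine Finset.sum_le_sum fun z hz => mul_le_mul_left (eexp_le ?_) _
        exact mul_le_mul_of_nonneg_left (hC.near n N N z y (mem_nbhd.1 hz).2 hn hn)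
          (by positivity)
      calc mass C γ w N φ (nbhd S y n) = eexp (-(γ * β * (n * Real.log 2 - C₀))) *
            (eexp (γ * β * (n * Real.log 2 - C₀)) * mass C γ w N φ (nbhd S y n)) := by
            rw [← mul_assoc, ← eexp_add, neg_add_cancel, eexp_zero, one_mul]
        _ < eexp (-(γ * β * (n * Real.log 2 - C₀))) *
            eexp (-L - n * (d + γ ^ 2 / 2 - γ * β + δ) * Real.log 2) :=
            ENNReal.mul_lt_mul_right (eexp_ne_zero _) (eexp_ne_top _) (h1.trans_lt hlt)
        _ = _ := by rw [← eexp_add]; congr 1; ring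
    by_cases h2 : φ (n, y) < -(u n / γ)
    · right
      simp only [Set.mem_iUnion]
      exact ⟨n, by simpa using hn, h2⟩
    · left
      simp only [Set.mem_iUnion]
      refine ⟨n, by simpa using hn, h0, hlt2.trans_le (eexp_le ?_)⟩
      have h3 : -(u n) ≤ γ * φ (n, y) := by
        rw [not_lt] at h2
        calc -(u n) = γ * -(u n / γ) := by field_simp
          _ ≤ _ := mul_le_mul_of_nonneg_left h2 hγ.le
      have h4 : 2 * u n = n * δ' + P := by simp only [hu]; ring
      rw [hδ', hP] at h4
      linarith
  have s1 : ∑ n ∈ Finset.Icc 0 N, μ (E₁ n) ≤ eexp (-M - 1) := by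
    calc _ ≤ ∑ n ∈ Finset.range (N + 1), ENNReal.ofReal (4 * K' * (1 / (n * δ' + P) ^ 2)) := by
          rw [← Nat.range_succ_eq_Icc_zero]
          exact Finset.sum_le_sum fun n hn => b1 n (by simpa [Nat.lt_succ_iff] using hn)
      _ = ENNReal.ofReal (4 * K' * ∑ n ∈ Finset.range (N + 1), 1 / (n * δ' + P) ^ 2) := by
          rw [Finset.mul_sum, ENNReal.ofReal_sum_of_nonneg fun n _ => by positivity]
      _ ≤ _ := by
          refine ENNReal.ofReal_le_ofReal ?_
          refine (mul_le_mul_of_nonneg_left (sum_inv_sq_le hδ'0 hP0 _) (by positivity)).trans ?_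
          have h5 : 4 * K' / δ' * Real.exp (M + 1) ≤ P - δ' := by linarith
          rw [mul_one_div, ← div_div, div_le_iff₀ (by linarith)]
          calc 4 * K' / δ' = Real.exp (-M - 1) * (4 * K' / δ' * Real.exp (M + 1)) := by
                rw [mul_left_comm, ← Real.exp_add]; simp
            _ ≤ _ := mul_le_mul_of_nonneg_left h5 (Real.exp_pos _).le
  have s2 : ∑ n ∈ Finset.Icc 0 N, μ (E₂ n) ≤ eexp (-M - 1) := by
    calc _ ≤ ∑ n ∈ Finset.Icc 0 N, eexp (θ * δ / 4 * C₀ - θ * P / 2) *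
            eexp (-((n : ℝ) - (0 : ℕ)) * (θ * δ' / 4)) :=
          Finset.sum_le_sum fun n hn => b2 n (Finset.mem_Icc.1 hn).2
      _ ≤ eexp (θ * δ / 4 * C₀ - θ * P / 2) * eexp G := by
          rw [← Finset.mul_sum]; exact mul_le_mul_right (hG 0 N) _
      _ ≤ _ := by rw [← eexp_add]; exact eexp_le (by linarith)
  calc _ ≤ μ (⋃ n ∈ Finset.Icc 0 N, E₁ n) + μ (⋃ n ∈ Finset.Icc 0 N, E₂ n) :=
        (measure_mono hsub).trans (measure_union_le _ _)
    _ ≤ eexp (-M - 1) + eexp (-M - 1) := add_le_add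
        ((measure_biUnion_finset_le _ _).trans s1) ((measure_biUnion_finset_le _ _).trans s2)
    _ ≤ _ := by rw [← two_mul]; exact two_mul_eexp_sub_one_le _

end Tilted

/-- A discretisation of the chaos: a grid `S` with cell volume `w`, observed at scale `rad N`,
together with the subset `I` of the grid points that are kept away from the boundary. -/
structure Stage (d : ℕ) where
  S : Finset (EuclideanSpace ℝ (Fin d))
  I : Finset (EuclideanSpace ℝ (Fin d))
  w : ℝ≥0∞
  N : ℕ

structure Stage.Valid (T : Stage d) (C₁ c₁ c₂ : ℝ) (n₀ : ℕ) : Prop where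
  subset : T.I ⊆ T.S
  grid : UpperGrid T.S T.w T.N C₁
  lower : ∀ y ∈ T.I, ∀ n, n₀ ≤ n → n ≤ T.N →
    eexp (c₁ - n * d * Real.log 2) ≤ T.w * (nbhd T.S y n).card
  card_le : eexp c₂ ≤ T.w * T.I.card

/-- The point `y` is regular for the chaos of parameter `γ`, with local dimension `α`, and for the
chaos of parameter `β`, with local dimension at least `s`. -/
def IsGood (C : Site d → Site d → ℝ) (γ β s α : ℝ) (B : ℕ → ℝ) (n₀ : ℕ) (h : ℝ) (T : Stage d)
    (φ : Site d → ℝ) (y : EuclideanSpace ℝ (Fin d)) : Prop :=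
  (∀ n, n₀ ≤ n → n ≤ T.N → ∀ j : ℕ,
    mass C γ T.w T.N φ (nbhd T.S y n) ≤
        eexp (h + B j - n * (α - 1 / (j + 1)) * Real.log 2) ∧
      eexp (-(h + B j) - n * (α + 1 / (j + 1)) * Real.log 2) ≤
        mass C γ T.w T.N φ (nbhd T.S y n)) ∧
  ∀ n ≤ T.N, mass C β T.w T.N φ (nbhd T.S y n) ≤ eexp (h + B 0 - n * s * Real.log 2)

def goodMass (C : Site d → Site d → ℝ) (γ β s α : ℝ) (B : ℕ → ℝ) (n₀ : ℕ) (h : ℝ) (T : Stage d)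
    (φ : Site d → ℝ) : ℝ≥0∞ :=
  ∑ y ∈ T.I, T.w * (dens C β T.N φ y * {φ | IsGood C γ β s α B n₀ h T φ y}.indicator 1 φ)

section Good

variable {C : Site d → Site d → ℝ} {C₀ C₁ c₁ c₂ γ β s α h h' : ℝ} {B : ℕ → ℝ} {n₀ : ℕ}
  {T : Stage d} {μ : Measure (Site d → ℝ)} {φ ψ : Site d → ℝ}

lemma IsGood.mono (hh : h ≤ h') {y : EuclideanSpace ℝ (Fin d)}
    (hy : IsGood C γ β s α B n₀ h T φ y) : IsGood C γ β s α B n₀ h' T φ y := by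
  refine ⟨fun n hn hN j => ⟨(hy.1 n hn hN j).1.trans (eexp_le (by linarith)),
    (eexp_le (by linarith)).trans (hy.1 n hn hN j).2⟩,
    fun n hN => (hy.2 n hN).trans (eexp_le (by linarith))⟩

lemma goodMass_mono (hh : h ≤ h') :
    goodMass C γ β s α B n₀ h T φ ≤ goodMass C γ β s α B n₀ h' T φ := by
  refine Finset.sum_le_sum fun y _ => mul_le_mul_right (mul_le_mul_right ?_ _) _
  exact Set.indicator_le_indicator_of_subset (fun φ hφ => IsGood.mono hh hφ)
    (fun _ => by simp) φ

lemma measurableSet_isGood (y : EuclideanSpace ℝ (Fin d)) :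
    MeasurableSet {φ | IsGood C γ β s α B n₀ h T φ y} := by
  have hmγ := fun T' => measurable_mass C γ T.w T.N T'
  have hmβ := fun T' => measurable_mass C β T.w T.N T'
  simp only [IsGood, Set.ofPred_and, Set.ofPred_forall]
  refine MeasurableSet.inter ?_ ?_
  · refine MeasurableSet.iInter fun n => MeasurableSet.iInter fun _ => MeasurableSet.iInter
      fun _ => MeasurableSet.iInter fun j => MeasurableSet.inter ?_ ?_
    · exact measurableSet_le (hmγ _) measurable_const
    · exact measurableSet_le measurable_const (hmγ _)
  · exact MeasurableSet.iInter fun n => MeasurableSet.iInter fun _ =>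
      measurableSet_le (hmβ _) measurable_const

lemma measurable_goodMass (T : Stage d) : Measurable (goodMass C γ β s α B n₀ h T) := by
  unfold goodMass
  refine Finset.measurable_sum _ fun y _ => Measurable.const_mul ?_ _
  exact (measurable_dens C β T.N y).mul
    (measurable_one.indicator (measurableSet_isGood y))

lemma goodMass_le_mass : goodMass C γ β s α B n₀ h T φ ≤ mass C β T.w T.N φ T.I := by
  refine Finset.sum_le_sum fun y _ => mul_le_mul_right ?_ _
  refine (mul_le_mul_right (Set.indicator_le_self _ _ _) _).trans ?_
  simp

/-- Most of the mass of the chaos of parameter `β` sits on good points. -/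
lemma exists_isGood_lower (hC : KernelBound C C₀) (C₁ c₁ : ℝ) (hγ : 0 < γ) (hγd : γ ^ 2 < 2 * d)
    (hβ : 0 < β) (hβd : β ^ 2 < 2 * d) (hα : α = d + γ ^ 2 / 2 - γ * β) (hα0 : 0 < α)
    (hs : s < d - β ^ 2 / 2) :
    ∃ B : ℕ → ℝ, ∀ (μ : Measure (Site d → ℝ)), GaussField μ C → ∀ (T : Stage d) (c₂ : ℝ) (n₀ : ℕ),
      T.Valid C₁ c₁ c₂ n₀ → ∀ y ∈ T.I, eexp (-1) ≤
        ∫⁻ φ, dens C β T.N φ y * {φ | IsGood C γ β s α B n₀ 0 T φ y}.indicator 1 φ ∂μ := by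
  obtain ⟨ε, hε0, hε⟩ := ENNReal.exists_pos_sum_of_countable'
    (ε := eexp (-2) ) (eexp_ne_zero _) ℕ
  have hM : ∀ j, ∃ M : ℝ, eexp (-M) ≤ ε j := fun j => by
    have h1 : ε j ≠ ⊤ := ((ENNReal.le_tsum j).trans_lt (hε.trans_le le_top)).ne
    obtain ⟨a, ha⟩ := exists_eq_eexp (hε0 j).ne' h1
    exact ⟨-a, by rw [neg_neg, ha]⟩
  choose M hM using hM
  have hδ : ∀ j : ℕ, (0 : ℝ) < 1 / (j + 1) := fun j => by positivity
  choose L hL using fun j : ℕ => exists_tilted_upper hC C₁ hγ hβ.le (hα ▸ hα0) (hδ j) (M j + 1)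
  choose L' hL' using fun j : ℕ =>
    exists_tilted_lower hC C₁ c₁ hγ hγd hβ.le (hδ j) (M j + 1)
  obtain ⟨L'', hL''⟩ := exists_tilted_upper hC C₁ hβ hβ.le (by nlinarith)
    (sub_pos.2 hs) 2
  refine ⟨fun j => max (max (L j) (L' j)) L'', fun μ hμ T c₂ n₀ hT y hy => ?_⟩
  set B : ℕ → ℝ := fun j => max (max (L j) (L' j)) L'' with hB
  have hprob := hμ.isProbabilityMeasure
  have hyS := hT.subset hy
  have hmd := measurable_dens C β T.N y
  set U : ℕ → Set (Site d → ℝ) := fun j => {φ | ∃ n ≤ T.N,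
    eexp (B j - n * (d + γ ^ 2 / 2 - γ * β - 1 / (j + 1)) * Real.log 2) <
      mass C γ T.w T.N φ (nbhd T.S y n)} with hU
  set V : ℕ → Set (Site d → ℝ) := fun j => {φ | ∃ n, n₀ ≤ n ∧ n ≤ T.N ∧
    mass C γ T.w T.N φ (nbhd T.S y n) <
      eexp (-B j - n * (d + γ ^ 2 / 2 - γ * β + 1 / (j + 1)) * Real.log 2)} with hV
  set W : Set (Site d → ℝ) := {φ | ∃ n ≤ T.N,
    eexp (B 0 - n * (d + β ^ 2 / 2 - β * β - (d - β ^ 2 / 2 - s)) * Real.log 2) <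
      mass C β T.w T.N φ (nbhd T.S y n)} with hW
  have h1 : ∀ j, ∫⁻ φ, dens C β T.N φ y * (U j).indicator 1 φ ∂μ ≤ eexp (-(M j + 1)) := fun j =>
    hL j (B j) ((le_max_left _ _).trans (le_max_left _ _)) μ hμ T.S T.w T.N hT.grid y hyS
  have h2 : ∀ j, ∫⁻ φ, dens C β T.N φ y * (V j).indicator 1 φ ∂μ ≤ eexp (-(M j + 1)) := fun j =>
    hL' j (B j) ((le_max_right _ _).trans (le_max_left _ _)) μ hμ T.S T.w T.N hT.grid n₀ y hyS
      (hT.lower y hy)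
  have h3 : ∫⁻ φ, dens C β T.N φ y * W.indicator 1 φ ∂μ ≤ eexp (-2) :=
    hL'' (B 0) (le_max_right _ _) μ hμ T.S T.w T.N hT.grid y hyS
  set A := {φ | IsGood C γ β s α B n₀ 0 T φ y} with hA
  have hcov : ∀ φ, φ ∉ A → φ ∈ W ∨ ∃ j, φ ∈ U j ∨ φ ∈ V j := by
    intro φ hφ
    by_contra! hcon
    obtain ⟨hc1, hc2⟩ := hcon
    refine hφ ⟨fun n hn hN j => ⟨?_, ?_⟩, fun n hN => ?_⟩
    · by_contra! hlt
      refine (hc2 j).1 ⟨n, hN, ?_⟩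
      rwa [zero_add, hα] at hlt
    · by_contra! hlt
      refine (hc2 j).2 ⟨n, hn, hN, ?_⟩
      rwa [zero_add, hα] at hlt
    · by_contra! hlt
      refine hc1 ⟨n, hN, ?_⟩
      rw [zero_add] at hlt
      have : (d + β ^ 2 / 2 - β * β - (d - β ^ 2 / 2 - s)) = s := by ring
      rwa [this]
  have hpt : ∀ φ, dens C β T.N φ y ≤ dens C β T.N φ y * A.indicator 1 φ +
      (dens C β T.N φ y * W.indicator 1 φ +
        ∑' j, (dens C β T.N φ y * (U j).indicator 1 φ +
          dens C β T.N φ y * (V j).indicator 1 φ)) := by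
    intro φ
    by_cases hφ : φ ∈ A
    · simp [hφ]
    · rcases hcov φ hφ with hw | ⟨j, hj⟩
      · refine le_add_left (le_add_right ?_)
        simp [hw]
      · refine le_add_left (le_add_left (le_trans ?_ (ENNReal.le_tsum j)))
        rcases hj with hj | hj <;> simp [hj]
  have hmγ := fun T' => measurable_mass C γ T.w T.N T'
  have hmβ := fun T' => measurable_mass C β T.w T.N T'
  have mA : Measurable (A.indicator (1 : (Site d → ℝ) → ℝ≥0∞)) :=
    measurable_one.indicator (measurableSet_isGood y)
  have mW : Measurable (W.indicator (1 : (Site d → ℝ) → ℝ≥0∞)) := by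
    refine measurable_one.indicator ?_
    simp only [hW, Set.ofPred_exists, Set.ofPred_and]
    exact MeasurableSet.iUnion fun n => (MeasurableSet.const _).inter
      (measurableSet_lt measurable_const (hmβ _))
  have mU : ∀ j, Measurable ((U j).indicator (1 : (Site d → ℝ) → ℝ≥0∞)) := fun j => by
    refine measurable_one.indicator ?_
    simp only [hU, Set.ofPred_exists, Set.ofPred_and]
    exact MeasurableSet.iUnion fun n => (MeasurableSet.const _).inter
      (measurableSet_lt measurable_const (hmγ _))
  have mV : ∀ j, Measurable ((V j).indicator (1 : (Site d → ℝ) → ℝ≥0∞)) := fun j => by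
    refine measurable_one.indicator ?_
    simp only [hV, Set.ofPred_exists, Set.ofPred_and]
    exact MeasurableSet.iUnion fun n => (MeasurableSet.const _).inter
      ((MeasurableSet.const _).inter (measurableSet_lt (hmγ _) measurable_const))
  have mA' : Measurable fun φ => dens C β T.N φ y * A.indicator 1 φ := hmd.mul mA
  have mW' : Measurable fun φ => dens C β T.N φ y * W.indicator 1 φ := hmd.mul mW
  have mU' : ∀ j, Measurable fun φ => dens C β T.N φ y * (U j).indicator 1 φ :=
    fun j => hmd.mul (mU j)
  have mV' : ∀ j, Measurable fun φ => dens C β T.N φ y * (V j).indicator 1 φ :=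
    fun j => hmd.mul (mV j)
  have hone : ∫⁻ φ, dens C β T.N φ y ∂μ = 1 := by
    have := hμ.lintegral_dens_mul (γ := β) (N := T.N) y (F := 1) measurable_one
    simpa using this
  have hsum : ∑' j, (eexp (-(M j + 1)) + eexp (-(M j + 1))) ≤ eexp (-2) := by
    refine (ENNReal.tsum_le_tsum fun j => ?_).trans hε.le
    refine le_trans ?_ (hM j)
    rw [← two_mul, neg_add, ← sub_eq_add_neg]
    exact two_mul_eexp_sub_one_le _
  have htot : 1 ≤ (∫⁻ φ, dens C β T.N φ y * A.indicator 1 φ ∂μ) + eexp (-1) := by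
    calc (1 : ℝ≥0∞) = ∫⁻ φ, dens C β T.N φ y ∂μ := hone.symm
      _ ≤ _ := lintegral_mono hpt
      _ = (∫⁻ φ, dens C β T.N φ y * A.indicator 1 φ ∂μ) +
          ((∫⁻ φ, dens C β T.N φ y * W.indicator 1 φ ∂μ) +
          ∑' j, ((∫⁻ φ, dens C β T.N φ y * (U j).indicator 1 φ ∂μ) +
            ∫⁻ φ, dens C β T.N φ y * (V j).indicator 1 φ ∂μ)) := by
          rw [lintegral_add_left mA', lintegral_add_left mW', lintegral_tsum]
          · congr 2
            refine tsum_congr fun j => ?_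
            rw [lintegral_add_left (mU' j)]
          · exact fun j => ((mU' j).add (mV' j)).aemeasurable
      _ ≤ (∫⁻ φ, dens C β T.N φ y * A.indicator 1 φ ∂μ) + (eexp (-2) + eexp (-2)) := by
          gcongr
          exact (ENNReal.tsum_le_tsum fun j => add_le_add (h1 j) (h2 j)).trans hsum
      _ ≤ _ := by
          gcongr
          rw [← two_mul]
          have := two_mul_eexp_sub_one_le (-1)
          norm_num at this
          exact this
  have h5 : eexp (-1) + eexp (-1) ≤ 1 := by
    have := two_mul_eexp_sub_one_le 0
    rw [eexp_zero, zero_sub, two_mul] at this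
    exact this
  exact (ENNReal.add_le_add_iff_right (eexp_ne_top _)).1 (h5.trans htot)

/-- With probability bounded below uniformly over the stages, good points carry a macroscopic
mass. -/
lemma exists_goodMass_lower (hC : KernelBound C C₀) (C₁ c₁ c₂ : ℝ) (hγ : 0 < γ)
    (hγd : γ ^ 2 < 2 * d) (hβ : 0 < β) (hβd : β ^ 2 < 2 * d)
    (hα : α = d + γ ^ 2 / 2 - γ * β) (hα0 : 0 < α) (hs : s < d - β ^ 2 / 2) :
    ∃ (B : ℕ → ℝ) (c : ℝ), ∀ (μ : Measure (Site d → ℝ)), GaussField μ C →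
      ∀ (T : Stage d) (n₀ : ℕ), T.Valid C₁ c₁ c₂ n₀ →
      eexp c ≤ μ {φ | eexp (c₂ - 3) ≤ goodMass C γ β s α B n₀ 0 T φ} := by
  obtain ⟨B, hB⟩ := exists_isGood_lower hC C₁ c₁ hγ hγd hβ hβd hα hα0 hs
  set t := (2 * d / β ^ 2 - 1) / 2 with ht
  have hβ2 : 0 < β ^ 2 := by positivity
  have ht0 : 0 < t := by
    have : 1 < 2 * d / β ^ 2 := by rwa [lt_div_iff₀ hβ2, one_mul]
    rw [ht]; linarith
  have hp : β ^ 2 * (1 + t) < 2 * d := by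
    have : β ^ 2 * (1 + t) = (2 * d + β ^ 2) / 2 := by rw [ht]; field_simp; ring
    rw [this]; linarith
  obtain ⟨b, hb⟩ := exists_lintegral_mass_rpow_le hC C₁ hβ.le (by linarith : 0 < 1 + t)
    (Or.inr hp)
  obtain ⟨c, hc⟩ := exists_le_measure_of_moment ht0 (c₂ - 1) b
  refine ⟨B, c, fun μ hμ T n₀ hT => ?_⟩
  have hprob := hμ.isProbabilityMeasure
  have key := hc μ (measurable_goodMass T) (measurable_mass C β T.w T.N T.I)
    (fun φ => goodMass_le_mass (C := C) (γ := γ) (β := β) (s := s) (α := α) (B := B) (n₀ := n₀)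
      (h := 0) (T := T)) ?_ ?_
  · convert key using 6
    ring
  · have : ∫⁻ φ, goodMass C γ β s α B n₀ 0 T φ ∂μ = ∑ y ∈ T.I, T.w *
        ∫⁻ φ, dens C β T.N φ y * {φ | IsGood C γ β s α B n₀ 0 T φ y}.indicator 1 φ ∂μ := by
      have hm : ∀ y, Measurable fun φ => dens C β T.N φ y *
          {φ | IsGood C γ β s α B n₀ 0 T φ y}.indicator 1 φ := fun y =>
        (measurable_dens C β T.N y).mul (measurable_one.indicator (measurableSet_isGood y))
      unfold goodMass
      rw [lintegral_finsetSum _ fun y _ => (hm y).const_mul _]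
      exact Finset.sum_congr rfl fun y _ => lintegral_const_mul _ (hm y)
    rw [this]
    calc eexp (c₂ - 1) = eexp c₂ * eexp (-1) := by rw [← eexp_add, sub_eq_add_neg]
      _ ≤ T.w * T.I.card * eexp (-1) := mul_le_mul_left hT.card_le _
      _ = ∑ y ∈ T.I, T.w * eexp (-1) := by
          rw [Finset.sum_const, nsmul_eq_mul]; ring
      _ ≤ _ := Finset.sum_le_sum fun y hy => mul_le_mul_right (hB μ hμ T c₂ n₀ hT y hy) _
  · rcases T.I.eq_empty_or_nonempty with h0 | ⟨x, hx⟩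
    · have := hT.card_le
      simp [h0, eexp_ne_zero] at this
    have hxS := hT.subset hx
    have hsub : T.I ⊆ nbhd T.S x 0 := fun z hz => mem_nbhd.2
      ⟨hT.subset hz, by rw [rad_zero]; exact hT.grid.dist_le _ (hT.subset hz) _ hxS⟩
    have h1 := hb μ hμ T.S T.w T.N hT.grid x hxS 0 (Nat.zero_le _)
    simp only [Nat.cast_zero, zero_mul, sub_zero] at h1
    refine (lintegral_mono fun φ => ?_).trans h1
    calc goodMass C γ β s α B n₀ 0 T φ * mass C β T.w T.N φ T.I ^ t
        ≤ mass C β T.w T.N φ T.I * mass C β T.w T.N φ T.I ^ t :=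
          mul_le_mul_left goodMass_le_mass _
      _ = mass C β T.w T.N φ T.I ^ (1 + t) := by
          rw [ENNReal.rpow_add_of_nonneg _ _ zero_le_one ht0.le, ENNReal.rpow_one]
      _ ≤ _ := ENNReal.rpow_le_rpow (mass_mono hsub φ) (by linarith)

lemma dens_le_of_le {V : ℝ} (hγ : 0 ≤ γ) (y : EuclideanSpace ℝ (Fin d)) {N : ℕ}
    (h : φ (N, y) ≤ ψ (N, y) + V) : dens C γ N φ y ≤ eexp (γ * V) * dens C γ N ψ y := by
  rw [dens, dens, ← eexp_add]
  exact eexp_le (by nlinarith [mul_le_mul_of_nonneg_left h hγ])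

lemma mass_le_of_le {V : ℝ} (hγ : 0 ≤ γ) {w : ℝ≥0∞} {N : ℕ}
    {A : Finset (EuclideanSpace ℝ (Fin d))} (h : ∀ i, φ i ≤ ψ i + V) :
    mass C γ w N φ A ≤ eexp (γ * V) * mass C γ w N ψ A := by
  rw [mass, mass, Finset.mul_sum]
  refine Finset.sum_le_sum fun y _ => ?_
  rw [mul_left_comm]
  exact mul_le_mul_right (dens_le_of_le hγ y (h _)) _

lemma IsGood.shift {V : ℝ} (hγ : 0 ≤ γ) (hβ : 0 ≤ β) (hV : 0 ≤ V) (h1 : ∀ i, φ i ≤ ψ i + V)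
    (h2 : ∀ i, ψ i ≤ φ i + V) {y : EuclideanSpace ℝ (Fin d)}
    (hy : IsGood C γ β s α B n₀ h T φ y) :
    IsGood C γ β s α B n₀ (h + (γ + β) * V) T ψ y := by
  have p1 := mul_nonneg hγ hV
  have p2 := mul_nonneg hβ hV
  refine ⟨fun n hn hN j => ⟨?_, ?_⟩, fun n hN => ?_⟩
  · refine (mass_le_of_le hγ h2).trans ((mul_le_mul_right (hy.1 n hn hN j).1 _).trans ?_)
    rw [← eexp_add]; exact eexp_le (by linarith)
  · have h3 := (hy.1 n hn hN j).2.trans (mass_le_of_le hγ h1)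
    calc _ ≤ eexp (-(γ * V)) * eexp (-(h + B j) - n * (α + 1 / (j + 1)) * Real.log 2) := by
          rw [← eexp_add]; exact eexp_le (by linarith)
      _ ≤ eexp (-(γ * V)) * (eexp (γ * V) * mass C γ T.w T.N ψ (nbhd T.S y n)) :=
          mul_le_mul_right h3 _
      _ = _ := by rw [← mul_assoc, ← eexp_add, neg_add_cancel, eexp_zero, one_mul]
  · refine (mass_le_of_le hβ h2).trans ((mul_le_mul_right (hy.2 n hN) _).trans ?_)
    rw [← eexp_add]; exact eexp_le (by linarith)

lemma goodMass_shift {V : ℝ} (hγ : 0 ≤ γ) (hβ : 0 ≤ β) (hV : 0 ≤ V) (h1 : ∀ i, φ i ≤ ψ i + V)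
    (h2 : ∀ i, ψ i ≤ φ i + V) : goodMass C γ β s α B n₀ h T φ ≤
      eexp (β * V) * goodMass C γ β s α B n₀ (h + (γ + β) * V) T ψ := by
  rw [goodMass, goodMass, Finset.mul_sum]
  refine Finset.sum_le_sum fun y _ => ?_
  rw [mul_left_comm (eexp _)]
  refine mul_le_mul_right ?_ _
  by_cases hy : IsGood C γ β s α B n₀ h T φ y
  · have hy' := hy.shift hγ hβ hV h1 h2
    simpa [Set.indicator, hy, hy'] using dens_le_of_le hβ y (h1 _)
  · simp [Set.indicator, hy]

lemma KernelBound.abs_cmShift_le (hC : KernelBound C C₀) (l : Site d →₀ ℝ) :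
    ∃ V, 0 ≤ V ∧ ∀ i, |cmShift C l i| ≤ V := by
  have hb : ∀ i j : Site d, |C i j| ≤ j.1 * Real.log 2 + |C₀| := by
    rintro ⟨m, x⟩ ⟨m', y⟩
    rw [abs_le]
    have h0 : (0 : ℝ) ≤ m' * Real.log 2 := mul_nonneg (Nat.cast_nonneg _) log_two_pos.le
    have h1 := hC.far m' m m' x y (Or.inr (Or.inr le_rfl))
    have h2 := hC.low (m, x) (m', y)
    have h3 := le_abs_self C₀
    constructor <;> simp only <;> linarith
  refine ⟨∑ j ∈ l.support, |l j| * (j.1 * Real.log 2 + |C₀|), ?_, fun i => ?_⟩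
  · refine Finset.sum_nonneg fun j _ => mul_nonneg (abs_nonneg _) ?_
    have := log_two_pos.le
    positivity
  · rw [cmShift, linForm_eq_sum]
    refine (Finset.abs_sum_le_sum_abs _ _).trans (Finset.sum_le_sum fun j _ => ?_)
    rw [abs_mul]
    exact mul_le_mul_of_nonneg_left (hb i j) (abs_nonneg _)

/-- Along infinitely many stages, the good points carry a mass bounded below. -/
def goodEvent (C : Site d → Site d → ℝ) (γ β s α : ℝ) (B : ℕ → ℝ) (n₀ : ℕ) (T : ℕ → Stage d) :
    Set (Site d → ℝ) :=
  {φ | ∃ H : ℕ, ∃ᶠ k in atTop, eexp (-(H : ℝ)) ≤ goodMass C γ β s α B n₀ H (T k) φ}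

lemma measurableSet_goodEvent (T : ℕ → Stage d) :
    MeasurableSet (goodEvent C γ β s α B n₀ T) := by
  have : goodEvent C γ β s α B n₀ T = ⋃ H : ℕ, ⋂ i : ℕ, ⋃ k : ℕ, ⋃ _ : i ≤ k,
      {φ | eexp (-(H : ℝ)) ≤ goodMass C γ β s α B n₀ H (T k) φ} := by
    ext φ
    simp only [goodEvent, frequently_atTop, Set.mem_iUnion, Set.mem_iInter, Set.mem_ofPred_eq,
      exists_prop]
  rw [this]
  exact MeasurableSet.iUnion fun H => MeasurableSet.iInter fun i => MeasurableSet.iUnion fun k =>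
    MeasurableSet.iUnion fun _ => measurableSet_le measurable_const (measurable_goodMass _)

lemma measure_frequently_ge {E : Type*} [MeasurableSpace E] {ρ : Measure E} [IsFiniteMeasure ρ]
    {A : ℕ → Set E} (hA : ∀ k, MeasurableSet (A k)) {c : ℝ≥0∞} (hc : ∀ k, c ≤ ρ (A k)) :
    c ≤ ρ {x | ∃ᶠ k in atTop, x ∈ A k} := by
  have h1 : {x | ∃ᶠ k in atTop, x ∈ A k} = ⋂ i : ℕ, ⋃ k : ℕ, ⋃ _ : i ≤ k, A k := by
    ext x
    simp [frequently_atTop]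
  rw [h1]
  have hmeas : ∀ i : ℕ, MeasurableSet (⋃ k : ℕ, ⋃ _ : i ≤ k, A k) := fun i =>
    MeasurableSet.iUnion fun k => MeasurableSet.iUnion fun _ => hA k
  have h2 : Antitone fun i : ℕ => ⋃ k : ℕ, ⋃ _ : i ≤ k, A k := by
    intro i j hij x hx
    simp only [Set.mem_iUnion] at hx ⊢
    obtain ⟨k, hk, hx⟩ := hx
    exact ⟨k, hij.trans hk, hx⟩
  have h3 := tendsto_measure_iInter_atTop (μ := ρ) (fun i => (hmeas i).nullMeasurableSet) h2
    ⟨0, measure_ne_top _ _⟩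
  refine ge_of_tendsto' h3 fun i => (hc i).trans (measure_mono ?_)
  intro x hx
  simp only [Set.mem_iUnion]
  exact ⟨i, le_rfl, hx⟩

/-- Almost surely, along infinitely many stages, the good points carry a mass bounded below. -/
theorem exists_goodEvent_ae (hC : KernelBound C C₀) (C₁ c₁ c₂ : ℝ) (hγ : 0 < γ)
    (hγd : γ ^ 2 < 2 * d) (hβ : 0 < β) (hβd : β ^ 2 < 2 * d)
    (hα : α = d + γ ^ 2 / 2 - γ * β) (hα0 : 0 < α) (hs : s < d - β ^ 2 / 2) :
    ∃ B : ℕ → ℝ, ∀ (μ : Measure (Site d → ℝ)), GaussField μ C →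
      ∀ (T : ℕ → Stage d) (n₀ : ℕ), (∀ k, (T k).Valid C₁ c₁ c₂ n₀) →
      ∀ᵐ φ ∂μ, φ ∈ goodEvent C γ β s α B n₀ T := by
  obtain ⟨B, c, hB⟩ := exists_goodMass_lower hC C₁ c₁ c₂ hγ hγd hβ hβd hα hα0 hs
  refine ⟨B, fun μ hμ T n₀ hT => ?_⟩
  have hprob := hμ.isProbabilityMeasure
  refine hμ.zero_one (measurableSet_goodEvent T) ?_ ?_
  · rintro l φ ⟨H, hH⟩
    obtain ⟨V, hV0, hV⟩ := hC.abs_cmShift_le l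
    obtain ⟨H', hH'⟩ := exists_nat_ge (H + (γ + β) * V)
    refine ⟨H', hH.mono fun k hk => ?_⟩
    have h1 := hk.trans (goodMass_shift (ψ := fun i => φ i + cmShift C l i) hγ.le hβ.le hV0
      (fun i => by have := (abs_le.1 (hV i)).1; linarith)
      (fun i => by have := (abs_le.1 (hV i)).2; linarith))
    have p1 := mul_nonneg hγ.le hV0
    calc eexp (-(H' : ℝ)) ≤ eexp (-(β * V)) * eexp (-(H : ℝ)) := by
          rw [← eexp_add]; exact eexp_le (by linarith)
      _ ≤ _ := mul_le_mul_right h1 _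
      _ = goodMass C γ β s α B n₀ (H + (γ + β) * V) (T k) _ := by
          rw [← mul_assoc, ← eexp_add, neg_add_cancel, eexp_zero, one_mul]
      _ ≤ _ := goodMass_mono hH'
  · have h1 := measure_frequently_ge (ρ := μ)
      (fun k => measurableSet_le measurable_const (measurable_goodMass (T k)))
      (fun k => hB μ hμ (T k) n₀ (hT k))
    refine fun h0 => eexp_ne_zero c (le_antisymm (h1.trans ((measure_mono ?_).trans h0.le)) ?_)
    · intro φ hφ
      obtain ⟨H, hH⟩ := exists_nat_ge (3 - c₂)
      refine ⟨H, Frequently.mono hφ fun k hk => ?_⟩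
      exact (eexp_le (by linarith)).trans (le_trans hk (goodMass_mono (Nat.cast_nonneg H)))
    · exact zero_le

end Good

section Deterministic

lemma tendsto_log_div_log {F : ℝ → ℝ≥0∞} (hF : Monotone F) {α : ℝ}
    (h : ∀ δ > 0, ∃ (c : ℝ) (n₁ : ℕ), ∀ n ≥ n₁,
      F (rad n) ≤ eexp (c - n * (α - δ) * Real.log 2) ∧
      eexp (-c - n * (α + δ) * Real.log 2) ≤ F (rad n)) :
    Tendsto (fun ε : ℝ => Real.log (F ε).toReal / Real.log ε) (𝓝[>] (0 : ℝ)) (𝓝 α) := by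
  rw [Metric.tendsto_nhds]
  intro e he
  obtain ⟨c, n₁, hc⟩ := h (e / 2) (by positivity)
  have hlog : ∀ᶠ ε in 𝓝[>] (0 : ℝ), Real.log ε <
      -(2 / e * (|c| + (|α| + e / 2) * Real.log 2) + 1) :=
    Real.tendsto_log_nhdsGT_zero.eventually_lt_atBot _
  have hpos : ∀ᶠ ε in 𝓝[>] (0 : ℝ), 0 < ε := eventually_mem_nhdsWithin
  have hsmall : ∀ᶠ ε in 𝓝[>] (0 : ℝ), ε < rad (n₁ + 1) :=
    (nhdsWithin_le_nhds) (gt_mem_nhds (rad_pos _))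
  filter_upwards [hlog, hpos, hsmall] with ε h1 h2 h3
  have hε1 : ε ≤ 1 := h3.le.trans (by rw [← rad_zero]; exact rad_anti (Nat.zero_le _))
  obtain ⟨n, hn1, hn2⟩ := exists_nat_pow_near_of_lt_one h2 hε1
    (by norm_num : (0 : ℝ) < 1 / 2) (by norm_num)
  change rad (n + 1) < ε at hn1
  change ε ≤ rad n at hn2
  have hn : n₁ ≤ n := by
    by_contra! hlt
    exact absurd (h3.trans_le (rad_anti (by omega : n + 1 ≤ n₁ + 1))) hn1.not_gt
  have hup := (hF hn2).trans (hc n hn).1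
  have hlo := (hc (n + 1) (by omega)).2.trans (hF hn1.le)
  have hne0 : F ε ≠ 0 := fun h0 => eexp_ne_zero _ (le_antisymm (h0 ▸ hlo) zero_le)
  have hnet : F ε ≠ ⊤ := (hup.trans_lt (eexp_ne_top _).lt_top).ne
  obtain ⟨z, hz⟩ := exists_eq_eexp hne0 hnet
  rw [hz, eexp_le_iff] at hup hlo
  have hl1 : -Real.log ε ≤ (n + 1) * Real.log 2 := by
    have := Real.log_le_log (rad_pos _) hn1.le
    rw [rad_eq_exp, Real.log_exp] at this
    push_cast at this
    linarith
  have hl2 : n * Real.log 2 ≤ -Real.log ε := by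
    have := Real.log_le_log h2 hn2
    rw [rad_eq_exp, Real.log_exp] at this
    linarith
  have hl := log_two_pos
  rw [hz, eexp_toReal, Real.log_exp, Real.dist_eq]
  set L := -Real.log ε with hL
  have hL1 : |c| + (|α| + e / 2) * Real.log 2 < e / 2 * L := by
    have : 2 / e * (|c| + (|α| + e / 2) * Real.log 2) < L := by linarith
    calc _ = e / 2 * (2 / e * (|c| + (|α| + e / 2) * Real.log 2)) := by field_simp
      _ < _ := by gcongr
  have hA : ∀ a x y : ℝ, |a| ≤ |α| + e / 2 → |x - y| ≤ Real.log 2 →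
      a * x ≤ a * y + (|α| + e / 2) * Real.log 2 := by
    intro a x y ha hxy
    have h5 : |a * (x - y)| ≤ (|α| + e / 2) * Real.log 2 := by
      rw [abs_mul]
      exact mul_le_mul ha hxy (abs_nonneg _) (by positivity)
    have := le_abs_self (a * (x - y))
    nlinarith
  have ha1 : |α - e / 2| ≤ |α| + e / 2 := by
    have := abs_sub α (e / 2)
    rwa [abs_of_pos (by positivity : 0 < e / 2)] at this
  have ha2 : |α + e / 2| ≤ |α| + e / 2 := by
    have := abs_add_le α (e / 2)
    rwa [abs_of_pos (by positivity : 0 < e / 2)] at this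
  have k1 := hA (α - e / 2) L (n * Real.log 2) ha1 (by rw [abs_le]; constructor <;> nlinarith)
  have k2 := hA (α + e / 2) ((n + 1) * Real.log 2) L ha2
    (by rw [abs_le]; constructor <;> nlinarith)
  have c1 := le_abs_self c
  have hLpos : 0 < L := by
    have : 0 ≤ |c| + (|α| + e / 2) * Real.log 2 := by positivity
    nlinarith
  push_cast at hlo
  have hq : z / Real.log ε = -z / L := by rw [hL, neg_div_neg_eq]
  rw [hq, abs_lt]
  constructor
  · rw [lt_sub_iff_add_lt, lt_div_iff₀ hLpos]
    nlinarith
  · rw [sub_lt_iff_lt_add, div_lt_iff₀ hLpos]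
    nlinarith

lemma exists_level {s : ℝ} (hs : 0 < s) {δ e : ℝ≥0∞} (h : δ ^ s < e)
    (he : e ≤ eexp (-s * Real.log 2)) :
    ∃ n : ℕ, δ < ENNReal.ofReal (rad (n + 1)) ∧
      eexp (-n * s * Real.log 2) ≤ eexp (2 * s * Real.log 2) * e := by
  obtain ⟨u, rfl⟩ := exists_eq_eexp (zero_le.trans_lt h).ne'
    (he.trans_lt (eexp_ne_top _).lt_top).ne
  rw [eexp_le_iff] at he
  have h1 : δ < eexp (u / s) := by
    by_contra! hle
    have h2 := ENNReal.rpow_le_rpow hle hs.le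
    rw [eexp_rpow, mul_div_cancel₀ _ hs.ne'] at h2
    exact absurd h h2.not_gt
  have h3 : u / s ≤ -Real.log 2 := by
    rw [div_le_iff₀ hs]; linarith
  have h4 : 2 * Real.exp (u / s) ≤ 1 := by
    calc 2 * Real.exp (u / s) ≤ 2 * Real.exp (-Real.log 2) := by gcongr
      _ = 1 := by rw [Real.exp_neg, Real.exp_log two_pos]; norm_num
  obtain ⟨n, hn1, hn2⟩ := exists_nat_pow_near_of_lt_one
    (by positivity : 0 < 2 * Real.exp (u / s)) h4 (by norm_num : (0 : ℝ) < 1 / 2) (by norm_num)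
  change rad (n + 1) < _ at hn1
  change _ ≤ rad n at hn2
  refine ⟨n, h1.trans_le ?_, ?_⟩
  · refine ENNReal.ofReal_le_ofReal ?_
    rw [rad_succ]; linarith
  · rw [← eexp_add]
    refine eexp_le ?_
    have h5 : rad n < Real.exp (2 * Real.log 2 + u / s) := by
      rw [rad_succ] at hn1
      rw [Real.exp_add, two_mul, Real.exp_add, Real.exp_log two_pos]
      linarith
    rw [rad_eq_exp, Real.exp_lt_exp] at h5
    have h6 := mul_lt_mul_of_pos_left h5 hs
    have h7 : s * (2 * Real.log 2 + u / s) = 2 * s * Real.log 2 + u := by field_simp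
    linarith

/-- The points of `S` at distance at most `r` from `x`. -/
def near (S : Finset (EuclideanSpace ℝ (Fin d))) (x : EuclideanSpace ℝ (Fin d)) (r : ℝ) :
    Finset (EuclideanSpace ℝ (Fin d)) := S.filter fun y => dist y x ≤ r

lemma mem_near {S : Finset (EuclideanSpace ℝ (Fin d))} {x y : EuclideanSpace ℝ (Fin d)} {r : ℝ} :
    y ∈ near S x r ↔ y ∈ S ∧ dist y x ≤ r := by simp [near]

/-- The measure `m` is the limit of the discretised chaos, on balls centred in
`closedBall x₀ ρ`. -/
structure Approximates (C : Site d → Site d → ℝ) (γ : ℝ) (T : ℕ → Stage d) (φ : Site d → ℝ)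
    (m : Measure (EuclideanSpace ℝ (Fin d))) (x₀ : EuclideanSpace ℝ (Fin d)) (ρ : ℝ) : Prop where
  ball_le : ∀ x ∈ Metric.closedBall x₀ ρ, ∀ r r' : ℝ, 0 < r → r < r' → r' ≤ ρ → ∀ c : ℝ≥0∞,
    (∃ᶠ k in atTop, mass C γ (T k).w (T k).N φ (near (T k).S x r') ≤ c) → m (Metric.ball x r) ≤ c
  le_ball : ∀ x ∈ Metric.closedBall x₀ ρ, ∀ r r' : ℝ, 0 < r → r < r' → r' ≤ ρ → ∀ c : ℝ≥0∞,
    (∃ᶠ k in atTop, c ≤ mass C γ (T k).w (T k).N φ (near (T k).S x r)) → c ≤ m (Metric.ball x r')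

variable {C : Site d → Site d → ℝ} {C₁ c₁ c₂ γ β s α h : ℝ} {B : ℕ → ℝ} {n₀ : ℕ}
  {T : ℕ → Stage d} {φ : Site d → ℝ} {m : Measure (EuclideanSpace ℝ (Fin d))}
  {x₀ : EuclideanSpace ℝ (Fin d)}

/-- A limit of good points lies in the level set. -/
lemma tendsto_of_frequently_good (hm : Approximates C γ T φ m x₀ (rad n₀))
    (hN : Tendsto (fun k => (T k).N) atTop atTop) {x : EuclideanSpace ℝ (Fin d)}
    (hx : x ∈ Metric.closedBall x₀ (rad n₀))
    (hg : ∀ ε > 0, ∃ᶠ k in atTop, ∃ y, IsGood C γ β s α B n₀ h (T k) φ y ∧ dist x y < ε) :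
    Tendsto (fun ε : ℝ => Real.log (m (Metric.ball x ε)).toReal / Real.log ε)
      (𝓝[>] (0 : ℝ)) (𝓝 α) := by
  refine tendsto_log_div_log (F := fun ε => m (Metric.ball x ε))
    (fun a b hab => measure_mono (Metric.ball_subset_ball hab)) fun δ hδ => ?_
  obtain ⟨j, hj⟩ := exists_nat_one_div_lt hδ
  have hj' : (0 : ℝ) < 1 / (j + 1) := by positivity
  have hl := log_two_pos
  have key : ∀ n, n₀ ≤ n → ∃ᶠ k in atTop,
      mass C γ (T k).w (T k).N φ (near (T k).S x (rad (n + 1))) ≤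
          eexp (h + B j - n * (α - 1 / (j + 1)) * Real.log 2) ∧
        eexp (-(h + B j) - n * (α + 1 / (j + 1)) * Real.log 2) ≤
          mass C γ (T k).w (T k).N φ (near (T k).S x (3 / 2 * rad n)) := by
    intro n hn
    refine ((hg (rad (n + 1)) (rad_pos _)).and_eventually
      (hN.eventually_ge_atTop n)).mono ?_
    rintro k ⟨⟨y, hy, hxy⟩, hk⟩
    have h1 := hy.1 n hn hk j
    rw [rad_succ] at hxy
    refine ⟨(mass_mono (fun z hz => ?_) φ).trans h1.1, h1.2.trans (mass_mono (fun z hz => ?_) φ)⟩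
    · rw [mem_near, rad_succ] at hz
      exact mem_nbhd.2 ⟨hz.1, by linarith [dist_triangle z x y]⟩
    · rw [mem_nbhd] at hz
      rw [dist_comm] at hxy
      exact mem_near.2 ⟨hz.1, by linarith [dist_triangle z y x]⟩
  refine ⟨|h + B j| + 2 * (|α| + δ) * Real.log 2, n₀ + 2, fun n hn => ?_⟩
  obtain ⟨p, rfl⟩ : ∃ p, n = p + 2 := ⟨n - 2, by omega⟩
  have hp : n₀ ≤ p := by omega
  have a1 := le_abs_self (h + B j)
  have a2 := neg_abs_le α
  have a3 := le_abs_self α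
  constructor
  · refine (hm.ball_le x hx (rad (p + 2)) (rad (p + 1)) (rad_pos _) ?_ (rad_anti (by omega)) _
      ((key p hp).mono fun k hk => hk.1)).trans (eexp_le ?_)
    · rw [rad_succ (p + 1)]; linarith [rad_pos (p + 1)]
    · have e1 : (0 : ℝ) ≤ p * (δ - 1 / (j + 1)) * Real.log 2 := by
        have : 0 ≤ δ - 1 / ((j : ℝ) + 1) := by linarith
        positivity
      have e2 : 0 ≤ (|α| - α + 2 * δ) * Real.log 2 := by
        have : 0 ≤ |α| - α + 2 * δ := by linarith
        positivity
      push_cast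
      nlinarith
  · refine le_trans (eexp_le ?_) (hm.le_ball x hx (3 / 2 * rad (p + 4)) (rad (p + 2))
      (by have := rad_pos (p + 4); positivity) ?_ (rad_anti (by omega)) _
      ((key (p + 4) (by omega)).mono fun k hk => hk.2))
    · have e1 : (0 : ℝ) ≤ (p + 4) * (δ - 1 / (j + 1)) * Real.log 2 := by
        have : 0 ≤ δ - 1 / ((j : ℝ) + 1) := by linarith
        positivity
      have e2 : 0 ≤ (|α| - α) * Real.log 2 := by
        have : 0 ≤ |α| - α := by linarith
        positivity
      push_cast
      nlinarith
    · rw [rad_succ (p + 3), rad_succ (p + 2)]; linarith [rad_pos (p + 2)]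

/-- The mass distribution principle along the stages. -/
lemma le_dimH_of_goodEvent (hs : 0 < s)
    (hm : Approximates C γ T φ m x₀ (rad n₀)) (hN : Tendsto (fun k => (T k).N) atTop atTop)
    (hT : ∀ k, (T k).Valid C₁ c₁ c₂ n₀)
    (hI : ∀ k, ∀ y ∈ (T k).I, y ∈ Metric.closedBall x₀ (rad n₀))
    (hφ : φ ∈ goodEvent C γ β s α B n₀ T) :
    ENNReal.ofReal s ≤ dimH {x | x ∈ Metric.closedBall x₀ (rad n₀) ∧
      Tendsto (fun ε : ℝ => Real.log (m (Metric.ball x ε)).toReal / Real.log ε)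
        (𝓝[>] (0 : ℝ)) (𝓝 α)} := by
  obtain ⟨H, hH⟩ := hφ
  classical
  set gd : ℕ → Finset (EuclideanSpace ℝ (Fin d)) := fun k =>
    (T k).I.filter fun y => IsGood C γ β s α B n₀ H (T k) φ y with hgd
  set Q : ℕ → Prop := fun k => eexp (-(H : ℝ)) ≤ goodMass C γ β s α B n₀ H (T k) φ with hQ
  set V : ℕ → Set (EuclideanSpace ℝ (Fin d)) := fun i =>
    closure (⋃ k : ℕ, ⋃ _ : i ≤ k ∧ Q k, (gd k : Set (EuclideanSpace ℝ (Fin d)))) with hV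
  have hVsub : ∀ i, V i ⊆ Metric.closedBall x₀ (rad n₀) := fun i => by
    refine closure_minimal (fun z hz => ?_) Metric.isClosed_closedBall
    simp only [Set.mem_iUnion] at hz
    obtain ⟨k, -, hz⟩ := hz
    exact hI k z (Finset.mem_filter.1 hz).1
  have hVc : ∀ i, IsCompact (V i) := fun i =>
    (isCompact_closedBall x₀ (rad n₀)).of_isClosed_subset isClosed_closure (hVsub i)
  have hVanti : Antitone V := by
    intro i j hij
    refine closure_mono fun z hz => ?_
    simp only [Set.mem_iUnion] at hz ⊢
    obtain ⟨k, hk, hz⟩ := hz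
    exact ⟨k, ⟨hij.trans hk.1, hk.2⟩, hz⟩
  set G := ⋂ i, V i with hG
  have hGK : G ⊆ {x | x ∈ Metric.closedBall x₀ (rad n₀) ∧
      Tendsto (fun ε : ℝ => Real.log (m (Metric.ball x ε)).toReal / Real.log ε)
        (𝓝[>] (0 : ℝ)) (𝓝 α)} := by
    intro x hx
    have hx' : ∀ i, x ∈ V i := Set.mem_iInter.1 hx
    refine ⟨hVsub 0 (hx' 0), tendsto_of_frequently_good (β := β) (s := s) (B := B) (h := H)
      hm hN (hVsub 0 (hx' 0)) fun ε hε => ?_⟩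
    rw [frequently_atTop]
    intro i
    obtain ⟨y, hy, hxy⟩ := Metric.mem_closure_iff.1 (hx' i) ε hε
    simp only [Set.mem_iUnion] at hy
    obtain ⟨k, hk, hy⟩ := hy
    exact ⟨k, hk.1, y, (Finset.mem_filter.1 hy).2, hxy⟩
  refine le_trans ?_ (dimH_mono hGK)
  refine le_dimH_of_hausdorffMeasure_ne_zero (d := s.toNNReal) fun h0 => ?_
  rw [Real.coe_toNNReal _ hs.le, Measure.hausdorffMeasure_apply] at h0
  set η := min (eexp (-s * Real.log 2 - 1))
    (eexp (-(H : ℝ) - (H + B 0) - 2 * s * Real.log 2 - 2)) with hη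
  have hη0 : 0 < η := lt_min (eexp_pos _) (eexp_pos _)
  have h1 : ⨅ (t : ℕ → Set (EuclideanSpace ℝ (Fin d))) (_ : G ⊆ ⋃ n, t n)
      (_ : ∀ n, Metric.ediam (t n) ≤ 1),
        ∑' n, ⨆ _ : (t n).Nonempty, Metric.ediam (t n) ^ s = 0 := by
    refine le_antisymm (le_trans ?_ h0.le) zero_le
    exact le_iSup₂_of_le (1 : ℝ≥0∞) one_pos le_rfl
  have h2 := h1.trans_lt hη0
  simp only [iInf_lt_iff] at h2
  obtain ⟨t, hcov, -, hsum⟩ := h2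
  set a : ℕ → ℝ≥0∞ := fun i => ⨆ _ : (t i).Nonempty, Metric.ediam (t i) ^ s with ha
  have hda : ∀ i, Metric.ediam (t i) ^ s ≤ a i := by
    intro i
    rcases (t i).eq_empty_or_nonempty with he | hne
    · simp [he, hs]
    · exact le_iSup_of_le hne le_rfl
  obtain ⟨ε, hε0, hε⟩ := ENNReal.exists_pos_sum_of_countable' hη0.ne' ℕ
  have hsum2 : ∑' i, (a i + ε i) ≤ 2 * η := by
    rw [ENNReal.tsum_add, two_mul]
    exact add_le_add hsum.le hε.le
  have hai : ∀ i, a i < ⊤ := fun i =>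
    (ENNReal.le_tsum i).trans_lt (hsum.trans_le ((min_le_left _ _).trans le_top))
  have hlev : ∀ i, ∃ n : ℕ, Metric.ediam (t i) < ENNReal.ofReal (rad (n + 1)) ∧
      eexp (-n * s * Real.log 2) ≤ eexp (2 * s * Real.log 2) * (a i + ε i) := by
    intro i
    refine exists_level hs ((hda i).trans_lt (ENNReal.lt_add_right (hai i).ne (hε0 i).ne')) ?_
    refine (ENNReal.le_tsum i).trans (hsum2.trans ?_)
    exact (mul_le_mul_right (min_le_left _ _) _).trans (two_mul_eexp_sub_one_le _)
  choose n hn1 hn2 using hlev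
  have hpt : ∀ i, ∃ x, t i ∩ G ⊆ Metric.ball x (rad (n i + 1)) := by
    intro i
    rcases (t i ∩ G).eq_empty_or_nonempty with he | ⟨x, hx⟩
    · exact ⟨0, by simp [he]⟩
    · refine ⟨x, fun z hz => ?_⟩
      have h3 := (Metric.edist_le_ediam_of_mem hz.1 hx.1).trans_lt (hn1 i)
      rwa [edist_dist, ENNReal.ofReal_lt_ofReal_iff (rad_pos _)] at h3
  choose x hx using hpt
  have hGc : IsCompact G := by
    refine (hVc 0).of_isClosed_subset (isClosed_iInter fun i => isClosed_closure) ?_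
    exact Set.iInter_subset _ _
  obtain ⟨F, hF⟩ := hGc.elim_finite_subcover (fun i => Metric.ball (x i) (rad (n i + 1)))
    (fun i => Metric.isOpen_ball) (fun z hz => by
      obtain ⟨i, hi⟩ := Set.mem_iUnion.1 (hcov hz)
      exact Set.mem_iUnion.2 ⟨i, hx i ⟨hi, hz⟩⟩)
  obtain ⟨i₀, hi₀⟩ := exists_subset_nhds_of_isCompact' (V := V)
    (directed_of_isDirected_le fun i j hij => hVanti hij) hVc
    (fun i => isClosed_closure) (U := ⋃ i ∈ F, Metric.ball (x i) (rad (n i + 1)))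
    (fun z hz => (isOpen_biUnion fun i _ => Metric.isOpen_ball).mem_nhds (hF hz))
  obtain ⟨k, hQk, hk0, hkN⟩ := (hH.and_eventually ((eventually_ge_atTop i₀).and
    (hN.eventually_ge_atTop (F.sup n)))).exists
  have hgood : ∀ y ∈ gd k, ∃ i ∈ F, y ∈ Metric.ball (x i) (rad (n i + 1)) := by
    intro y hy
    have : y ∈ V i₀ := subset_closure (by
      simp only [Set.mem_iUnion]
      exact ⟨k, ⟨hk0, hQk⟩, hy⟩)
    simpa using hi₀ this
  have hball : ∀ i ∈ F, ∑ y ∈ (gd k).filter (fun y => y ∈ Metric.ball (x i) (rad (n i + 1))),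
      (T k).w * dens C β (T k).N φ y ≤ eexp (H + B 0) * eexp (-n i * s * Real.log 2) := by
    intro i hi
    rcases ((gd k).filter
      (fun y => y ∈ Metric.ball (x i) (rad (n i + 1)))).eq_empty_or_nonempty with he | ⟨y, hy⟩
    · rw [he]; simp
    · rw [Finset.mem_filter, Finset.mem_filter] at hy
      have h3 := hy.1.2.2 (n i) ((Finset.le_sup hi).trans hkN)
      rw [← eexp_add]
      refine le_trans ?_ (h3.trans (eexp_le (by linarith)))
      refine mass_mono (fun z hz => ?_) φ
      rw [Finset.mem_filter, Finset.mem_filter] at hz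
      refine mem_nbhd.2 ⟨(hT k).subset hz.1.1, ?_⟩
      have h4 := Metric.mem_ball.1 hz.2
      have h5 := Metric.mem_ball'.1 hy.2
      rw [rad_succ] at h4 h5
      linarith [dist_triangle z (x i) y]
  have hle : goodMass C γ β s α B n₀ H (T k) φ ≤
      ∑ i ∈ F, ∑ y ∈ (gd k).filter (fun y => y ∈ Metric.ball (x i) (rad (n i + 1))),
        (T k).w * dens C β (T k).N φ y := by
    have h3 : goodMass C γ β s α B n₀ H (T k) φ =
        ∑ y ∈ gd k, (T k).w * dens C β (T k).N φ y := by
      rw [goodMass, hgd, Finset.sum_filter]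
      refine Finset.sum_congr rfl fun y _ => ?_
      by_cases hy : IsGood C γ β s α B n₀ H (T k) φ y <;> simp [Set.indicator, hy]
    rw [h3]
    simp only [Finset.sum_filter]
    rw [Finset.sum_comm]
    refine Finset.sum_le_sum fun y hy => ?_
    obtain ⟨i, hi, hyi⟩ := hgood y hy
    exact le_trans (by rw [if_pos hyi]) (Finset.single_le_sum
      (f := fun i => if y ∈ Metric.ball (x i) (rad (n i + 1)) then (T k).w * dens C β (T k).N φ y
        else 0) (fun _ _ => zero_le) hi)
  have hfin : eexp (-(H : ℝ)) ≤ eexp (-(H : ℝ) - 1) := by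
    calc eexp (-(H : ℝ)) ≤ ∑ i ∈ F, eexp (H + B 0) * eexp (-n i * s * Real.log 2) :=
          hQk.trans (hle.trans (Finset.sum_le_sum hball))
      _ ≤ ∑ i ∈ F, eexp (H + B 0) * (eexp (2 * s * Real.log 2) * (a i + ε i)) :=
          Finset.sum_le_sum fun i _ => mul_le_mul_right (hn2 i) _
      _ = eexp (H + B 0) * (eexp (2 * s * Real.log 2) * ∑ i ∈ F, (a i + ε i)) := by
          rw [Finset.mul_sum, Finset.mul_sum]
      _ ≤ eexp (H + B 0) * (eexp (2 * s * Real.log 2) * (2 *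
            eexp (-(H : ℝ) - (H + B 0) - 2 * s * Real.log 2 - 2))) := by
          gcongr
          exact (ENNReal.sum_le_tsum F).trans (hsum2.trans
            (mul_le_mul_right (min_le_right _ _) _))
      _ ≤ eexp (H + B 0) * (eexp (2 * s * Real.log 2) *
            eexp (-(H : ℝ) - (H + B 0) - 2 * s * Real.log 2 - 1)) := by
          gcongr
          have h4 : -(H : ℝ) - (H + B 0) - 2 * s * Real.log 2 - 2 =
            -(H : ℝ) - (H + B 0) - 2 * s * Real.log 2 - 1 - 1 := by ring
          rw [h4]
          exact two_mul_eexp_sub_one_le _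
      _ = _ := by rw [← eexp_add, ← eexp_add]; congr 1; ring
  rw [eexp_le_iff] at hfin
  linarith

end Deterministic

section LogSingularity

/-- The positive part of `log (1 / ‖z‖)`. -/
def logSing (z : EuclideanSpace ℝ (Fin d)) : ℝ := max (Real.log ‖z‖⁻¹) 0

lemma logKernel_eq (g : EuclideanSpace ℝ (Fin d) → EuclideanSpace ℝ (Fin d) → ℝ) (x y) :
    logKernel g x y = logSing (x - y) + g x y := by rw [logKernel, logSing, dist_eq_norm]

lemma logSing_nonneg (z : EuclideanSpace ℝ (Fin d)) : 0 ≤ logSing z := le_max_right _ _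

@[fun_prop]
lemma measurable_logSing : Measurable (logSing (d := d)) := by unfold logSing; fun_prop

lemma logSing_le {z : EuclideanSpace ℝ (Fin d)} {a : ℝ} (ha : 0 ≤ a) (h : Real.exp (-a) ≤ ‖z‖) :
    logSing z ≤ a := by
  refine max_le ?_ ha
  rw [Real.log_inv, neg_le]
  exact (Real.le_log_iff_exp_le ((Real.exp_pos _).trans_le h)).2 h

lemma le_logSing {z : EuclideanSpace ℝ (Fin d)} {a : ℝ} (hz : z ≠ 0) (h : ‖z‖ ≤ Real.exp (-a)) :
    a ≤ logSing z := by
  refine le_max_of_le_left ?_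
  rw [Real.log_inv, le_neg]
  exact (Real.log_le_iff_le_exp (norm_pos_iff.2 hz)).2 h

lemma ofReal_logSing_le (n : ℕ) (z : EuclideanSpace ℝ (Fin d)) :
    ENNReal.ofReal (logSing z) ≤ ENNReal.ofReal (n * Real.log 2) +
      ∑' j : ℕ, (Metric.closedBall 0 (rad (n + j))).indicator
        (fun _ => ENNReal.ofReal (Real.log 2)) z := by
  by_cases hz : z = 0
  · simp [hz, logSing]
  by_cases hn : rad n ≤ ‖z‖
  · refine le_add_right (ENNReal.ofReal_le_ofReal ?_)
    exact logSing_le (mul_nonneg n.cast_nonneg log_two_pos.le) (by rwa [← rad_eq_exp])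
  push Not at hn
  obtain ⟨k, hk1, hk2⟩ := exists_nat_pow_near_of_lt_one (norm_pos_iff.2 hz)
    (hn.le.trans (rad_zero ▸ rad_anti n.zero_le)) (y := (1 / 2 : ℝ)) (by norm_num) (by norm_num)
  change rad (k + 1) < _ at hk1
  change _ ≤ rad k at hk2
  have hnk : n ≤ k := by
    by_contra h
    exact absurd (hk1.trans hn) (not_lt.2 (rad_anti (by omega)))
  have h1 : logSing z ≤ n * Real.log 2 + (k + 1 - n : ℕ) * Real.log 2 := by
    have : (k + 1 - n : ℕ) = ((k : ℝ) + 1 - n) := by rw [Nat.cast_sub (by omega)]; simp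
    rw [this]
    have h := logSing_le (z := z) (a := ((k + 1 : ℕ) : ℝ) * Real.log 2)
      (mul_nonneg (Nat.cast_nonneg _) log_two_pos.le) (by rw [← rad_eq_exp]; exact hk1.le)
    push_cast at h
    linarith
  refine (ENNReal.ofReal_le_ofReal h1).trans ?_
  rw [ENNReal.ofReal_add (mul_nonneg n.cast_nonneg log_two_pos.le)
    (mul_nonneg (Nat.cast_nonneg _) log_two_pos.le)]
  refine add_le_add_right ?_ _
  refine le_trans (le_of_eq ?_) (ENNReal.sum_le_tsum (Finset.range (k + 1 - n)))
  rw [Finset.sum_congr rfl (g := fun _ => ENNReal.ofReal (Real.log 2))]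
  · simp [ENNReal.ofReal_mul]
  · intro j hj
    rw [Finset.mem_range] at hj
    rw [Set.indicator_of_mem]
    simpa using hk2.trans (rad_anti (by omega))

lemma tsum_ofReal_rad : ∑' j : ℕ, ENNReal.ofReal (rad j) = 2 := by
  have : ∀ j : ℕ, ENNReal.ofReal (rad j) = (2⁻¹ : ℝ≥0∞) ^ j := fun j => by
    rw [rad, ENNReal.ofReal_pow (by norm_num)]
    simp [ENNReal.ofReal_inv_of_pos]
  simp_rw [this]
  rw [ENNReal.tsum_geometric, ENNReal.one_sub_inv_two, inv_inv]

lemma lintegral_logSing_le {σ : Measure (EuclideanSpace ℝ (Fin d))} {n : ℕ} {V : ℝ≥0∞}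
    (h : ∀ a, ∀ j : ℕ, σ (Metric.closedBall a (rad (n + j))) ≤ V * ENNReal.ofReal (rad j))
    (a : EuclideanSpace ℝ (Fin d)) :
    ∫⁻ v, ENNReal.ofReal (logSing (a - v)) ∂σ ≤
      ENNReal.ofReal (n * Real.log 2) * σ Set.univ + 2 * V * ENNReal.ofReal (Real.log 2) := by
  have hset : ∀ j : ℕ, ∀ v, (Metric.closedBall 0 (rad (n + j))).indicator
      (fun _ => ENNReal.ofReal (Real.log 2)) (a - v) =
      (Metric.closedBall a (rad (n + j))).indicator (fun _ => ENNReal.ofReal (Real.log 2)) v := by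
    intro j v
    simp only [Set.indicator, Metric.mem_closedBall, dist_eq_norm, norm_sub_rev v a, sub_zero]
  calc ∫⁻ v, ENNReal.ofReal (logSing (a - v)) ∂σ
      ≤ ∫⁻ v, (ENNReal.ofReal (n * Real.log 2) +
        ∑' j : ℕ, (Metric.closedBall a (rad (n + j))).indicator
          (fun _ => ENNReal.ofReal (Real.log 2)) v) ∂σ := by
        refine lintegral_mono fun v => ?_
        refine (ofReal_logSing_le n (a - v)).trans (le_of_eq ?_)
        simp_rw [hset]
    _ = ENNReal.ofReal (n * Real.log 2) * σ Set.univ +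
        ∑' j : ℕ, ENNReal.ofReal (Real.log 2) * σ (Metric.closedBall a (rad (n + j))) := by
        rw [lintegral_add_left measurable_const, lintegral_const, lintegral_tsum]
        · congr 2; ext j
          rw [lintegral_indicator measurableSet_closedBall, lintegral_const,
            Measure.restrict_apply_univ]
        · intro j
          exact (measurable_const.indicator measurableSet_closedBall).aemeasurable
    _ ≤ ENNReal.ofReal (n * Real.log 2) * σ Set.univ +
        ∑' j : ℕ, ENNReal.ofReal (Real.log 2) * V * ENNReal.ofReal (rad j) := by
        refine add_le_add_right (ENNReal.tsum_le_tsum fun j => ?_) _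
        rw [mul_assoc]
        exact mul_le_mul_right (h a j) _
    _ = _ := by rw [ENNReal.tsum_mul_left, tsum_ofReal_rad]; ring

end LogSingularity

section Mollifier

variable {θ : EuclideanSpace ℝ (Fin d) → ℝ}

/-- The probability measure with density `θ_ε`, where `ε = 2^{-n}`. -/
def moll (θ : EuclideanSpace ℝ (Fin d) → ℝ) (n : ℕ) : Measure (EuclideanSpace ℝ (Fin d)) :=
  volume.withDensity fun u => ENNReal.ofReal (mollifierScaled θ (rad n) u)

lemma IsMollifier.continuous_scaled (hθ : IsMollifier θ) (n : ℕ) :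
    Continuous (mollifierScaled θ (rad n)) := by
  have := hθ.1.continuous
  unfold mollifierScaled
  fun_prop

lemma IsMollifier.scaled_nonneg (hθ : IsMollifier θ) (n : ℕ) (x) :
    0 ≤ mollifierScaled θ (rad n) x :=
  mul_nonneg (inv_nonneg.2 (pow_nonneg (rad_pos n).le _)) (hθ.2.2.1 _)

lemma IsMollifier.hasCompactSupport_scaled (hθ : IsMollifier θ) (n : ℕ) :
    HasCompactSupport (mollifierScaled θ (rad n)) := by
  have h := hθ.2.1.comp_homeomorph (Homeomorph.smulOfNeZero (rad n)⁻¹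
    (inv_ne_zero (rad_pos n).ne') : EuclideanSpace ℝ (Fin d) ≃ₜ _)
  exact h.mul_left (f := fun _ => ((rad n) ^ d)⁻¹)

lemma IsMollifier.integral_scaled (hθ : IsMollifier θ) (n : ℕ) :
    ∫ x, mollifierScaled θ (rad n) x = 1 := by
  have hr := rad_pos n
  unfold mollifierScaled
  rw [integral_const_mul, Measure.integral_comp_smul_of_nonneg volume θ (rad n)⁻¹
    (hR := by positivity), hθ.2.2.2]
  have : (rad n) ^ d ≠ 0 := by positivity
  simp [this]

lemma IsMollifier.isProbabilityMeasure_moll (hθ : IsMollifier θ) (n : ℕ) :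
    IsProbabilityMeasure (moll θ n) := by
  constructor
  rw [moll, withDensity_apply _ MeasurableSet.univ, Measure.restrict_univ,
    ← ofReal_integral_eq_lintegral_ofReal, hθ.integral_scaled, ENNReal.ofReal_one]
  · exact (hθ.continuous_scaled n).integrable_of_hasCompactSupport (hθ.hasCompactSupport_scaled n)
  · exact ae_of_all _ (hθ.scaled_nonneg n)

lemma IsMollifier.exists_support (hθ : IsMollifier θ) :
    ∃ R : ℝ, 0 < R ∧ ∀ n, ∀ᵐ u ∂moll θ n, ‖u‖ ≤ R * rad n := by
  obtain ⟨R, hR0, hR⟩ := hθ.2.1.isCompact.isBounded.exists_pos_norm_le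
  refine ⟨R, hR0, fun n => ?_⟩
  rw [moll, ae_withDensity_iff (hθ.continuous_scaled n).measurable.ennreal_ofReal]
  refine ae_of_all _ fun u hu => ?_
  have hne : θ ((rad n)⁻¹ • u) ≠ 0 := by
    rintro h
    simp [mollifierScaled, h] at hu
  have := hR _ (subset_tsupport θ hne)
  rw [norm_smul, norm_inv, Real.norm_of_nonneg (rad_pos n).le, inv_mul_le_iff₀ (rad_pos n)] at this
  linarith

lemma rad_add (n j : ℕ) : rad (n + j) = rad n * rad j := by simp [rad, pow_add]

lemma IsMollifier.exists_moll_closedBall_le (hd : 1 ≤ d) (hθ : IsMollifier θ) :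
    ∃ V : ℝ≥0∞, V ≠ ⊤ ∧ ∀ n a, ∀ j : ℕ,
      moll θ n (Metric.closedBall a (rad (n + j))) ≤ V * ENNReal.ofReal (rad j) := by
  obtain ⟨B, hB⟩ := hθ.2.1.exists_bound_of_continuous hθ.1.continuous
  refine ⟨ENNReal.ofReal B * volume (Metric.ball (0 : EuclideanSpace ℝ (Fin d)) 1),
    ENNReal.mul_ne_top ENNReal.ofReal_ne_top measure_ball_lt_top.ne, fun n a j => ?_⟩
  have hr := rad_pos n
  have hj := rad_pos j
  have hj1 : rad j ^ d ≤ rad j := by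
    obtain ⟨e, rfl⟩ : ∃ e, d = e + 1 := ⟨d - 1, by omega⟩
    rw [pow_succ]
    exact mul_le_of_le_one_left hj.le (pow_le_one₀ hj.le (rad_zero ▸ rad_anti j.zero_le))
  rw [moll, withDensity_apply _ measurableSet_closedBall]
  calc ∫⁻ u in Metric.closedBall a (rad (n + j)), ENNReal.ofReal (mollifierScaled θ (rad n) u)
      ≤ ∫⁻ u in Metric.closedBall a (rad (n + j)), ENNReal.ofReal ((rad n ^ d)⁻¹ * B) := by
        refine lintegral_mono fun u => ENNReal.ofReal_le_ofReal ?_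
        unfold mollifierScaled
        gcongr
        exact (le_abs_self _).trans (hB _)
    _ = ENNReal.ofReal ((rad n ^ d)⁻¹ * B) * (ENNReal.ofReal (rad (n + j) ^ d) *
        volume (Metric.ball (0 : EuclideanSpace ℝ (Fin d)) 1)) := by
        rw [lintegral_const, Measure.restrict_apply_univ,
          Measure.addHaar_closedBall _ _ (rad_pos _).le, finrank_euclideanSpace_fin]
    _ ≤ _ := by
        have hB0 : 0 ≤ B := (norm_nonneg _).trans (hB 0)
        rw [← mul_assoc, ← ENNReal.ofReal_mul (by positivity), mul_right_comm (ENNReal.ofReal B),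
          ← ENNReal.ofReal_mul hB0]
        refine mul_le_mul_left (ENNReal.ofReal_le_ofReal ?_) _
        rw [rad_add, mul_pow]
        calc (rad n ^ d)⁻¹ * B * (rad n ^ d * rad j ^ d) = B * rad j ^ d := by
              field_simp
          _ ≤ _ := by gcongr

lemma moll_ac (θ : EuclideanSpace ℝ (Fin d) → ℝ) (n : ℕ) : moll θ n ≪ volume :=
  withDensity_absolutelyContinuous _ _

lemma IsMollifier.integral_moll (hθ : IsMollifier θ) (n : ℕ)
    (f : EuclideanSpace ℝ (Fin d) → ℝ) :
    ∫ u, f u ∂moll θ n = ∫ u, mollifierScaled θ (rad n) u * f u := by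
  rw [moll, integral_withDensity_eq_integral_toReal_smul
    (hθ.continuous_scaled n).measurable.ennreal_ofReal
    (ae_of_all _ fun _ => ENNReal.ofReal_lt_top)]
  simp [ENNReal.toReal_ofReal (hθ.scaled_nonneg n _)]

lemma IsMollifier.mollifiedCov_eq (hθ : IsMollifier θ)
    (K : EuclideanSpace ℝ (Fin d) → EuclideanSpace ℝ (Fin d) → ℝ) (m m' : ℕ) (x y) :
    mollifiedCov K θ θ (rad m) (rad m') x y =
      ∫ u, (∫ v, K (x - u) (y - v) ∂moll θ m') ∂moll θ m := by
  rw [hθ.integral_moll, mollifiedCov]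
  congr 1; ext u
  rw [hθ.integral_moll, ← integral_const_mul]
  simp [mul_assoc]

end Mollifier

section KernelBounds

variable {θ : EuclideanSpace ℝ (Fin d) → ℝ}
  {g : EuclideanSpace ℝ (Fin d) → EuclideanSpace ℝ (Fin d) → ℝ}

/-- The mollification of the singular part of the kernel. -/
def logMass (θ : EuclideanSpace ℝ (Fin d) → ℝ) (m m' : ℕ) (x y : EuclideanSpace ℝ (Fin d)) :
    ℝ≥0∞ :=
  ∫⁻ u, (∫⁻ v, ENNReal.ofReal (logSing (x - u - (y - v))) ∂moll θ m') ∂moll θ m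

lemma logSing_neg (z : EuclideanSpace ℝ (Fin d)) : logSing (-z) = logSing z := by simp [logSing]

lemma IsMollifier.exists_lintegral_logSing_le (hd : 1 ≤ d) (hθ : IsMollifier θ) :
    ∃ c : ℝ, 0 ≤ c ∧ ∀ m a, ∫⁻ v, ENNReal.ofReal (logSing (a - v)) ∂moll θ m ≤
      ENNReal.ofReal (m * Real.log 2 + c) := by
  obtain ⟨V, hV, h⟩ := hθ.exists_moll_closedBall_le hd
  have hne : 2 * V * ENNReal.ofReal (Real.log 2) ≠ ⊤ := by finiteness
  refine ⟨(2 * V * ENNReal.ofReal (Real.log 2)).toReal, ENNReal.toReal_nonneg, fun m a => ?_⟩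
  have := hθ.isProbabilityMeasure_moll m
  refine (lintegral_logSing_le (h m) a).trans (le_of_eq ?_)
  rw [measure_univ, mul_one, ENNReal.ofReal_add (mul_nonneg m.cast_nonneg log_two_pos.le)
    ENNReal.toReal_nonneg, ENNReal.ofReal_toReal hne]

lemma IsMollifier.exists_logMass_le (hd : 1 ≤ d) (hθ : IsMollifier θ) :
    ∃ c : ℝ, 0 ≤ c ∧ ∀ m m' x y, logMass θ m m' x y ≤ ENNReal.ofReal (m * Real.log 2 + c) ∧
      logMass θ m m' x y ≤ ENNReal.ofReal (m' * Real.log 2 + c) := by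
  obtain ⟨c, hc0, hc⟩ := hθ.exists_lintegral_logSing_le hd
  have hp := hθ.isProbabilityMeasure_moll
  refine ⟨c, hc0, fun m m' x y => ⟨?_, ?_⟩⟩
  · have hmeas : Measurable (Function.uncurry fun u v : EuclideanSpace ℝ (Fin d) =>
        ENNReal.ofReal (logSing (x - u - (y - v)))) := by
      unfold Function.uncurry; fun_prop
    rw [logMass, lintegral_lintegral_swap hmeas.aemeasurable]
    calc _ ≤ ∫⁻ _, ENNReal.ofReal (m * Real.log 2 + c) ∂moll θ m' := by
          refine lintegral_mono fun v => ?_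
          refine le_trans (le_of_eq ?_) (hc m (x - y + v))
          refine lintegral_congr fun u => ?_
          congr 2; abel
      _ = _ := by simp
  · calc _ ≤ ∫⁻ _, ENNReal.ofReal (m' * Real.log 2 + c) ∂moll θ m := by
          refine lintegral_mono fun u => ?_
          refine le_trans (le_of_eq ?_) (hc m' (y - x + u))
          refine lintegral_congr fun v => ?_
          rw [← logSing_neg]
          congr 2; abel
      _ = _ := by simp

lemma moll_ae_ne (hd : 1 ≤ d) (θ : EuclideanSpace ℝ (Fin d) → ℝ) (n : ℕ)
    (a : EuclideanSpace ℝ (Fin d)) : ∀ᵐ v ∂moll θ n, v ≠ a := by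
  have : NeZero d := ⟨by omega⟩
  have : Nontrivial (EuclideanSpace ℝ (Fin d)) := by
    have : Nonempty (Fin d) := ⟨⟨0, by omega⟩⟩
    infer_instance
  have h : ∀ᵐ v : EuclideanSpace ℝ (Fin d), v ≠ a := by
    rw [ae_iff]
    simp
  exact (moll_ac θ n).ae_le h

lemma IsMollifier.exists_le_logMass (hd : 1 ≤ d) (hθ : IsMollifier θ) :
    ∃ c : ℝ, ∀ (n m m' : ℕ) (x y), dist x y ≤ rad n → n ≤ m → n ≤ m' →
      ENNReal.ofReal (n * Real.log 2 - c) ≤ logMass θ m m' x y := by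
  obtain ⟨R, hR0, hR⟩ := hθ.exists_support
  have hp := hθ.isProbabilityMeasure_moll
  refine ⟨Real.log (1 + 2 * R), fun n m m' x y hxy hm hm' => ?_⟩
  calc ENNReal.ofReal (n * Real.log 2 - Real.log (1 + 2 * R))
      = ∫⁻ _, (∫⁻ _, ENNReal.ofReal (n * Real.log 2 - Real.log (1 + 2 * R)) ∂moll θ m')
        ∂moll θ m := by simp
    _ ≤ _ := by
      refine lintegral_mono_ae ?_
      filter_upwards [hR m] with u hu
      refine lintegral_mono_ae ?_
      filter_upwards [hR m', moll_ae_ne hd θ m' (y - x + u)] with v hv hne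
      refine ENNReal.ofReal_le_ofReal (le_logSing (fun h => hne ?_) ?_)
      · rw [eq_comm, ← sub_eq_zero, ← neg_eq_zero, ← h]; abel
      · rw [neg_sub, Real.exp_sub, Real.exp_log (by positivity), div_eq_mul_inv, ← Real.exp_neg,
          ← rad_eq_exp]
        have h1 := rad_anti hm
        have h2 := rad_anti hm'
        calc ‖x - u - (y - v)‖ = ‖(x - y) - u + v‖ := by congr 1; abel
          _ ≤ ‖x - y‖ + ‖u‖ + ‖v‖ := (norm_add_le _ _).trans (by gcongr; exact norm_sub_le _ _)
          _ ≤ rad n + R * rad n + R * rad n := by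
            rw [dist_eq_norm] at hxy
            gcongr
            · exact hu.trans (by gcongr)
            · exact hv.trans (by gcongr)
          _ = _ := by ring

lemma IsMollifier.exists_logMass_le_far (hd : 1 ≤ d) (hθ : IsMollifier θ) :
    ∃ c : ℝ, 0 ≤ c ∧ ∀ (n m m' : ℕ) (x y), (rad n ≤ dist x y ∨ m ≤ n ∨ m' ≤ n) →
      logMass θ m m' x y ≤ ENNReal.ofReal (n * Real.log 2 + c) := by
  obtain ⟨R, hR0, hR⟩ := hθ.exists_support
  obtain ⟨c, hc0, hc⟩ := hθ.exists_logMass_le hd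
  have hp := hθ.isProbabilityMeasure_moll
  obtain ⟨p, hpR⟩ : ∃ p : ℕ, R * rad p ≤ 1 / 4 := by
    obtain ⟨p, hp⟩ := exists_pow_lt_of_lt_one (show 0 < 1 / (4 * R) by positivity)
      (show (1 / 2 : ℝ) < 1 by norm_num)
    refine ⟨p, ?_⟩
    rw [lt_div_iff₀ (by positivity)] at hp
    unfold rad
    linarith
  have hl := log_two_pos
  refine ⟨c + (p + 1) * Real.log 2, by positivity, fun n m m' x y h => ?_⟩
  by_cases hm : m ≤ n + p
  · refine (hc m m' x y).1.trans (ENNReal.ofReal_le_ofReal ?_)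
    have : (m : ℝ) ≤ n + p := by exact_mod_cast hm
    nlinarith
  by_cases hm' : m' ≤ n + p
  · refine (hc m m' x y).2.trans (ENNReal.ofReal_le_ofReal ?_)
    have : (m' : ℝ) ≤ n + p := by exact_mod_cast hm'
    nlinarith
  have hxy : rad n ≤ dist x y := by
    rcases h with h | h | h
    · exact h
    · omega
    · omega
  have hsmall : ∀ k, n + p ≤ k → R * rad k ≤ rad n / 4 := fun k hk => by
    have h1 := rad_anti hk
    rw [rad_add] at h1
    nlinarith [rad_pos n]
  calc logMass θ m m' x y
      ≤ ∫⁻ _, (∫⁻ _, ENNReal.ofReal (((n + 1 : ℕ) : ℝ) * Real.log 2) ∂moll θ m')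
        ∂moll θ m := by
        refine lintegral_mono_ae ?_
        filter_upwards [hR m] with u hu
        refine lintegral_mono_ae ?_
        filter_upwards [hR m'] with v hv
        refine ENNReal.ofReal_le_ofReal (logSing_le (by positivity) ?_)
        rw [← rad_eq_exp, rad_succ]
        have h1 := hsmall m (by omega)
        have h2 := hsmall m' (by omega)
        have h3 : ‖x - y‖ ≤ ‖x - u - (y - v)‖ + ‖u‖ + ‖v‖ := by
          calc ‖x - y‖ = ‖(x - u - (y - v)) + u - v‖ := by congr 1; abel
            _ ≤ _ := (norm_sub_le _ _).trans (by gcongr; exact norm_add_le _ _)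
        rw [dist_eq_norm] at hxy
        linarith
    _ = ENNReal.ofReal (((n + 1 : ℕ) : ℝ) * Real.log 2) := by simp
    _ ≤ _ := by
      refine ENNReal.ofReal_le_ofReal ?_
      push_cast
      nlinarith [mul_nonneg (p.cast_nonneg : (0 : ℝ) ≤ p) hl.le]

lemma IsMollifier.mollifiedCov_logKernel (hd : 1 ≤ d) (hθ : IsMollifier θ)
    (hg : Measurable (Function.uncurry g)) {Cg : ℝ} (hC : ∀ x y, |g x y| ≤ Cg) (m m' : ℕ) (x y) :
    |mollifiedCov (logKernel g) θ θ (rad m) (rad m') x y - (logMass θ m m' x y).toReal| ≤ Cg := by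
  obtain ⟨c, hc0, hc⟩ := hθ.exists_lintegral_logSing_le hd
  have hp := hθ.isProbabilityMeasure_moll
  have hg' : Measurable fun p : EuclideanSpace ℝ (Fin d) × EuclideanSpace ℝ (Fin d) =>
      g p.1 p.2 := hg
  have hin : ∀ u, ∫⁻ v, ENNReal.ofReal (logSing (x - u - (y - v))) ∂moll θ m' ≤
      ENNReal.ofReal (m' * Real.log 2 + c) := fun u => by
    refine le_trans (le_of_eq ?_) (hc m' (y - x + u))
    refine lintegral_congr fun v => ?_
    rw [← logSing_neg]
    congr 2; abel
  have hint : ∀ u, Integrable (fun v => logSing (x - u - (y - v))) (moll θ m') := fun u => by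
    refine ⟨Measurable.aestronglyMeasurable (by fun_prop), ?_⟩
    rw [hasFiniteIntegral_iff_ofReal (ae_of_all _ fun v => logSing_nonneg _)]
    exact (hin u).trans_lt ENNReal.ofReal_lt_top
  have hintg : ∀ u, Integrable (fun v => g (x - u) (y - v)) (moll θ m') := fun u =>
    Integrable.of_bound (Measurable.aestronglyMeasurable (by fun_prop)) Cg
      (ae_of_all _ fun v => hC _ _)
  have hinner : ∀ u, ∫ v, logKernel g (x - u) (y - v) ∂moll θ m' =
      (∫⁻ v, ENNReal.ofReal (logSing (x - u - (y - v))) ∂moll θ m').toReal +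
        ∫ v, g (x - u) (y - v) ∂moll θ m' := fun u => by
    simp_rw [logKernel_eq]
    rw [integral_add (hint u) (hintg u), integral_eq_lintegral_of_nonneg_ae
      (ae_of_all _ fun v => logSing_nonneg _) (Measurable.aestronglyMeasurable (by fun_prop))]
  have hm1 : Measurable fun u => ∫⁻ v, ENNReal.ofReal (logSing (x - u - (y - v))) ∂moll θ m' := by
    refine Measurable.lintegral_prod_right' (f := fun p : EuclideanSpace ℝ (Fin d) × _ =>
      ENNReal.ofReal (logSing (x - p.1 - (y - p.2)))) (by fun_prop)
  have hbd : ∀ u, |∫ v, g (x - u) (y - v) ∂moll θ m'| ≤ Cg := fun u => by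
    have := norm_integral_le_of_norm_le_const (μ := moll θ m') (f := fun v => g (x - u) (y - v))
      (ae_of_all _ fun v => hC _ _)
    simpa using this
  have hm2 : StronglyMeasurable fun u => ∫ v, g (x - u) (y - v) ∂moll θ m' := by
    refine StronglyMeasurable.integral_prod_right' (f := fun p : EuclideanSpace ℝ (Fin d) × _ =>
      g (x - p.1) (y - p.2)) (Measurable.stronglyMeasurable (by fun_prop))
  rw [hθ.mollifiedCov_eq]
  simp_rw [hinner]
  rw [integral_add, integral_toReal hm1.aemeasurable
    (ae_of_all _ fun u => (hin u).trans_lt ENNReal.ofReal_lt_top), logMass, add_sub_cancel_left]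
  · have := norm_integral_le_of_norm_le_const (μ := moll θ m)
      (f := fun u => ∫ v, g (x - u) (y - v) ∂moll θ m') (ae_of_all _ hbd)
    simpa using this
  · refine Integrable.of_bound hm1.ennreal_toReal.aestronglyMeasurable (m' * Real.log 2 + c)
      (ae_of_all _ fun u => ?_)
    rw [Real.norm_of_nonneg ENNReal.toReal_nonneg]
    have hl := log_two_pos
    exact ENNReal.toReal_le_of_le_ofReal (by positivity) (hin u)
  · exact Integrable.of_bound hm2.aestronglyMeasurable Cg (ae_of_all _ hbd)

/-- The covariance of the field at dyadic scales. -/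
def covKer (g : EuclideanSpace ℝ (Fin d) → EuclideanSpace ℝ (Fin d) → ℝ)
    (θ : EuclideanSpace ℝ (Fin d) → ℝ) (i j : Site d) : ℝ :=
  (mollifiedCov (logKernel g) θ θ (rad i.1) (rad j.1) i.2 j.2 +
    mollifiedCov (logKernel g) θ θ (rad j.1) (rad i.1) j.2 i.2) / 2

lemma covKer_self (i : Site d) :
    covKer g θ i i = mollifiedCov (logKernel g) θ θ (rad i.1) (rad i.1) i.2 i.2 := by
  rw [covKer]; ring

lemma IsMollifier.exists_kernelBound (hd : 1 ≤ d) (hθ : IsMollifier θ)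
    (hg : IsBoundedMeasurable g) : ∃ C₀, KernelBound (covKer g θ) C₀ := by
  obtain ⟨hgm, Cg, hC⟩ := hg
  obtain ⟨c₁, h₁⟩ := hθ.exists_le_logMass hd
  obtain ⟨c₂, hc₂, h₂⟩ := hθ.exists_logMass_le_far hd
  have hl := log_two_pos
  have key := fun m m' x y => abs_le.1 (hθ.mollifiedCov_logKernel hd hgm hC m m' x y)
  have hCg : 0 ≤ Cg := (abs_nonneg _).trans (hC 0 0)
  have hlow : ∀ m m' x y, -Cg ≤ mollifiedCov (logKernel g) θ θ (rad m) (rad m') x y :=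
    fun m m' x y => by
      have h := (key m m' x y).1
      have := ENNReal.toReal_nonneg (a := logMass θ m m' x y)
      linarith
  have hnear : ∀ (n m m' : ℕ) (x y), dist x y ≤ rad n → n ≤ m → n ≤ m' →
      n * Real.log 2 - c₁ - Cg ≤ mollifiedCov (logKernel g) θ θ (rad m) (rad m') x y :=
    fun n m m' x y hxy hm hm' => by
      have h := (key m m' x y).1
      have h2 := h₁ n m m' x y hxy hm hm'
      have hfin : logMass θ m m' x y ≠ ⊤ :=
        ne_top_of_le_ne_top ENNReal.ofReal_ne_top (h₂ m m m' x y (Or.inr (Or.inl le_rfl)))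
      have := (ENNReal.ofReal_le_iff_le_toReal hfin).1 h2
      linarith
  have hfar : ∀ (n m m' : ℕ) (x y), (rad n ≤ dist x y ∨ m ≤ n ∨ m' ≤ n) →
      mollifiedCov (logKernel g) θ θ (rad m) (rad m') x y ≤ n * Real.log 2 + c₂ + Cg :=
    fun n m m' x y h => by
      have h1 := (key m m' x y).2
      have := ENNReal.toReal_le_of_le_ofReal (by positivity) (h₂ n m m' x y h)
      linarith
  refine ⟨max Cg (max (c₁ + Cg) (c₂ + Cg)), ⟨fun i j => ?_, fun n m m' x y h hm hm' => ?_,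
    fun n m m' x y h => ?_⟩⟩
  · have h1 := hlow i.1 j.1 i.2 j.2
    have h2 := hlow j.1 i.1 j.2 i.2
    have := le_max_left Cg (max (c₁ + Cg) (c₂ + Cg))
    simp only [covKer]
    linarith
  · have h1 := hnear n m m' x y h hm hm'
    have h2 := hnear n m' m y x (by rwa [dist_comm]) hm' hm
    have := (le_max_left (c₁ + Cg) (c₂ + Cg)).trans (le_max_right Cg _)
    simp only [covKer]
    linarith
  · have h1 := hfar n m m' x y h
    have h2 := hfar n m' m y x (by rw [dist_comm]; tauto)
    have := (le_max_right (c₁ + Cg) (c₂ + Cg)).trans (le_max_right Cg _)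
    simp only [covKer]
    linarith

end KernelBounds

section FieldLaw

variable {θ : EuclideanSpace ℝ (Fin d) → ℝ}
  {g : EuclideanSpace ℝ (Fin d) → EuclideanSpace ℝ (Fin d) → ℝ}

lemma exists_setLIntegral_logSing_le (hd : 1 ≤ d) {r : ℝ} (b : EuclideanSpace ℝ (Fin d)) :
    ∃ c : ℝ≥0∞, c ≠ ⊤ ∧ ∀ x, ∫⁻ v in Metric.ball b r, ENNReal.ofReal (logSing (x - v)) ≤ c := by
  refine ⟨ENNReal.ofReal ((0 : ℕ) * Real.log 2) * volume.restrict (Metric.ball b r) Set.univ +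
    2 * volume (Metric.ball (0 : EuclideanSpace ℝ (Fin d)) 1) * ENNReal.ofReal (Real.log 2), ?_,
    lintegral_logSing_le fun a j => ?_⟩
  · have := measure_ball_lt_top (μ := volume) (x := b) (r := r)
    have := measure_ball_lt_top (μ := volume) (x := (0 : EuclideanSpace ℝ (Fin d))) (r := 1)
    simp only [Measure.restrict_apply_univ]
    finiteness
  · refine (Measure.restrict_apply_le _ _).trans ?_
    have hj := rad_pos j
    rw [Measure.addHaar_closedBall _ _ (rad_pos _).le, finrank_euclideanSpace_fin, mul_comm,
      zero_add]
    refine mul_le_mul_right (ENNReal.ofReal_le_ofReal ?_) _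
    obtain ⟨e, rfl⟩ : ∃ e, d = e + 1 := ⟨d - 1, by omega⟩
    rw [pow_succ]
    exact mul_le_of_le_one_left hj.le (pow_le_one₀ hj.le (rad_zero ▸ rad_anti j.zero_le))

lemma IsBoundedMeasurable.locallyIntegrable_logKernel (hd : 1 ≤ d) (hg : IsBoundedMeasurable g) :
    LocallyIntegrable fun p : EuclideanSpace ℝ (Fin d) × EuclideanSpace ℝ (Fin d) =>
      logKernel g p.1 p.2 := by
  obtain ⟨hgm, Cg, hC⟩ := hg
  have hg' : Measurable fun p : EuclideanSpace ℝ (Fin d) × EuclideanSpace ℝ (Fin d) =>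
      g p.1 p.2 := hgm
  intro p
  refine ⟨Metric.ball p.1 1 ×ˢ Metric.ball p.2 1,
    prod_mem_nhds (Metric.ball_mem_nhds _ one_pos) (Metric.ball_mem_nhds _ one_pos), ?_⟩
  simp_rw [logKernel_eq]
  refine Integrable.add (f := fun p : EuclideanSpace ℝ (Fin d) × EuclideanSpace ℝ (Fin d) =>
    logSing (p.1 - p.2)) ?_ ?_
  · refine ⟨Measurable.aestronglyMeasurable (by fun_prop), ?_⟩
    rw [hasFiniteIntegral_iff_ofReal (ae_of_all _ fun v => logSing_nonneg _),
      Measure.volume_eq_prod, ← Measure.prod_restrict, lintegral_prod _ (by fun_prop)]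
    obtain ⟨c, hc, h⟩ := exists_setLIntegral_logSing_le hd (r := 1) p.2
    refine (lintegral_mono fun x => h x).trans_lt ?_
    rw [lintegral_const, Measure.restrict_apply_univ]
    exact ENNReal.mul_lt_top hc.lt_top measure_ball_lt_top
  · refine Measure.integrableOn_of_bounded (M := Cg) ?_ hg'.aestronglyMeasurable
      (ae_of_all _ fun v => hC _ _)
    rw [Measure.volume_eq_prod, Measure.prod_prod]
    exact (ENNReal.mul_lt_top measure_ball_lt_top measure_ball_lt_top).ne

lemma IsMollifier.continuous_mollifiedCov (hd : 1 ≤ d) (hθ : IsMollifier θ)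
    (hg : IsBoundedMeasurable g) (m m' : ℕ) :
    Continuous fun p : EuclideanSpace ℝ (Fin d) × EuclideanSpace ℝ (Fin d) =>
      mollifiedCov (logKernel g) θ θ (rad m) (rad m') p.1 p.2 := by
  have hloc := hg.locallyIntegrable_logKernel hd
  rw [Measure.volume_eq_prod] at hloc
  have : ((volume : Measure (EuclideanSpace ℝ (Fin d))).prod
      (volume : Measure (EuclideanSpace ℝ (Fin d)))).IsNegInvariant :=
    Measure.IsAddHaarMeasure.isNegInvariant_of_regular _
  set f : EuclideanSpace ℝ (Fin d) × EuclideanSpace ℝ (Fin d) → ℝ := fun p =>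
    mollifierScaled θ (rad m) p.1 * mollifierScaled θ (rad m') p.2 with hf
  have hfc : Continuous f :=
    ((hθ.continuous_scaled m).comp continuous_fst).mul
      ((hθ.continuous_scaled m').comp continuous_snd)
  have hfs : HasCompactSupport f := by
    refine HasCompactSupport.intro ((hθ.hasCompactSupport_scaled m).isCompact.prod
      (hθ.hasCompactSupport_scaled m').isCompact) fun p hp => ?_
    rw [Set.mem_prod, not_and_or] at hp
    rcases hp with h | h
    · simp [hf, image_eq_zero_of_notMem_tsupport h]
    · simp [hf, image_eq_zero_of_notMem_tsupport h]
  have h1 := hfs.continuous_convolution_left (ContinuousLinearMap.mul ℝ ℝ) hfc hloc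
  have h2 := hfs.convolutionExists_left (ContinuousLinearMap.mul ℝ ℝ) hfc hloc
  refine h1.congr fun p => ?_
  have h3 := h2 p
  rw [ConvolutionExistsAt] at h3
  rw [convolution_def, integral_prod _ h3]
  rfl

lemma IsMollifier.continuous_covKer (hd : 1 ≤ d) (hθ : IsMollifier θ)
    (hg : IsBoundedMeasurable g) (m m' : ℕ) :
    Continuous fun p : EuclideanSpace ℝ (Fin d) × EuclideanSpace ℝ (Fin d) =>
      covKer g θ (m, p.1) (m', p.2) := by
  have h1 := hθ.continuous_mollifiedCov hd hg m m'
  have h2 := (hθ.continuous_mollifiedCov hd hg m' m).comp continuous_swap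
  exact (h1.add h2).div_const 2

variable {Ω : Type*} [MeasurableSpace Ω] {P : Measure Ω} {X : ℝ → EuclideanSpace ℝ (Fin d) → Ω → ℝ}

/-- The restriction of the field to dyadic scales. -/
def dyadicField (X : ℝ → EuclideanSpace ℝ (Fin d) → Ω → ℝ) (ω : Ω) (i : Site d) : ℝ :=
  X (rad i.1) i.2 ω

lemma IsGaussianFamily.measurable_dyadicField
    {Km : ℝ → ℝ → EuclideanSpace ℝ (Fin d) → EuclideanSpace ℝ (Fin d) → ℝ}
    (hX : IsGaussianFamily P X Km) : Measurable (dyadicField X) :=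
  measurable_pi_lambda _ fun _ =>
    hX.1.comp (measurable_const.prodMk (measurable_const.prodMk measurable_id))

lemma IsGaussianFamily.gaussField (hX : IsGaussianFamily P X (mollifiedCov (logKernel g) θ θ)) :
    GaussField (P.map (dyadicField X)) (covKer g θ) := by
  refine ⟨fun i j => by simp only [covKer]; ring, fun l => ?_⟩
  rw [lintegral_map (measurable_eexp_linForm l) hX.measurable_dyadicField]
  let e := l.support.equivFin.symm
  have hsum : ∀ f : Site d → ℝ, ∑ i ∈ l.support, f i = ∑ k, f (e k) := fun f => by
    rw [← Finset.sum_coe_sort, ← e.sum_comp]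
  obtain ⟨v, hv, hmap⟩ := hX.2 _ (fun k => rad (e k).1.1) (fun k => (e k).1.2)
    (fun k => ⟨rad_pos _, rad_zero ▸ rad_anti (Nat.zero_le _)⟩) fun k => l (e k)
  have hmeas : Measurable fun ω => ∑ k, l (e k) * X (rad (e k).1.1) (e k).1.2 ω := by
    refine Finset.measurable_sum _ fun k _ => Measurable.const_mul ?_ _
    exact hX.1.comp (measurable_const.prodMk (measurable_const.prodMk measurable_id))
  calc ∫⁻ ω, eexp (linForm l (dyadicField X ω)) ∂P
      = ∫⁻ ω, eexp (∑ k, l (e k) * X (rad (e k).1.1) (e k).1.2 ω) ∂P := by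
        refine lintegral_congr fun ω => ?_
        rw [linForm_eq_sum, hsum]
        rfl
    _ = eexp (v / 2) := by
        rw [← lintegral_map measurable_eexp hmeas, hmap, lintegral_eexp_gaussianReal]
    _ = _ := by
        congr 2
        rw [hv, covForm, linForm_eq_sum, hsum]
        simp_rw [linForm_eq_sum, hsum, Finset.mul_sum, covKer]
        have hswap := Finset.sum_comm (s := Finset.univ) (t := Finset.univ)
          (f := fun i j => l (e i) * l (e j) * mollifiedCov (logKernel g) θ θ
          (rad (e i).1.1) (rad (e j).1.1) (e i).1.2 (e j).1.2)
        have hhalf : ∀ a b : ℝ, a = b → a = (a + b) / 2 := fun a b h => by rw [h]; ring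
        rw [hhalf _ _ hswap, ← Finset.sum_add_distrib, Finset.sum_div]
        refine Finset.sum_congr rfl fun i _ => ?_
        rw [← Finset.sum_add_distrib, Finset.sum_div]
        exact Finset.sum_congr rfl fun j _ => by ring

end FieldLaw

section DyadicGrid

/-- The index of the dyadic cube of side `2^{-m}` containing `x`. -/
def dyadicCell (m : ℕ) (x : EuclideanSpace ℝ (Fin d)) : Fin d → ℤ := fun i => ⌊2 ^ m * x i⌋

/-- The corner of the dyadic cube of side `2^{-m}` containing `x`. -/
def dyadicFloor (m : ℕ) (x : EuclideanSpace ℝ (Fin d)) : EuclideanSpace ℝ (Fin d) :=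
  WithLp.toLp 2 fun i => (dyadicCell m x i : ℝ) / 2 ^ m

lemma dyadicFloor_apply (m : ℕ) (x : EuclideanSpace ℝ (Fin d)) (i : Fin d) :
    dyadicFloor m x i = (dyadicCell m x i : ℝ) / 2 ^ m := rfl

lemma rad_eq_inv (m : ℕ) : rad m = (2 ^ m)⁻¹ := by simp [rad]

@[fun_prop]
lemma measurable_dyadicCell (m : ℕ) : Measurable (dyadicCell (d := d) m) := by
  refine measurable_pi_lambda _ fun i => Int.measurable_floor.comp ?_
  fun_prop

@[fun_prop]
lemma measurable_dyadicFloor (m : ℕ) : Measurable (dyadicFloor (d := d) m) := by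
  have : Measurable fun x : EuclideanSpace ℝ (Fin d) =>
      fun i => (dyadicCell m x i : ℝ) / 2 ^ m := by
    refine measurable_pi_lambda _ fun i => Measurable.div_const ?_ _
    exact (measurable_from_top (f := fun z : ℤ => (z : ℝ))).comp
      ((measurable_pi_apply i).comp (measurable_dyadicCell m))
  exact (MeasurableEquiv.toLp 2 (Fin d → ℝ)).measurable.comp this

lemma dyadicCell_dyadicFloor {p m : ℕ} (h : p ≤ m) (x : EuclideanSpace ℝ (Fin d)) :
    dyadicCell p (dyadicFloor m x) = dyadicCell p x := by
  obtain ⟨j, rfl⟩ := Nat.exists_eq_add_of_le h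
  have key : ∀ a : ℝ, ⌊2 ^ p * a⌋ = ⌊2 ^ (p + j) * a⌋ / ((2 ^ j : ℕ) : ℤ) := fun a => by
    rw [← Int.floor_div_natCast]
    congr 1
    rw [pow_add]
    push_cast
    field_simp
  ext i
  rw [dyadicCell, key, dyadicFloor_apply, mul_div_cancel₀ _ (by positivity), Int.floor_intCast,
    dyadicCell, dyadicCell, ← key]

lemma dyadicFloor_dyadicFloor (m : ℕ) (x : EuclideanSpace ℝ (Fin d)) :
    dyadicFloor m (dyadicFloor m x) = dyadicFloor m x := by
  rw [dyadicFloor, dyadicCell_dyadicFloor le_rfl, ← dyadicFloor]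

lemma dist_dyadicFloor_le (m : ℕ) (x : EuclideanSpace ℝ (Fin d)) :
    dist (dyadicFloor m x) x ≤ d * rad m := by
  have h0 : ∀ i, dist (dyadicFloor m x i) (x i) ^ 2 ≤ rad m ^ 2 := fun i => by
    have h1 := Int.floor_le (2 ^ m * x i)
    have h2 := Int.lt_floor_add_one (2 ^ m * x i)
    have hp : (0 : ℝ) < 2 ^ m := by positivity
    refine pow_le_pow_left₀ dist_nonneg ?_ 2
    rw [dyadicFloor_apply, dyadicCell, Real.dist_eq, rad_eq_inv, abs_le]
    constructor
    · rw [neg_le_sub_iff_le_add, ← one_div, ← add_div, le_div_iff₀ hp]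
      linarith
    · rw [sub_le_iff_le_add, div_le_iff₀ hp, add_mul, inv_mul_cancel₀ hp.ne']
      linarith
  rw [EuclideanSpace.dist_eq]
  refine Real.sqrt_le_iff.2 ⟨mul_nonneg d.cast_nonneg (rad_pos m).le, ?_⟩
  refine (Finset.sum_le_sum fun i _ => h0 i).trans ?_
  rw [Finset.sum_const, Finset.card_univ, Fintype.card_fin, nsmul_eq_mul, mul_pow]
  gcongr
  exact_mod_cast Nat.le_self_pow two_ne_zero d

lemma dist_le_of_dyadicCell_eq {m : ℕ} {x y : EuclideanSpace ℝ (Fin d)}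
    (h : dyadicCell m x = dyadicCell m y) : dist x y ≤ 2 * (d * rad m) := by
  have h1 := dist_dyadicFloor_le m x
  have h2 := dist_dyadicFloor_le m y
  rw [dyadicFloor, h, ← dyadicFloor] at h1
  linarith [dist_triangle_left x y (dyadicFloor m y)]

lemma finite_image_dyadicCell (m : ℕ) {B : Set (EuclideanSpace ℝ (Fin d))}
    (hB : Bornology.IsBounded B) : (dyadicCell m '' B).Finite := by
  obtain ⟨R, hR⟩ := hB.exists_norm_le
  refine (Set.finite_Icc (fun _ : Fin d => -⌈2 ^ m * R⌉) fun _ => ⌈2 ^ m * R⌉).subset ?_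
  rintro _ ⟨x, hx, rfl⟩
  have h : ∀ i, |x i| ≤ R := fun i => (PiLp.norm_apply_le x i).trans (hR x hx)
  have hp : (0 : ℝ) < 2 ^ m := by positivity
  refine ⟨fun i => ?_, fun i => ?_⟩
  · refine Int.le_floor.2 ?_
    have := Int.le_ceil (2 ^ m * R)
    push_cast
    nlinarith [neg_le_of_abs_le (h i)]
  · refine (Int.floor_le_ceil _).trans (Int.ceil_le_ceil ?_)
    have := le_of_abs_le (h i)
    gcongr

lemma finite_dyadicFloor_fixed (m : ℕ) {B : Set (EuclideanSpace ℝ (Fin d))}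
    (hB : Bornology.IsBounded B) : {y | y ∈ B ∧ dyadicFloor m y = y}.Finite := by
  refine Set.Finite.of_finite_image ((finite_image_dyadicCell m hB).subset
    (Set.image_mono fun y hy => hy.1)) fun x hx y hy h => ?_
  rw [← hx.2, ← hy.2, dyadicFloor, h, ← dyadicFloor]

open Classical in
/-- The points of `B` with coordinates in `2^{-m} ℤ`. -/
def dyadicGrid (m : ℕ) (B : Set (EuclideanSpace ℝ (Fin d))) : Finset (EuclideanSpace ℝ (Fin d)) :=
  if h : {y | y ∈ B ∧ dyadicFloor m y = y}.Finite then h.toFinset else ∅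

lemma mem_dyadicGrid {m : ℕ} {B : Set (EuclideanSpace ℝ (Fin d))} (hB : Bornology.IsBounded B)
    {y : EuclideanSpace ℝ (Fin d)} : y ∈ dyadicGrid m B ↔ y ∈ B ∧ dyadicFloor m y = y := by
  simp [dyadicGrid, finite_dyadicFloor_fixed m hB]

lemma volume_dyadicFloor_preimage {m : ℕ} {y : EuclideanSpace ℝ (Fin d)}
    (hy : dyadicFloor m y = y) :
    volume (dyadicFloor m ⁻¹' {y}) = ENNReal.ofReal (rad m ^ d) := by
  have hp : (0 : ℝ) < 2 ^ m := by positivity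
  have hset : dyadicFloor m ⁻¹' {y} = (MeasurableEquiv.toLp 2 (Fin d → ℝ)).symm ⁻¹'
      Set.univ.pi fun i => Set.Ico (y i) (y i + rad m) := by
    ext z
    have hyi : ∀ i, y i = (dyadicCell m y i : ℝ) / 2 ^ m := fun i => by
      conv_lhs => rw [← hy]
      rfl
    have : z ∈ dyadicFloor m ⁻¹' {y} ↔ ∀ i, dyadicCell m z i = dyadicCell m y i := by
      rw [Set.mem_preimage, Set.mem_singleton_iff]
      constructor
      · intro h i
        rw [← h, dyadicCell_dyadicFloor le_rfl]
      · intro h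
        rw [← hy, dyadicFloor, funext h, ← dyadicFloor]
    rw [this, Set.mem_preimage, Set.mem_univ_pi]
    refine forall_congr' fun i => ?_
    change _ ↔ z i ∈ _
    rw [Set.mem_Ico, hyi i, rad_eq_inv, ← one_div, ← add_div, div_le_iff₀ hp, lt_div_iff₀ hp,
      dyadicCell, Int.floor_eq_iff, mul_comm]
  rw [hset,
    (EuclideanSpace.volume_preserving_symm_measurableEquiv_toLp (Fin d)).measure_preimage_equiv,
    Real.volume_pi_Ico]
  simp [ENNReal.ofReal_pow (rad_pos m).le]

lemma setLIntegral_dyadicFloor {m : ℕ} {G : Finset (EuclideanSpace ℝ (Fin d))}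
    (hG : ∀ y ∈ G, dyadicFloor m y = y) (f : EuclideanSpace ℝ (Fin d) → ℝ≥0∞) :
    ∫⁻ z in dyadicFloor m ⁻¹' G, f (dyadicFloor m z) =
      ∑ y ∈ G, ENNReal.ofReal (rad m ^ d) * f y := by
  have hU : dyadicFloor m ⁻¹' (G : Set (EuclideanSpace ℝ (Fin d))) =
      ⋃ y ∈ G, dyadicFloor m ⁻¹' {y} := by
    ext z; simp
  have hms : ∀ y, MeasurableSet (dyadicFloor m ⁻¹' {y} : Set (EuclideanSpace ℝ (Fin d))) :=
    fun y => measurable_dyadicFloor m (measurableSet_singleton y)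
  rw [hU, lintegral_biUnion_finset]
  · refine Finset.sum_congr rfl fun y hy => ?_
    rw [setLIntegral_congr_fun (g := fun _ => f y) (hms y) fun z hz => by
      simp only [Set.mem_preimage, Set.mem_singleton_iff] at hz; simp only [hz]]
    rw [setLIntegral_const, volume_dyadicFloor_preimage (hG y hy), mul_comm]
  · intro a _ b _ hab
    exact Disjoint.preimage _ (Set.disjoint_singleton.2 hab)
  · exact fun y _ => hms y

lemma volume_dyadicFloor_preimage_finset {m : ℕ} {G : Finset (EuclideanSpace ℝ (Fin d))}
    (hG : ∀ y ∈ G, dyadicFloor m y = y) :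
    volume (dyadicFloor m ⁻¹' (G : Set (EuclideanSpace ℝ (Fin d)))) =
      ENNReal.ofReal (rad m ^ d) * G.card := by
  have := setLIntegral_dyadicFloor hG 1
  simpa [mul_comm] using this

/-- A finite union of dyadic cubes of side `2^{-p}`. -/
def dyadicUnion (p : ℕ) (F : Finset (Fin d → ℤ)) : Set (EuclideanSpace ℝ (Fin d)) :=
  dyadicCell p ⁻¹' F

lemma measurableSet_dyadicUnion (p : ℕ) (F : Finset (Fin d → ℤ)) :
    MeasurableSet (dyadicUnion (d := d) p F) :=
  measurable_dyadicCell p F.measurableSet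

lemma dyadicUnion_eq_preimage {p m : ℕ} (h : p ≤ m) {F : Finset (Fin d → ℤ)}
    (hF : Bornology.IsBounded (dyadicUnion (d := d) p F)) :
    dyadicUnion p F = dyadicFloor m ⁻¹' (dyadicGrid m (dyadicUnion p F)) := by
  ext z
  rw [Set.mem_preimage, Finset.mem_coe, mem_dyadicGrid hF]
  simp only [dyadicUnion, Set.mem_preimage, dyadicCell_dyadicFloor h, dyadicFloor_dyadicFloor,
    and_true]

lemma eventually_mul_rad_le (c : ℝ) {ε : ℝ} (hε : 0 < ε) : ∀ᶠ m in atTop, c * rad m ≤ ε := by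
  have h : Tendsto (fun m => c * rad m) atTop (𝓝 (c * 0)) :=
    (tendsto_pow_atTop_nhds_zero_of_lt_one (by norm_num) (by norm_num)).const_mul c
  rw [mul_zero] at h
  exact (h.eventually_lt_const hε).mono fun _ h => h.le

/-- A union of dyadic cubes fits between two concentric balls. -/
lemma exists_dyadicUnion (x : EuclideanSpace ℝ (Fin d)) {r r' : ℝ} (h : r < r') :
    ∃ p F, Metric.closedBall x r ⊆ dyadicUnion p F ∧ dyadicUnion p F ⊆ Metric.ball x r' := by
  obtain ⟨p, hp⟩ := (eventually_mul_rad_le (2 * d) (half_pos (sub_pos.2 h))).exists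
  have hfin := finite_image_dyadicCell p (Metric.isBounded_closedBall (x := x) (r := r))
  refine ⟨p, hfin.toFinset, fun y hy => ?_, fun y hy => ?_⟩
  · simpa [dyadicUnion] using ⟨y, hy, rfl⟩
  · simp only [dyadicUnion, Set.Finite.coe_toFinset, Set.mem_preimage, Set.mem_image] at hy
    obtain ⟨z, hz, hzy⟩ := hy
    have h1 := dist_le_of_dyadicCell_eq hzy
    rw [Metric.mem_closedBall] at hz
    rw [Metric.mem_ball]
    linarith [dist_triangle_left y x z]

end DyadicGrid

section GridStage

/-- The dyadic discretisation of a ball. -/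
def gridStage (x₀ : EuclideanSpace ℝ (Fin d)) (n₀ m N : ℕ) : Stage d where
  S := dyadicGrid m (Metric.closedBall x₀ (2 * rad n₀))
  I := dyadicGrid m (Metric.closedBall x₀ (rad n₀))
  w := ENNReal.ofReal (rad m ^ d)
  N := N

lemma ofReal_rad_pow (n : ℕ) : ENNReal.ofReal (rad n ^ d) = eexp (-(n * d * Real.log 2)) := by
  rw [eexp, rad_eq_exp, ← Real.exp_nat_mul]
  congr 2; ring

lemma exists_volume_ball (d : ℕ) : ∃ v : ℝ, ∀ (x : EuclideanSpace ℝ (Fin d)) (n : ℕ),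
    volume (Metric.ball x (rad n)) = eexp (v - n * d * Real.log 2) := by
  obtain ⟨v, hv⟩ := exists_eq_eexp (a := volume (Metric.ball (0 : EuclideanSpace ℝ (Fin d)) 1))
    (Metric.measure_ball_pos _ _ one_pos).ne' measure_ball_lt_top.ne
  refine ⟨v, fun x n => ?_⟩
  rw [Measure.addHaar_ball_of_pos _ _ (rad_pos n), finrank_euclideanSpace_fin, hv, ofReal_rad_pow,
    ← eexp_add]
  congr 1; ring

lemma exists_gridStage_valid (d n₀ : ℕ) (hn₀ : 2 ≤ n₀) :
    ∃ C₁ c₁ c₂ : ℝ, ∀ (x₀ : EuclideanSpace ℝ (Fin d)) (m N : ℕ), n₀ ≤ N →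
      d * rad m ≤ rad (N + 1) → (gridStage x₀ n₀ m N).Valid C₁ c₁ c₂ n₀ := by
  obtain ⟨v, hv⟩ := exists_volume_ball d
  refine ⟨v + 2 * d * Real.log 2, v - d * Real.log 2, v - (n₀ + 1 : ℕ) * d * Real.log 2,
    fun x₀ m N hN hm => ?_⟩
  have hb : ∀ r, Bornology.IsBounded (Metric.closedBall x₀ r) := fun r =>
    Metric.isBounded_closedBall
  have hS : ∀ y, y ∈ (gridStage x₀ n₀ m N).S ↔ dist y x₀ ≤ 2 * rad n₀ ∧ dyadicFloor m y = y :=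
    fun y => mem_dyadicGrid (hb _)
  have hI : ∀ y, y ∈ (gridStage x₀ n₀ m N).I ↔ dist y x₀ ≤ rad n₀ ∧ dyadicFloor m y = y :=
    fun y => mem_dyadicGrid (hb _)
  have hn0 : rad n₀ ≤ 1 / 4 := (rad_anti hn₀).trans (by norm_num [rad])
  have hd : ∀ z : EuclideanSpace ℝ (Fin d), dist (dyadicFloor m z) z ≤ rad (N + 1) := fun z =>
    (dist_dyadicFloor_le m z).trans hm
  have hnb : ∀ y n, ∀ z ∈ nbhd (gridStage x₀ n₀ m N).S y n, dyadicFloor m z = z := fun y n z hz =>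
    ((hS z).1 (mem_nbhd.1 hz).1).2
  refine ⟨fun y hy => (hS y).2 ?_, ⟨fun x hx y hy => ?_, fun x _ n hn => ?_⟩,
    fun y hy n hn hnN => ?_, ?_⟩
  · obtain ⟨h1, h2⟩ := (hI y).1 hy
    exact ⟨by linarith [rad_pos n₀], h2⟩
  · linarith [((hS x).1 hx).1, ((hS y).1 hy).1, dist_triangle_right x y x₀]
  · change n ≤ N at hn
    change ENNReal.ofReal (rad m ^ d) * _ ≤ _
    rw [← volume_dyadicFloor_preimage_finset (hnb x n)]
    have hr2 := rad_pos n
    have hsub : dyadicFloor m ⁻¹' (nbhd (gridStage x₀ n₀ m N).S x n) ⊆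
        Metric.closedBall x (2 * rad n) := fun z hz => by
      have h1 := (mem_nbhd.1 hz).2
      have h2 := hd z
      have h3 := rad_anti (show n ≤ N + 1 by omega)
      rw [Metric.mem_closedBall]
      linarith [dist_triangle_left z x (dyadicFloor m z)]
    refine (measure_mono hsub).trans ?_
    have h4 : volume (Metric.ball (0 : EuclideanSpace ℝ (Fin d)) 1) = eexp v := by
      simpa [rad_zero] using hv 0 0
    rw [Measure.addHaar_closedBall _ _ (by positivity), finrank_euclideanSpace_fin, h4, mul_pow,
      ENNReal.ofReal_mul (by positivity), ofReal_rad_pow]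
    have h5 : ENNReal.ofReal (2 ^ d) = eexp (d * Real.log 2) := by
      rw [eexp, Real.exp_nat_mul, Real.exp_log two_pos]
    rw [h5, ← eexp_add, ← eexp_add, eexp_le_iff]
    nlinarith [mul_nonneg (d.cast_nonneg : (0 : ℝ) ≤ d) log_two_pos.le]
  · change n ≤ N at hnN
    change _ ≤ ENNReal.ofReal (rad m ^ d) * _
    rw [← volume_dyadicFloor_preimage_finset (hnb y n)]
    have hsub : Metric.ball y (rad (n + 1)) ⊆
        dyadicFloor m ⁻¹' (nbhd (gridStage x₀ n₀ m N).S y n) := fun z hz => by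
      rw [Metric.mem_ball] at hz
      have h2 := hd z
      have h3 := rad_anti (show n + 1 ≤ N + 1 by omega)
      have h4 := dist_triangle (dyadicFloor m z) z y
      have h5 : dist (dyadicFloor m z) y ≤ rad n := by
        rw [rad_succ n] at *
        linarith
      refine mem_nbhd.2 ⟨(hS _).2 ⟨?_, dyadicFloor_dyadicFloor m z⟩, h5⟩
      linarith [dist_triangle (dyadicFloor m z) y x₀, ((hI y).1 hy).1, rad_anti hn]
    refine le_trans ?_ (measure_mono hsub)
    rw [hv, eexp_le_iff]
    push_cast
    linarith
  · change _ ≤ ENNReal.ofReal (rad m ^ d) * _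
    rw [← volume_dyadicFloor_preimage_finset fun y hy => ((hI y).1 hy).2]
    have hsub : Metric.ball x₀ (rad (n₀ + 1)) ⊆
        dyadicFloor m ⁻¹' (gridStage x₀ n₀ m N).I := fun z hz => by
      rw [Metric.mem_ball] at hz
      have h2 := hd z
      have h3 := rad_anti (show n₀ + 1 ≤ N + 1 by omega)
      have h4 := dist_triangle (dyadicFloor m z) z x₀
      refine (hI _).2 ⟨?_, dyadicFloor_dyadicFloor m z⟩
      rw [rad_succ n₀] at *
      linarith
    refine le_trans ?_ (measure_mono hsub)
    rw [hv]

end GridStage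

section DensApprox

variable {C : Site d → Site d → ℝ} {C₀ γ : ℝ} {N : ℕ} {μ : Measure (Site d → ℝ)}

lemma GaussField.lintegral_dens (hμ : GaussField μ C) (z : EuclideanSpace ℝ (Fin d)) :
    ∫⁻ φ, dens C γ N φ z ∂μ = 1 := by
  have := hμ.isProbabilityMeasure
  simpa using hμ.lintegral_dens_mul (γ := γ) (N := N) z (F := fun _ => 1) measurable_const

lemma GaussField.lintegral_dens_mul_dens (hμ : GaussField μ C) (z y : EuclideanSpace ℝ (Fin d)) :
    ∫⁻ φ, dens C γ N φ y * dens C γ N φ z ∂μ = eexp (γ ^ 2 * C (N, z) (N, y)) := by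
  rw [hμ.lintegral_dens_mul y (measurable_dens C γ N z)]
  simp_rw [dens_shift]
  rw [lintegral_const_mul _ (measurable_dens C γ N z), hμ.lintegral_dens, mul_one, sq]

lemma ofReal_toReal_sub_sq_add {a b : ℝ≥0∞} (ha : a ≠ ⊤) (hb : b ≠ ⊤) :
    ‖a.toReal - b.toReal‖ₑ ^ (2 : ℝ) + 2 * (a * b) = a * a + b * b := by
  lift a to ℝ≥0 using ha
  lift b to ℝ≥0 using hb
  rw [← Real.enorm_abs, Real.enorm_of_nonneg (abs_nonneg _),
    ENNReal.ofReal_rpow_of_nonneg (abs_nonneg _) zero_le_two]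
  have h : ((2 : ℝ≥0∞) * (a * b)) = ENNReal.ofReal (2 * ((a : ℝ) * b)) := by
    rw [ENNReal.ofReal_mul zero_le_two, ENNReal.ofReal_mul (NNReal.coe_nonneg a)]; simp
  have h' : ((a : ℝ≥0∞) * a + b * b) = ENNReal.ofReal ((a : ℝ) * a + b * b) := by
    rw [ENNReal.ofReal_add (by positivity) (by positivity),
      ENNReal.ofReal_mul (NNReal.coe_nonneg a),
      ENNReal.ofReal_mul (NNReal.coe_nonneg b)]; simp
  rw [h, h', ← ENNReal.ofReal_add (by positivity) (by positivity)]
  simp only [ENNReal.coe_toReal, Real.rpow_ofNat, sq_abs]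
  congr 1; ring

lemma dens_ne_top (φ : Site d → ℝ) (y : EuclideanSpace ℝ (Fin d)) : dens C γ N φ y ≠ ⊤ :=
  eexp_ne_top _

/-- The second moment of the increment of the density between two points. -/
def densGap (C : Site d → Site d → ℝ) (γ : ℝ) (N : ℕ) (z y : EuclideanSpace ℝ (Fin d)) : ℝ≥0∞ :=
  eexp (γ ^ 2 * C (N, z) (N, z)) + eexp (γ ^ 2 * C (N, y) (N, y)) -
    2 * eexp (γ ^ 2 * C (N, y) (N, z))

lemma GaussField.lintegral_enorm_dens_sub_le (hμ : GaussField μ C)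
    (z y : EuclideanSpace ℝ (Fin d)) :
    ∫⁻ φ, ‖(dens C γ N φ z).toReal - (dens C γ N φ y).toReal‖ₑ ∂μ ≤
      densGap C γ N z y ^ (1 / 2 : ℝ) := by
  have := hμ.isProbabilityMeasure
  have hz := measurable_dens C γ N z
  have hy := measurable_dens C γ N y
  have hm : Measurable fun φ => ‖(dens C γ N φ z).toReal - (dens C γ N φ y).toReal‖ₑ := by
    fun_prop
  have h := ENNReal.lintegral_mul_le_Lp_mul_Lq μ Real.HolderConjugate.two_two hm.aemeasurable
    (aemeasurable_const (b := (1 : ℝ≥0∞)))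
  simp only [Pi.mul_apply, mul_one, ENNReal.one_rpow, lintegral_one, measure_univ] at h
  refine h.trans_eq ?_
  congr 1
  refine ENNReal.eq_sub_of_add_eq (ENNReal.mul_ne_top (by simp) (eexp_ne_top _)) ?_
  rw [← hμ.lintegral_dens_mul_dens, ← hμ.lintegral_dens_mul_dens, ← hμ.lintegral_dens_mul_dens,
    ← lintegral_const_mul _ (by fun_prop), ← lintegral_add_right _ (by fun_prop),
    ← lintegral_add_right _ (by fun_prop)]
  exact lintegral_congr fun φ => ofReal_toReal_sub_sq_add (dens_ne_top _ _) (dens_ne_top _ _)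

lemma tendsto_dyadicFloor (z : EuclideanSpace ℝ (Fin d)) :
    Tendsto (fun m => dyadicFloor m z) atTop (𝓝 z) := by
  refine Metric.tendsto_atTop'.2 fun ε hε => ?_
  obtain ⟨m, hm⟩ := eventually_atTop.1 (eventually_mul_rad_le d (half_pos hε))
  exact ⟨m, fun k hk => ((dist_dyadicFloor_le k z).trans (hm k hk.le)).trans_lt (half_lt_self hε)⟩

lemma tendsto_densGap_dyadicFloor
    (hc : Continuous fun p : EuclideanSpace ℝ (Fin d) × EuclideanSpace ℝ (Fin d) =>
      C (N, p.1) (N, p.2)) (z : EuclideanSpace ℝ (Fin d)) :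
    Tendsto (fun m => densGap C γ N z (dyadicFloor m z)) atTop (𝓝 0) := by
  have he : Continuous eexp := ENNReal.continuous_ofReal.comp Real.continuous_exp
  have hf := tendsto_dyadicFloor z
  have h1 : Tendsto (fun m => eexp (γ ^ 2 * C (N, dyadicFloor m z) (N, dyadicFloor m z))) atTop
      (𝓝 (eexp (γ ^ 2 * C (N, z) (N, z)))) :=
    (he.tendsto _).comp (((hc.tendsto (z, z)).comp (hf.prodMk_nhds hf)).const_mul _)
  have h2 : Tendsto (fun m => eexp (γ ^ 2 * C (N, dyadicFloor m z) (N, z))) atTop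
      (𝓝 (eexp (γ ^ 2 * C (N, z) (N, z)))) :=
    (he.tendsto _).comp (((hc.tendsto (z, z)).comp (hf.prodMk_nhds tendsto_const_nhds)).const_mul _)
  have h := ENNReal.Tendsto.sub (tendsto_const_nhds (x := eexp (γ ^ 2 * C (N, z) (N, z))).add h1)
    (ENNReal.Tendsto.const_mul (a := 2) h2 (Or.inr (by simp)))
    (Or.inl (by finiteness [eexp_ne_top (γ ^ 2 * C (N, z) (N, z))]))
  rwa [two_mul, tsub_self] at h

lemma KernelBound.densGap_le (hC : KernelBound C C₀) (z y : EuclideanSpace ℝ (Fin d)) :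
    densGap C γ N z y ≤ 2 * eexp (γ ^ 2 * (N * Real.log 2 + C₀)) := by
  have h : ∀ x, eexp (γ ^ 2 * C (N, x) (N, x)) ≤ eexp (γ ^ 2 * (N * Real.log 2 + C₀)) := fun x =>
    eexp_le (mul_le_mul_of_nonneg_left (hC.far _ _ _ _ _ (Or.inr (Or.inl le_rfl))) (sq_nonneg _))
  rw [two_mul]
  exact tsub_le_self.trans (add_le_add (h z) (h y))

variable {Ω : Type*} [MeasurableSpace Ω] {P : Measure Ω} {Φ : Ω → Site d → ℝ}

/-- The integrated error made when the density is evaluated at dyadic points. -/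
def discError (C : Site d → Site d → ℝ) (γ : ℝ) (N m : ℕ) (U : Set (EuclideanSpace ℝ (Fin d)))
    (φ : Site d → ℝ) : ℝ≥0∞ :=
  ∫⁻ z in U, ‖(dens C γ N φ z).toReal - (dens C γ N φ (dyadicFloor m z)).toReal‖ₑ

lemma measurable_uncurry_dens
    (hc : Continuous fun p : EuclideanSpace ℝ (Fin d) × EuclideanSpace ℝ (Fin d) =>
      C (N, p.1) (N, p.2))
    (hΦ : Measurable fun p : Ω × EuclideanSpace ℝ (Fin d) => Φ p.1 (N, p.2)) :
    Measurable fun p : Ω × EuclideanSpace ℝ (Fin d) => dens C γ N (Φ p.1) p.2 := by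
  have h : Measurable fun p : Ω × EuclideanSpace ℝ (Fin d) => C (N, p.2) (N, p.2) :=
    (hc.measurable.comp (measurable_id.prodMk measurable_id)).comp measurable_snd
  exact measurable_eexp.comp ((hΦ.const_mul γ).sub (h.const_mul _))

lemma measurable_uncurry_enorm_dens_sub
    (hc : Continuous fun p : EuclideanSpace ℝ (Fin d) × EuclideanSpace ℝ (Fin d) =>
      C (N, p.1) (N, p.2))
    (hΦ : Measurable fun p : Ω × EuclideanSpace ℝ (Fin d) => Φ p.1 (N, p.2)) (m : ℕ) :
    Measurable fun p : Ω × EuclideanSpace ℝ (Fin d) =>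
      ‖(dens C γ N (Φ p.1) p.2).toReal - (dens C γ N (Φ p.1) (dyadicFloor m p.2)).toReal‖ₑ := by
  have h := measurable_uncurry_dens (γ := γ) hc hΦ
  have h' : Measurable fun p : Ω × EuclideanSpace ℝ (Fin d) =>
      dens C γ N (Φ p.1) (dyadicFloor m p.2) :=
    h.comp (measurable_fst.prodMk ((measurable_dyadicFloor m).comp measurable_snd))
  fun_prop

lemma measurable_discError
    (hc : Continuous fun p : EuclideanSpace ℝ (Fin d) × EuclideanSpace ℝ (Fin d) =>
      C (N, p.1) (N, p.2))
    (hΦ : Measurable fun p : Ω × EuclideanSpace ℝ (Fin d) => Φ p.1 (N, p.2)) (m : ℕ)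
    (U : Set (EuclideanSpace ℝ (Fin d))) :
    Measurable fun ω => discError C γ N m U (Φ ω) :=
  (measurable_uncurry_enorm_dens_sub hc hΦ m).lintegral_prod_right'

lemma tendsto_lintegral_discError [IsProbabilityMeasure P] (hC : KernelBound C C₀)
    (hc : Continuous fun p : EuclideanSpace ℝ (Fin d) × EuclideanSpace ℝ (Fin d) =>
      C (N, p.1) (N, p.2))
    (hΦm : Measurable Φ)
    (hΦ : Measurable fun p : Ω × EuclideanSpace ℝ (Fin d) => Φ p.1 (N, p.2))
    (hμ : GaussField (P.map Φ) C) {U : Set (EuclideanSpace ℝ (Fin d))} (hU : volume U ≠ ⊤) :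
    Tendsto (fun m => ∫⁻ ω, discError C γ N m U (Φ ω) ∂P) atTop (𝓝 0) := by
  have hle : ∀ m z, ∫⁻ ω, ‖(dens C γ N (Φ ω) z).toReal -
      (dens C γ N (Φ ω) (dyadicFloor m z)).toReal‖ₑ ∂P ≤
        densGap C γ N z (dyadicFloor m z) ^ (1 / 2 : ℝ) := fun m z => by
    refine le_trans (le_of_eq ?_) (hμ.lintegral_enorm_dens_sub_le z (dyadicFloor m z))
    have hz := measurable_dens C γ N z
    have hy := measurable_dens C γ N (dyadicFloor m z)
    rw [lintegral_map (by fun_prop) hΦm]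
  have hm := fun m => measurable_uncurry_enorm_dens_sub (γ := γ) hc hΦ m
  have hswap : ∀ m, ∫⁻ ω, discError C γ N m U (Φ ω) ∂P = ∫⁻ z in U, (∫⁻ ω,
      ‖(dens C γ N (Φ ω) z).toReal - (dens C γ N (Φ ω) (dyadicFloor m z)).toReal‖ₑ ∂P) :=
    fun m => lintegral_lintegral_swap (hm m).aemeasurable
  simp_rw [hswap]
  rw [← lintegral_zero (μ := volume.restrict U)]
  refine tendsto_lintegral_of_dominated_convergence
    (fun _ => (2 * eexp (γ ^ 2 * (N * Real.log 2 + C₀))) ^ (1 / 2 : ℝ))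
    (fun m => (hm m).lintegral_prod_left') (fun m => ae_of_all _ fun z => (hle m z).trans
      (ENNReal.rpow_le_rpow (hC.densGap_le _ _) (by norm_num))) ?_ (ae_of_all _ fun z => ?_)
  · rw [lintegral_const, Measure.restrict_apply_univ]
    have := eexp_ne_top (γ ^ 2 * (N * Real.log 2 + C₀))
    exact ENNReal.mul_ne_top (ENNReal.rpow_ne_top_of_nonneg (by norm_num) (by finiteness)) hU
  · refine tendsto_of_tendsto_of_tendsto_of_le_of_le tendsto_const_nhds ?_
      (fun _ => zero_le) fun m => hle m z
    have h := (tendsto_densGap_dyadicFloor (γ := γ) hc z).ennrpow_const (1 / 2 : ℝ)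
    rwa [ENNReal.zero_rpow_of_pos (by norm_num)] at h

lemma mass_eq_setLIntegral (φ : Site d → ℝ) {p m : ℕ} (h : p ≤ m) {F : Finset (Fin d → ℤ)}
    (hF : Bornology.IsBounded (dyadicUnion p F)) :
    mass C γ (ENNReal.ofReal (rad m ^ d)) N φ (dyadicGrid m (dyadicUnion p F)) =
      ∫⁻ z in dyadicUnion p F, dens C γ N φ (dyadicFloor m z) := by
  conv_rhs => rw [dyadicUnion_eq_preimage h hF]
  rw [setLIntegral_dyadicFloor fun y hy => ((mem_dyadicGrid hF).1 hy).2]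
  rfl

lemma le_add_enorm_toReal_sub {a b : ℝ≥0∞} (ha : a ≠ ⊤) (hb : b ≠ ⊤) :
    a ≤ b + ‖a.toReal - b.toReal‖ₑ := by
  rw [← ENNReal.ofReal_toReal ha, ← ENNReal.ofReal_toReal hb, Real.enorm_eq_ofReal_abs,
    ← ENNReal.ofReal_add ENNReal.toReal_nonneg (abs_nonneg _), ENNReal.toReal_ofReal
    ENNReal.toReal_nonneg, ENNReal.toReal_ofReal ENNReal.toReal_nonneg]
  exact ENNReal.ofReal_le_ofReal (by linarith [le_abs_self (a.toReal - b.toReal)])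

lemma setLIntegral_dens_le_mass_add {φ : Site d → ℝ} {m : ℕ} {F : Finset (Fin d → ℤ)} {p : ℕ}
    (h : p ≤ m) (hF : Bornology.IsBounded (dyadicUnion p F))
    (hm : Measurable fun z => dens C γ N φ z) :
    ∫⁻ z in dyadicUnion p F, dens C γ N φ z ≤
        mass C γ (ENNReal.ofReal (rad m ^ d)) N φ (dyadicGrid m (dyadicUnion p F)) +
          discError C γ N m (dyadicUnion p F) φ ∧
      mass C γ (ENNReal.ofReal (rad m ^ d)) N φ (dyadicGrid m (dyadicUnion p F)) ≤
        (∫⁻ z in dyadicUnion p F, dens C γ N φ z) + discError C γ N m (dyadicUnion p F) φ := by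
  have hm' : Measurable fun z => dens C γ N φ (dyadicFloor m z) :=
    hm.comp (measurable_dyadicFloor m)
  rw [mass_eq_setLIntegral φ h hF, discError]
  constructor
  · rw [← lintegral_add_left hm']
    exact lintegral_mono fun z => le_add_enorm_toReal_sub (dens_ne_top _ _) (dens_ne_top _ _)
  · rw [← lintegral_add_left hm]
    refine lintegral_mono fun z => ?_
    rw [← enorm_neg, neg_sub]
    exact le_add_enorm_toReal_sub (dens_ne_top _ _) (dens_ne_top _ _)

end DensApprox

section ChaosApprox

variable {θ : EuclideanSpace ℝ (Fin d) → ℝ}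
  {g : EuclideanSpace ℝ (Fin d) → EuclideanSpace ℝ (Fin d) → ℝ}
  {Ω : Type*} {X : ℝ → EuclideanSpace ℝ (Fin d) → Ω → ℝ} {γ : ℝ}

lemma approxGMC_rad {N : ℕ} {ω : Ω}
    (hm : Measurable fun z => dens (covKer g θ) γ N (dyadicField X ω) z)
    (A : Set (EuclideanSpace ℝ (Fin d))) :
    approxGMC γ X (mollifiedCov (logKernel g) θ θ) (fun _ => 1) (rad N) ω A =
      (∫⁻ z in A, dens (covKer g θ) γ N (dyadicField X ω) z).toReal := by
  have h : ∀ z, Real.exp (γ * X (rad N) z ω -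
      γ ^ 2 / 2 * mollifiedCov (logKernel g) θ θ (rad N) (rad N) z z) * 1 =
        (dens (covKer g θ) γ N (dyadicField X ω) z).toReal := fun z => by
    rw [dens, eexp_toReal, covKer_self, mul_one, dyadicField]
  rw [approxGMC]
  simp_rw [h]
  exact integral_toReal hm.aemeasurable (ae_of_all _ fun z => (dens_ne_top _ z).lt_top)

variable [MeasurableSpace Ω] {P : Measure Ω} {D : Set (EuclideanSpace ℝ (Fin d))}
  {M : Ω → Measure (EuclideanSpace ℝ (Fin d))}

lemma IsGaussianFamily.measurable_uncurry_dyadicField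
    {Km : ℝ → ℝ → EuclideanSpace ℝ (Fin d) → EuclideanSpace ℝ (Fin d) → ℝ}
    (hX : IsGaussianFamily P X Km) (N : ℕ) :
    Measurable fun p : Ω × EuclideanSpace ℝ (Fin d) => dyadicField X p.1 (N, p.2) :=
  hX.1.comp ((measurable_const (a := rad N)).prodMk measurable_swap)

lemma tendsto_rad : Tendsto rad atTop (𝓝[Set.Ioc (0 : ℝ) 1] 0) :=
  tendsto_nhdsWithin_iff.2 ⟨tendsto_pow_atTop_nhds_zero_of_lt_one (by norm_num) (by norm_num),
    Eventually.of_forall fun n => ⟨rad_pos n, rad_zero ▸ rad_anti n.zero_le⟩⟩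

lemma eventually_measure_approxGMC_le
    (hM : IsGMCMeasure P γ X (mollifiedCov (logKernel g) θ θ) (fun _ => 1) D M)
    {A : Set (EuclideanSpace ℝ (Fin d))} (hA : MeasurableSet A) (hAc : IsCompact (closure A))
    (hAD : closure A ⊆ D) {η : ℝ≥0∞} (hη : 0 < η) :
    ∀ᶠ N in atTop, P {ω | η ≤ edist (approxGMC γ X (mollifiedCov (logKernel g) θ θ) (fun _ => 1)
      (rad N) ω A) (M ω A).toReal} ≤ η :=
  ((hM.2.2 A hA hAc hAD η hη).comp tendsto_rad).eventually_le_const hη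

lemma eventually_measure_discError_le [IsProbabilityMeasure P] (hd : 1 ≤ d)
    (hθ : IsMollifier θ) (hg : IsBoundedMeasurable g)
    (hX : IsGaussianFamily P X (mollifiedCov (logKernel g) θ θ)) (N : ℕ)
    {U : Set (EuclideanSpace ℝ (Fin d))} (hU : volume U ≠ ⊤) {η : ℝ≥0∞} (hη : 0 < η)
    (hη' : η ≠ ⊤) :
    ∀ᶠ m in atTop, P {ω | η ≤ discError (covKer g θ) γ N m U (dyadicField X ω)} ≤ η := by
  obtain ⟨C₀, hC⟩ := hθ.exists_kernelBound hd hg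
  have hc := hθ.continuous_covKer hd hg N N
  have hΦ := hX.measurable_uncurry_dyadicField N
  filter_upwards [(tendsto_lintegral_discError (γ := γ) hC hc hX.measurable_dyadicField hΦ
    hX.gaussField hU).eventually_le_const (ENNReal.mul_pos hη.ne' hη.ne')] with m hm
  have h := (mul_meas_ge_le_lintegral (measurable_discError (γ := γ) hc hΦ m U) η).trans hm
  exact (ENNReal.mul_le_mul_iff_right hη.ne' hη').1 h

lemma mem_Icc_of_edist_lt {I m b Δ η : ℝ≥0∞} (hb : b ≠ ⊤) (hm : m ≠ ⊤) (h₁ : I ≤ m + Δ)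
    (h₂ : m ≤ I + Δ) (hΔ : Δ < η) (h : edist I.toReal b.toReal < η) :
    m ∈ Set.Icc (b - 2 * η) (b + 2 * η) := by
  have hI : I ≠ ⊤ := (h₁.trans_lt (ENNReal.add_lt_top.2 ⟨hm.lt_top, hΔ.trans_le le_top⟩)).ne
  rw [edist_eq_enorm_sub] at h
  have h3 := (le_add_enorm_toReal_sub hI hb).trans (add_le_add_right h.le _)
  rw [← enorm_neg, neg_sub] at h
  have h4 := (le_add_enorm_toReal_sub hb hI).trans (add_le_add_right h.le _)
  refine ⟨tsub_le_iff_right.2 ?_, ?_⟩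
  · calc b ≤ I + η := h4
      _ ≤ m + η + η := by gcongr; exact h₁.trans (by gcongr)
      _ = m + 2 * η := by ring
  · calc m ≤ I + η := h₂.trans (by gcongr)
      _ ≤ b + η + η := by gcongr
      _ = b + 2 * η := by ring

/-- Along suitable scales, the discretised masses converge almost surely to the chaos measure of
every dyadic set. -/
lemma exists_tendsto_mass [IsProbabilityMeasure P] (hd : 1 ≤ d)
    (hθ : IsMollifier θ) (hg : IsBoundedMeasurable g)
    (hX : IsGaussianFamily P X (mollifiedCov (logKernel g) θ θ))
    (hM : IsGMCMeasure P γ X (mollifiedCov (logKernel g) θ θ) (fun _ => 1) D M) :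
    ∃ N m : ℕ → ℕ, (∀ k, k ≤ N k) ∧ (∀ k, k ≤ m k) ∧ (∀ k, d * rad (m k) ≤ rad (N k + 1)) ∧
      ∀ᵐ ω ∂P, ∀ p F, IsCompact (closure (dyadicUnion (d := d) p F)) →
        closure (dyadicUnion p F) ⊆ D →
        Tendsto (fun k => mass (covKer g θ) γ (ENNReal.ofReal (rad (m k) ^ d)) (N k)
          (dyadicField X ω) (dyadicGrid (m k) (dyadicUnion p F))) atTop
          (𝓝 (M ω (dyadicUnion p F))) := by
  obtain ⟨e, he⟩ := exists_surjective_nat (ℕ × Finset (Fin d → ℤ))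
  let U : ℕ → Set (EuclideanSpace ℝ (Fin d)) := fun i => dyadicUnion (e i).1 (e i).2
  have hUm : ∀ i, MeasurableSet (U i) := fun i => measurableSet_dyadicUnion _ _
  let adm : ℕ → Prop := fun i => IsCompact (closure (U i)) ∧ closure (U i) ⊆ D
  let η : ℕ → ℝ≥0∞ := fun k => 2⁻¹ ^ k
  have hη : ∀ k, 0 < η k := fun k => ENNReal.pow_pos (by simp) k
  have hη' : ∀ k, η k ≠ ⊤ := fun k => by simp only [η]; finiteness
  have hN : ∀ k, ∃ N, k ≤ N ∧ ∀ i ∈ Finset.range k, adm i →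
      P {ω | η k ≤ edist (approxGMC γ X (mollifiedCov (logKernel g) θ θ) (fun _ => 1)
        (rad N) ω (U i)) (M ω (U i)).toReal} ≤ η k := fun k =>
    ((eventually_ge_atTop k).and ((eventually_all_finset _).2 fun i _ =>
      eventually_imp_distrib_left.2 fun ha =>
        eventually_measure_approxGMC_le hM (hUm i) ha.1 ha.2 (hη k))).exists
  choose N hkN hN using hN
  have hm : ∀ k, ∃ m, k ≤ m ∧ d * rad m ≤ rad (N k + 1) ∧ ∀ i ∈ Finset.range k, adm i →
      (e i).1 ≤ m ∧
      P {ω | η k ≤ discError (covKer g θ) γ (N k) m (U i) (dyadicField X ω)} ≤ η k := fun k =>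
    ((eventually_ge_atTop k).and ((eventually_mul_rad_le d (rad_pos _)).and
      ((eventually_all_finset _).2 fun i _ => eventually_imp_distrib_left.2 fun ha =>
        (eventually_ge_atTop _).and (eventually_measure_discError_le hd hθ hg hX (N k)
          ((measure_mono subset_closure).trans_lt ha.1.measure_lt_top).ne (hη k) (hη' k))))).exists
  choose m hkm hmN hm using hm
  refine ⟨N, m, hkN, hkm, hmN, ?_⟩
  have hlim : ∀ i, adm i → ∀ᵐ ω ∂P, Tendsto (fun k => mass (covKer g θ) γ
      (ENNReal.ofReal (rad (m k) ^ d)) (N k) (dyadicField X ω) (dyadicGrid (m k) (U i))) atTop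
      (𝓝 (M ω (U i))) := fun i ha => by
    let s : ℕ → Set Ω := fun k => if i < k then
      {ω | η k ≤ edist (approxGMC γ X (mollifiedCov (logKernel g) θ θ) (fun _ => 1)
        (rad (N k)) ω (U i)) (M ω (U i)).toReal} ∪
      {ω | η k ≤ discError (covKer g θ) γ (N k) (m k) (U i) (dyadicField X ω)} else ∅
    have hs : ∀ k, P (s k) ≤ 2 * 2⁻¹ ^ k := fun k => by
      by_cases hk : i < k
      · simp only [s, if_pos hk]
        rw [two_mul]
        exact (measure_union_le _ _).trans (add_le_add (hN k i (Finset.mem_range.2 hk) ha)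
          (hm k i (Finset.mem_range.2 hk) ha).2)
      · simp [s, if_neg hk]
    have hsum : ∑' k, P (s k) ≠ ⊤ := by
      refine ((ENNReal.tsum_le_tsum hs).trans_lt ?_).ne
      rw [ENNReal.tsum_mul_left, ENNReal.tsum_geometric, ENNReal.one_sub_inv_two, inv_inv]
      finiteness
    filter_upwards [ae_eventually_notMem hsum] with ω hω
    have hMt := hM.2.1 ω (U i) ha.1 ha.2
    refine (ENNReal.tendsto_nhds hMt).2 fun ε hε => ?_
    have hsmall : ∀ᶠ k in atTop, 2 * η k ≤ ε := by
      have := ENNReal.Tendsto.const_mul (a := 2)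
        (ENNReal.tendsto_pow_atTop_nhds_zero_of_lt_one (r := 2⁻¹) (by simp)) (Or.inr (by simp))
      rw [mul_zero] at this
      exact this.eventually_le_const hε
    filter_upwards [hω, hsmall, eventually_gt_atTop i] with k hk hke hik
    simp only [s, if_pos hik, Set.mem_union, Set.mem_ofPred_eq, not_or, not_le] at hk
    have hdm : Measurable fun z => dens (covKer g θ) γ (N k) (dyadicField X ω) z :=
      (measurable_uncurry_dens (γ := γ) (hθ.continuous_covKer hd hg _ _)
        (hX.measurable_uncurry_dyadicField (N k))).comp measurable_prodMk_left
    rw [approxGMC_rad hdm] at hk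
    have hb : Bornology.IsBounded (U i) := ha.1.isBounded.subset subset_closure
    have h2 := setLIntegral_dens_le_mass_add (hm k i (Finset.mem_range.2 hik) ha).1 hb hdm
    have h := mem_Icc_of_edist_lt hMt ?_ h2.1 h2.2 hk.2 hk.1
    · exact ⟨(tsub_le_tsub_left hke _).trans h.1, h.2.trans (by gcongr)⟩
    · exact ENNReal.sum_ne_top.2 fun y _ =>
        ENNReal.mul_ne_top ENNReal.ofReal_ne_top (dens_ne_top _ _)
  have hall := ae_all_iff.2 fun i => (eventually_imp_distrib_left.2 (hlim i) : ∀ᵐ ω ∂P, _)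
  filter_upwards [hall] with ω hω p F h1 h2
  obtain ⟨i, hi⟩ := he (p, F)
  have := hω i
  simp only [adm, U, hi] at this
  exact this ⟨h1, h2⟩

end ChaosApprox

section GridApprox

variable {C : Site d → Site d → ℝ} {C₀ γ : ℝ} {x₀ : EuclideanSpace ℝ (Fin d)} {n₀ : ℕ}
  {N m : ℕ → ℕ}

/-- Convergence of the masses of dyadic sets gives control of all balls. -/
lemma approximates_gridStage {φ : Site d → ℝ} {M : Measure (EuclideanSpace ℝ (Fin d))}
    {D : Set (EuclideanSpace ℝ (Fin d))} (hD : Metric.closedBall x₀ (2 * rad n₀) ⊆ D)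
    (h : ∀ p F, IsCompact (closure (dyadicUnion (d := d) p F)) →
      closure (dyadicUnion p F) ⊆ D →
        Tendsto (fun k => mass C γ (ENNReal.ofReal (rad (m k) ^ d)) (N k) φ
          (dyadicGrid (m k) (dyadicUnion p F))) atTop (𝓝 (M (dyadicUnion p F)))) :
    Approximates C γ (fun k => gridStage x₀ n₀ (m k) (N k)) φ M x₀ (rad n₀) := by
  have hadm : ∀ x ∈ Metric.closedBall x₀ (rad n₀), ∀ r' ≤ rad n₀, ∀ p F,
      dyadicUnion p F ⊆ Metric.ball x r' →
      dyadicUnion p F ⊆ Metric.closedBall x₀ (2 * rad n₀) ∧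
      Tendsto (fun k => mass C γ (ENNReal.ofReal (rad (m k) ^ d)) (N k) φ
          (dyadicGrid (m k) (dyadicUnion p F))) atTop (𝓝 (M (dyadicUnion p F))) := by
    intro x hx r' hr' p F hU
    have hs : dyadicUnion p F ⊆ Metric.closedBall x₀ (2 * rad n₀) :=
      hU.trans (Metric.ball_subset_closedBall.trans (Metric.closedBall_subset_closedBall' (by
        rw [Metric.mem_closedBall] at hx; linarith)))
    have hc := closure_minimal hs Metric.isClosed_closedBall
    exact ⟨hs, h p F ((isCompact_closedBall _ _).of_isClosed_subset isClosed_closure hc)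
      (hc.trans hD)⟩
  constructor
  · intro x hx r r' _ hrr' hr' c hfreq
    obtain ⟨p, F, h1, h2⟩ := exists_dyadicUnion x hrr'
    obtain ⟨hs, hlim⟩ := hadm x hx r' hr' p F h2
    have hb := Metric.isBounded_closedBall.subset hs
    refine (measure_mono (Metric.ball_subset_closedBall.trans h1)).trans
      (le_of_tendsto_of_frequently hlim (hfreq.mono fun k hk => (mass_mono ?_ φ).trans hk))
    intro y hy
    rw [mem_dyadicGrid hb] at hy
    exact mem_near.2 ⟨(mem_dyadicGrid Metric.isBounded_closedBall).2 ⟨hs hy.1, hy.2⟩,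
      (Metric.mem_ball.1 (h2 hy.1)).le⟩
  · intro x hx r r' _ hrr' hr' c hfreq
    obtain ⟨p, F, h1, h2⟩ := exists_dyadicUnion x hrr'
    obtain ⟨hs, hlim⟩ := hadm x hx r' hr' p F h2
    have hb := Metric.isBounded_closedBall.subset hs
    refine le_trans (ge_of_tendsto_of_frequently hlim (hfreq.mono fun k hk =>
      hk.trans (mass_mono ?_ φ))) (measure_mono h2)
    intro y hy
    obtain ⟨hyS, hyd⟩ := mem_near.1 hy
    exact (mem_dyadicGrid hb).2
      ⟨h1 hyd, ((mem_dyadicGrid Metric.isBounded_closedBall).1 hyS).2⟩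

lemma Approximates.rpow_ball_le_liminf {T : ℕ → Stage d} {φ : Site d → ℝ}
    {M : Measure (EuclideanSpace ℝ (Fin d))} {ρ : ℝ} (h : Approximates C γ T φ M x₀ ρ)
    {x : EuclideanSpace ℝ (Fin d)} (hx : x ∈ Metric.closedBall x₀ ρ) {r r' q : ℝ} (hr : 0 < r)
    (hrr' : r < r') (hr' : r' ≤ ρ) (hq : 0 < q) :
    M (Metric.ball x r) ^ q ≤
      liminf (fun k => mass C γ (T k).w (T k).N φ (near (T k).S x r') ^ q) atTop := by
  refine le_of_forall_gt_imp_ge_of_dense fun a ha => ?_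
  have hf := (frequently_lt_of_liminf_lt (by isBoundedDefault) ha).mono fun k hk =>
    ENNReal.le_rpow_inv_iff hq |>.2 hk.le
  exact (ENNReal.le_rpow_inv_iff hq).1 (h.ball_le x hx r r' hr hrr' hr' _ hf)

variable {Ω : Type*} [MeasurableSpace Ω] {P : Measure Ω} {Φ : Ω → Site d → ℝ}
  {M : Ω → Measure (EuclideanSpace ℝ (Fin d))}

lemma exists_lintegral_ball_rpow_le (hC : KernelBound C C₀) (hγ : 0 ≤ γ) {q : ℝ} (hq : 0 < q)
    (hq1 : q ≤ 1 ∨ γ ^ 2 * q < 2 * d) (hn₀ : 2 ≤ n₀) (hΦ : Measurable Φ)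
    (hμ : GaussField (P.map Φ) C) (hN : Tendsto N atTop atTop) (hNn : ∀ k, n₀ ≤ N k)
    (hm : ∀ k, d * rad (m k) ≤ rad (N k + 1))
    (hA : ∀ᵐ ω ∂P, Approximates C γ (fun k => gridStage x₀ n₀ (m k) (N k)) (Φ ω) (M ω) x₀
      (rad n₀)) :
    ∃ c : ℝ, ∀ y ∈ Metric.closedBall x₀ (rad n₀), ∀ n ≥ n₀,
      ∫⁻ ω, M ω (Metric.ball y (rad (n + 2))) ^ q ∂P ≤
        eexp (c - n * momExp d γ q * Real.log 2) := by
  obtain ⟨C₁, c₁, c₂, hval⟩ := exists_gridStage_valid d n₀ hn₀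
  obtain ⟨c, hc⟩ := exists_lintegral_mass_rpow_le hC C₁ hγ hq hq1
  refine ⟨c, fun y hy n hn => ?_⟩
  let T : ℕ → Stage d := fun k => gridStage x₀ n₀ (m k) (N k)
  have hle : ∀ᵐ ω ∂P, M ω (Metric.ball y (rad (n + 2))) ^ q ≤
      liminf (fun k => mass C γ (T k).w (T k).N (Φ ω) (near (T k).S y (rad (n + 1))) ^ q)
        atTop := by
    filter_upwards [hA] with ω hω
    have h1 := rad_pos (n + 1)
    exact hω.rpow_ball_le_liminf hy (rad_pos _) (by rw [rad_succ (n + 1)]; linarith)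
      (rad_anti (by omega)) hq
  have hmeas : ∀ k, Measurable fun φ : Site d → ℝ =>
      mass C γ (T k).w (T k).N φ (near (T k).S y (rad (n + 1))) ^ q := fun k =>
    (measurable_mass C γ _ _ _).pow_const q
  refine (lintegral_mono_ae hle).trans ((lintegral_liminf_le fun k =>
    (hmeas k).comp hΦ).trans (liminf_le_of_frequently_le'
      (Eventually.frequently ?_)))
  filter_upwards [hN.eventually_ge_atTop n] with k hk
  have hfl : dist (dyadicFloor (m k) y) y ≤ rad (n + 1) :=
    (dist_dyadicFloor_le _ _).trans ((hm k).trans (rad_anti (by omega)))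
  have hn1 : rad (n + 1) ≤ rad n₀ := rad_anti (by omega)
  have hmem : dyadicFloor (m k) y ∈ (T k).S := by
    refine (mem_dyadicGrid Metric.isBounded_closedBall).2 ⟨?_, dyadicFloor_dyadicFloor _ _⟩
    have := dist_triangle (dyadicFloor (m k) y) y x₀
    rw [Metric.mem_closedBall] at hy ⊢
    linarith
  have hsub : near (T k).S y (rad (n + 1)) ⊆ nbhd (T k).S (dyadicFloor (m k) y) n := by
    intro z hz
    obtain ⟨hzS, hzd⟩ := mem_near.1 hz
    refine mem_nbhd.2 ⟨hzS, ?_⟩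
    have := dist_triangle_right z (dyadicFloor (m k) y) y
    have := rad_succ n
    linarith
  simp only [Function.comp_apply]
  rw [← lintegral_map (hmeas k) hΦ]
  exact (lintegral_mono fun φ => ENNReal.rpow_le_rpow (mass_mono hsub φ) hq.le).trans
    (hc _ hμ _ _ _ (hval x₀ (m k) (N k) (hNn k) (hm k)).grid _ hmem n hk)

end GridApprox

section UpperBound

variable {M : Measure (EuclideanSpace ℝ (Fin d))}

/-- A Borel-Cantelli type covering bound. -/
lemma dimH_le_of_tendsto_sum {K : Set (EuclideanSpace ℝ (Fin d))}
    {Y : ℕ → Finset (EuclideanSpace ℝ (Fin d))}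
    (hY : ∀ᶠ n in atTop, ∀ x ∈ K, ∃ y ∈ Y n, dist x y ≤ rad (n + 3)) {s q a : ℝ}
    (hs : 0 ≤ s) (hq : 0 < q)
    (hlim : Tendsto (fun n : ℕ => (∑ y ∈ Y n, M (Metric.ball y (rad (n + 2))) ^ q) *
      eexp (n * (q * a - s) * Real.log 2)) atTop (𝓝 0)) :
    dimH {x | x ∈ K ∧ ∀ᶠ n : ℕ in atTop, eexp (-(n * a * Real.log 2)) ≤ M (Metric.ball x (rad n))} ≤
      ENNReal.ofReal s := by
  classical
  let E : ℕ → Set (EuclideanSpace ℝ (Fin d)) := fun n₁ =>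
    {x | x ∈ K ∧ ∀ n ≥ n₁, eexp (-(n * a * Real.log 2)) ≤ M (Metric.ball x (rad n))}
  have hE : {x | x ∈ K ∧ ∀ᶠ n : ℕ in atTop,
      eexp (-(n * a * Real.log 2)) ≤ M (Metric.ball x (rad n))} = ⋃ n₁, E n₁ := by
    ext x; simp [E, eventually_atTop]
  rw [hE, dimH_iUnion]
  refine iSup_le fun n₁ => ?_
  let bad : ℕ → Finset (EuclideanSpace ℝ (Fin d)) := fun n =>
    (Y n).filter fun y =>
      eexp (-((n + 3 : ℕ) * a * Real.log 2)) ≤ M (Metric.ball y (rad (n + 2)))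
  have hbad : ∀ n y, y ∈ bad n ↔ y ∈ Y n ∧
      eexp (-((n + 3 : ℕ) * a * Real.log 2)) ≤ M (Metric.ball y (rad (n + 2))) := fun n y => by
    simp [bad]
  have hr0 : Tendsto (fun n => ENNReal.ofReal (rad n)) atTop (𝓝 0) := by
    have := ENNReal.tendsto_ofReal (tendsto_rad.mono_right nhdsWithin_le_nhds)
    rwa [ENNReal.ofReal_zero] at this
  have hdiam : ∀ (n : ℕ) (y : EuclideanSpace ℝ (Fin d)),
      Metric.ediam (Metric.closedBall y (rad (n + 3))) ≤ ENNReal.ofReal (rad n) := fun n y => by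
    have h3 : 2 * rad (n + 3) ≤ rad n := by
      have := rad_pos n
      rw [rad_succ, rad_succ, rad_succ]; linarith
    refine Metric.ediam_le fun u hu v hv => ?_
    rw [edist_dist]
    refine ENNReal.ofReal_le_ofReal ?_
    rw [Metric.mem_closedBall] at hu hv
    linarith [dist_triangle_right u v y]
  have hcov : ∀ᶠ n in atTop, E n₁ ⊆ ⋃ y : bad n, Metric.closedBall (y : EuclideanSpace ℝ (Fin d))
      (rad (n + 3)) := by
    filter_upwards [hY, eventually_ge_atTop n₁] with n hn hn1 x hx
    obtain ⟨y, hy, hxy⟩ := hn x hx.1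
    refine Set.mem_iUnion.2 ⟨⟨y, (hbad n y).2 ⟨hy, ?_⟩⟩, hxy⟩
    refine (hx.2 (n + 3) (by omega)).trans (measure_mono (Metric.ball_subset_ball' ?_))
    have := rad_succ (n + 2)
    linarith
  have hmain := Measure.hausdorffMeasure_le_liminf_sum s (E n₁) _ hr0
    (fun n (y : bad n) => Metric.closedBall (y : EuclideanSpace ℝ (Fin d)) (rad (n + 3)))
    (Eventually.of_forall fun n y => hdiam n y) hcov
  have hsum : ∀ n, ∑ y : bad n, Metric.ediam (Metric.closedBall
      (y : EuclideanSpace ℝ (Fin d)) (rad (n + 3))) ^ s ≤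
      eexp (3 * q * a * Real.log 2) * ((∑ y ∈ Y n, M (Metric.ball y (rad (n + 2))) ^ q) *
        eexp (n * (q * a - s) * Real.log 2)) := fun n => by
    have hrs : ENNReal.ofReal (rad n) ^ s = eexp (-(n * s * Real.log 2)) := by
      rw [rad_eq_exp]; change eexp _ ^ s = _
      rw [eexp_rpow]; congr 1; ring
    calc ∑ y : bad n, Metric.ediam (Metric.closedBall
          (y : EuclideanSpace ℝ (Fin d)) (rad (n + 3))) ^ s
        ≤ ∑ _y : bad n, eexp (-(n * s * Real.log 2)) := Finset.sum_le_sum fun y _ =>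
          (ENNReal.rpow_le_rpow (hdiam n y) hs).trans_eq hrs
      _ = ∑ _y ∈ bad n, eexp (-(n * s * Real.log 2)) :=
          Finset.sum_coe_sort (bad n) fun _ => eexp (-(n * s * Real.log 2))
      _ ≤ ∑ y ∈ bad n, M (Metric.ball y (rad (n + 2))) ^ q *
          eexp (q * ((n + 3 : ℕ) * a * Real.log 2) - n * s * Real.log 2) := by
          refine Finset.sum_le_sum fun y hy => ?_
          have h := ENNReal.rpow_le_rpow ((hbad n y).1 hy).2 hq.le
          rw [eexp_rpow] at h
          refine le_trans (le_of_eq ?_) (mul_le_mul_left h _)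
          rw [← eexp_add]; congr 1; ring
      _ ≤ ∑ y ∈ Y n, M (Metric.ball y (rad (n + 2))) ^ q *
          eexp (q * ((n + 3 : ℕ) * a * Real.log 2) - n * s * Real.log 2) :=
          Finset.sum_le_sum_of_subset fun y hy => ((hbad n y).1 hy).1
      _ = _ := by
          rw [← Finset.sum_mul, mul_left_comm (eexp _), ← eexp_add]
          congr 2; push_cast; ring
  have hzero : Tendsto (fun n : ℕ => eexp (3 * q * a * Real.log 2) *
      ((∑ y ∈ Y n, M (Metric.ball y (rad (n + 2))) ^ q) *
        eexp (n * (q * a - s) * Real.log 2))) atTop (𝓝 0) := by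
    simpa using ENNReal.Tendsto.const_mul (a := eexp (3 * q * a * Real.log 2)) hlim
      (Or.inr (eexp_ne_top _))
  have hH : Measure.hausdorffMeasure s (E n₁) = 0 := le_antisymm (hmain.trans
    ((liminf_le_liminf (Eventually.of_forall hsum)).trans_eq hzero.liminf_eq)) zero_le
  lift s to ℝ≥0 using hs
  rw [ENNReal.ofReal_coe_nnreal]
  exact dimH_le_of_hausdorffMeasure_ne_top (by rw [hH]; simp)

/-- A lower bound for the masses of small balls around points of given local dimension. -/
lemma eventually_le_ball_of_tendsto {x : EuclideanSpace ℝ (Fin d)} {α a : ℝ} (hα : 0 < α)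
    (ha : α < a)
    (h : Tendsto (fun ε : ℝ => Real.log (M (Metric.ball x ε)).toReal / Real.log ε)
      (𝓝[>] (0 : ℝ)) (𝓝 α)) :
    ∀ᶠ n : ℕ in atTop, eexp (-(n * a * Real.log 2)) ≤ M (Metric.ball x (rad n)) := by
  have hr : Tendsto rad atTop (𝓝[>] 0) :=
    tendsto_rad.mono_right (nhdsWithin_mono _ Set.Ioc_subset_Ioi_self)
  filter_upwards [(h.comp hr).eventually (Ioo_mem_nhds hα ha), eventually_gt_atTop 0] with n hn hn0
  have hl : Real.log (rad n) = -(n * Real.log 2) := by rw [rad_eq_exp, Real.log_exp]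
  have hpos : 0 < n * Real.log 2 := mul_pos (Nat.cast_pos.2 hn0) log_two_pos
  simp only [Function.comp_apply, hl] at hn
  set L := Real.log (M (Metric.ball x (rad n))).toReal with hL
  rw [div_neg, ← neg_div] at hn
  have h2 := (div_lt_iff₀ hpos).1 hn.2
  have h1 := (lt_div_iff₀ hpos).1 hn.1
  have hm : (M (Metric.ball x (rad n))).toReal ≠ 0 := fun h0 => by
    rw [hL, h0, Real.log_zero] at h1; simp at h1
  calc eexp (-(n * a * Real.log 2)) ≤ eexp L := eexp_le (by linarith)
    _ = ENNReal.ofReal (M (Metric.ball x (rad n))).toReal := by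
      rw [eexp, Real.exp_log (lt_of_le_of_ne ENNReal.toReal_nonneg hm.symm)]
    _ ≤ _ := ENNReal.ofReal_toReal_le

lemma exists_card_dyadicGrid_le (x₀ : EuclideanSpace ℝ (Fin d)) (n₀ : ℕ) :
    ∃ v : ℝ, ∀ m, ((dyadicGrid m (Metric.closedBall x₀ (rad n₀))).card : ℝ≥0∞) ≤
      eexp (v + m * d * Real.log 2) := by
  let V := volume (Metric.closedBall x₀ (rad n₀ + d))
  obtain ⟨v, hv⟩ := exists_eq_eexp (a := V)
    (Metric.measure_closedBall_pos _ _ (by have := rad_pos n₀; positivity)).ne'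
    (isCompact_closedBall _ _).measure_lt_top.ne
  refine ⟨v, fun m => ?_⟩
  have hG : ∀ y ∈ dyadicGrid m (Metric.closedBall x₀ (rad n₀)),
      dist y x₀ ≤ rad n₀ ∧ dyadicFloor m y = y := fun y hy =>
    (mem_dyadicGrid Metric.isBounded_closedBall).1 hy
  have h := volume_dyadicFloor_preimage_finset fun y hy => (hG y hy).2
  have hle : volume (dyadicFloor m ⁻¹' (dyadicGrid m (Metric.closedBall x₀ (rad n₀)) :
      Set (EuclideanSpace ℝ (Fin d)))) ≤ V := by
    refine measure_mono fun z hz => ?_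
    have h1 := (hG _ hz).1
    have h2 := dist_dyadicFloor_le m z
    have h3 : (d : ℝ) * rad m ≤ d :=
      mul_le_of_le_one_right (Nat.cast_nonneg d) (rad_zero ▸ rad_anti m.zero_le)
    have := dist_triangle_left z x₀ (dyadicFloor m z)
    exact Metric.mem_closedBall.2 (by linarith)
  rw [h, hv, ofReal_rad_pow] at hle
  calc ((dyadicGrid m (Metric.closedBall x₀ (rad n₀))).card : ℝ≥0∞)
      = eexp (m * d * Real.log 2) * (eexp (-(m * d * Real.log 2)) *
        (dyadicGrid m (Metric.closedBall x₀ (rad n₀))).card) := by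
        rw [← mul_assoc, eexp_mul_neg, one_mul]
    _ ≤ eexp (m * d * Real.log 2) * eexp v := mul_le_mul_right hle _
    _ = _ := by rw [← eexp_add, add_comm]

variable {Ω : Type*} [MeasurableSpace Ω] {P : Measure Ω}

/-- Upper bound for the dimension of the level sets, from moment bounds. -/
lemma ae_dimH_le_of_lintegral_rpow_le {M : Ω → Measure (EuclideanSpace ℝ (Fin d))}
    {x₀ : EuclideanSpace ℝ (Fin d)} {n₀ : ℕ} {q c τ α s : ℝ}
    (hM : ∀ A, MeasurableSet A → Measurable fun ω => M ω A) (hq : 0 < q) (hα : 0 < α)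
    (hs : 0 ≤ s) (hsτ : d - τ + q * α < s)
    (hmom : ∀ y ∈ Metric.closedBall x₀ (rad n₀), ∀ n ≥ n₀,
      ∫⁻ ω, M ω (Metric.ball y (rad (n + 2))) ^ q ∂P ≤ eexp (c - n * τ * Real.log 2)) :
    ∀ᵐ ω ∂P, dimH {x | x ∈ Metric.closedBall x₀ (rad (n₀ + 1)) ∧
      Tendsto (fun ε : ℝ => Real.log (M ω (Metric.ball x ε)).toReal / Real.log ε)
        (𝓝[>] (0 : ℝ)) (𝓝 α)} ≤ ENNReal.ofReal s := by
  obtain ⟨v, hv⟩ := exists_card_dyadicGrid_le x₀ n₀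
  obtain ⟨e, he⟩ : ∃ e : ℕ, d * rad e ≤ rad 3 := (eventually_mul_rad_le d (rad_pos 3)).exists
  obtain ⟨a, ha, has⟩ : ∃ a, α < a ∧ d - τ + q * a < s := by
    refine ⟨α + (s - (d - τ + q * α)) / (2 * q), by
      have := sub_pos.2 hsτ
      have : 0 < (s - (d - τ + q * α)) / (2 * q) := by positivity
      linarith, ?_⟩
    have : q * (α + (s - (d - τ + q * α)) / (2 * q)) = q * α + (s - (d - τ + q * α)) / 2 := by
      field_simp
    linarith
  let Y : ℕ → Finset (EuclideanSpace ℝ (Fin d)) := fun n =>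
    dyadicGrid (n + e) (Metric.closedBall x₀ (rad n₀))
  have hfl : ∀ n (z : EuclideanSpace ℝ (Fin d)), dist z (dyadicFloor (n + e) z) ≤ rad (n + 3) :=
    fun n z => by
      rw [dist_comm]
      refine (dist_dyadicFloor_le _ _).trans ?_
      rw [rad_add, rad_add, mul_left_comm]
      exact mul_le_mul_of_nonneg_left he (rad_pos n).le
  have hY : ∀ᶠ n in atTop, ∀ x ∈ Metric.closedBall x₀ (rad (n₀ + 1)), ∃ y ∈ Y n,
      dist x y ≤ rad (n + 3) := by
    filter_upwards [eventually_ge_atTop n₀] with n hn x hx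
    refine ⟨_, (mem_dyadicGrid Metric.isBounded_closedBall).2
      ⟨?_, dyadicFloor_dyadicFloor (n + e) x⟩, hfl n x⟩
    have h1 := hfl n x
    have h2 := dist_triangle_left (dyadicFloor (n + e) x) x₀ x
    have h3 : rad (n + 3) ≤ rad (n₀ + 1) := rad_anti (by omega)
    have h4 := rad_succ n₀
    rw [Metric.mem_closedBall] at hx ⊢
    linarith
  let G : ℕ → Ω → ℝ≥0∞ := fun n ω => (∑ y ∈ Y n, M ω (Metric.ball y (rad (n + 2))) ^ q) *
    eexp (n * (q * a - s) * Real.log 2)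
  have hGm : ∀ n, Measurable (G n) := fun n =>
    (Finset.measurable_fun_sum _ fun y _ =>
      (hM _ Metric.isOpen_ball.measurableSet).pow_const q).mul_const _
  let κ := (s - (d - τ + q * a)) * Real.log 2
  have hκ : 0 < κ := mul_pos (by linarith) log_two_pos
  have hG : ∀ n ≥ n₀, ∫⁻ ω, G n ω ∂P ≤ eexp (v + e * d * Real.log 2 + c) * eexp (-(n * κ)) := by
    intro n hn
    simp only [G]
    rw [lintegral_mul_const _ (Finset.measurable_fun_sum _ fun y _ =>
      (hM _ Metric.isOpen_ball.measurableSet).pow_const q), lintegral_finsetSum _ fun y _ =>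
      (hM _ Metric.isOpen_ball.measurableSet).pow_const q]
    calc (∑ y ∈ Y n, ∫⁻ ω, M ω (Metric.ball y (rad (n + 2))) ^ q ∂P) *
          eexp (n * (q * a - s) * Real.log 2)
        ≤ (∑ _y ∈ Y n, eexp (c - n * τ * Real.log 2)) *
          eexp (n * (q * a - s) * Real.log 2) := by
          refine mul_le_mul_left (Finset.sum_le_sum fun y hy => hmom y ?_ n hn) _
          exact ((mem_dyadicGrid Metric.isBounded_closedBall).1 hy).1
      _ ≤ eexp (v + (n + e : ℕ) * d * Real.log 2) * eexp (c - n * τ * Real.log 2) *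
          eexp (n * (q * a - s) * Real.log 2) := by
          rw [Finset.sum_const, nsmul_eq_mul]
          exact mul_le_mul_left (mul_le_mul_left (hv _) _) _
      _ = _ := by
          rw [← eexp_add, ← eexp_add, ← eexp_add]
          congr 1; simp only [κ]; push_cast; ring
  have hfin : ∫⁻ ω, ∑' n, G (n + n₀) ω ∂P ≠ ⊤ := by
    rw [lintegral_tsum fun n => (hGm _).aemeasurable]
    refine ((ENNReal.tsum_le_tsum fun n => hG (n + n₀) (by omega)).trans_lt ?_).ne
    have hg : ∀ n : ℕ, eexp (-((n + n₀ : ℕ) * κ)) ≤ eexp (-κ) ^ n := fun n => by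
      rw [← ENNReal.rpow_natCast, eexp_rpow]
      refine eexp_le ?_
      push_cast
      nlinarith [mul_nonneg (Nat.cast_nonneg (α := ℝ) n₀) hκ.le]
    rw [ENNReal.tsum_mul_left]
    refine ENNReal.mul_lt_top (eexp_ne_top _).lt_top
      ((ENNReal.tsum_le_tsum hg).trans_lt ?_)
    rw [ENNReal.tsum_geometric, ENNReal.inv_lt_top, tsub_pos_iff_lt, ← eexp_zero]
    exact lt_of_not_ge fun h => by linarith [eexp_le_iff.1 h]
  filter_upwards [ae_lt_top (Measurable.tsum fun n => hGm (n + n₀)) hfin] with ω hω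
  have hlim : Tendsto (fun n => G n ω) atTop (𝓝 0) :=
    (tendsto_add_atTop_iff_nat n₀).1 (ENNReal.tendsto_atTop_zero_of_tsum_ne_top hω.ne)
  refine (dimH_mono fun x hx => ?_).trans (dimH_le_of_tendsto_sum hY hs hq hlim)
  exact ⟨hx.1, eventually_le_ball_of_tendsto hα ha hx.2⟩

end UpperBound

section Main

variable {θ : EuclideanSpace ℝ (Fin d) → ℝ}
  {g : EuclideanSpace ℝ (Fin d) → EuclideanSpace ℝ (Fin d) → ℝ}
  {Ω : Type*} [MeasurableSpace Ω] {P : Measure Ω}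
  {X : ℝ → EuclideanSpace ℝ (Fin d) → Ω → ℝ} {γ β α s : ℝ} {D : Set (EuclideanSpace ℝ (Fin d))}
  {M : Ω → Measure (EuclideanSpace ℝ (Fin d))} {x₀ : EuclideanSpace ℝ (Fin d)} {n₀ : ℕ}

lemma exists_approximates [IsProbabilityMeasure P] (hd : 1 ≤ d)
    (hθ : IsMollifier θ) (hg : IsBoundedMeasurable g)
    (hX : IsGaussianFamily P X (mollifiedCov (logKernel g) θ θ))
    (hM : IsGMCMeasure P γ X (mollifiedCov (logKernel g) θ θ) (fun _ => 1) D M)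
    (hx₀ : Metric.closedBall x₀ (2 * rad n₀) ⊆ D) :
    ∃ N m : ℕ → ℕ, Tendsto N atTop atTop ∧ (∀ k, n₀ ≤ N k) ∧
      (∀ k, d * rad (m k) ≤ rad (N k + 1)) ∧
      ∀ᵐ ω ∂P, Approximates (covKer g θ) γ (fun k => gridStage x₀ n₀ (m k) (N k))
        (dyadicField X ω) (M ω) x₀ (rad n₀) := by
  obtain ⟨N, m, hkN, -, hmN, hlim⟩ := exists_tendsto_mass hd hθ hg hX hM
  refine ⟨fun k => N (k + n₀), fun k => m (k + n₀),
    tendsto_atTop_mono (fun k => (Nat.le_add_right k n₀).trans (hkN _)) tendsto_id,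
    fun k => (Nat.le_add_left n₀ k).trans (hkN _), fun k => hmN _, ?_⟩
  filter_upwards [hlim] with ω hω
  exact approximates_gridStage hx₀ fun p F h1 h2 =>
    (hω p F h1 h2).comp (tendsto_add_atTop_nat n₀)

lemma ae_dimH_levelSet_le [IsProbabilityMeasure P] (hd : 1 ≤ d)
    (hθ : IsMollifier θ) (hg : IsBoundedMeasurable g)
    (hX : IsGaussianFamily P X (mollifiedCov (logKernel g) θ θ))
    (hM : IsGMCMeasure P γ X (mollifiedCov (logKernel g) θ θ) (fun _ => 1) D M)
    (hγ : 0 < γ) {q : ℝ} (hq : 0 < q) (hγq : γ ^ 2 * q < 2 * d) (hn₀ : 2 ≤ n₀)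
    (hx₀ : Metric.closedBall x₀ (2 * rad n₀) ⊆ D)
    (hα : α = d + (1 / 2 - q) * γ ^ 2) (hα0 : 0 < α) (hs0 : 0 ≤ s)
    (hs : d - γ ^ 2 * q ^ 2 / 2 < s) :
    ∀ᵐ ω ∂P, dimH {x | x ∈ Metric.closedBall x₀ (rad (n₀ + 1)) ∧
      Tendsto (fun ε : ℝ => Real.log (M ω (Metric.ball x ε)).toReal / Real.log ε)
        (𝓝[>] (0 : ℝ)) (𝓝 α)} ≤ ENNReal.ofReal s := by
  obtain ⟨C₀, hC⟩ := hθ.exists_kernelBound hd hg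
  obtain ⟨N, m, hN, hNn, hm, hA⟩ := exists_approximates hd hθ hg hX hM hx₀
  obtain ⟨c, hc⟩ := exists_lintegral_ball_rpow_le hC hγ.le hq (Or.inr hγq) hn₀
    hX.measurable_dyadicField hX.gaussField hN hNn hm hA
  refine ae_dimH_le_of_lintegral_rpow_le hM.1 hq hα0 hs0 ?_ hc
  rw [momExp, hα]
  linarith

lemma ae_le_dimH_levelSet [IsProbabilityMeasure P] (hd : 1 ≤ d)
    (hθ : IsMollifier θ) (hg : IsBoundedMeasurable g)
    (hX : IsGaussianFamily P X (mollifiedCov (logKernel g) θ θ))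
    (hM : IsGMCMeasure P γ X (mollifiedCov (logKernel g) θ θ) (fun _ => 1) D M)
    (hγ : 0 < γ) (hγd : γ ^ 2 < 2 * d) (hβ : 0 < β) (hβd : β ^ 2 < 2 * d) (hn₀ : 2 ≤ n₀)
    (hx₀ : Metric.closedBall x₀ (2 * rad n₀) ⊆ D)
    (hα : α = d + γ ^ 2 / 2 - γ * β) (hα0 : 0 < α) (hs0 : 0 < s) (hs : s < d - β ^ 2 / 2) :
    ∀ᵐ ω ∂P, ENNReal.ofReal s ≤ dimH {x | x ∈ Metric.closedBall x₀ (rad n₀) ∧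
      Tendsto (fun ε : ℝ => Real.log (M ω (Metric.ball x ε)).toReal / Real.log ε)
        (𝓝[>] (0 : ℝ)) (𝓝 α)} := by
  obtain ⟨C₀, hC⟩ := hθ.exists_kernelBound hd hg
  obtain ⟨C₁, c₁, c₂, hval⟩ := exists_gridStage_valid d n₀ hn₀
  obtain ⟨N, m, hN, hNn, hm, hA⟩ := exists_approximates hd hθ hg hX hM hx₀
  have hT : ∀ k, (gridStage x₀ n₀ (m k) (N k)).Valid C₁ c₁ c₂ n₀ := fun k =>
    hval _ _ _ (hNn k) (hm k)
  obtain ⟨B, hB⟩ := exists_goodEvent_ae hC C₁ c₁ c₂ hγ hγd hβ hβd hα hα0 hs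
  have hgood := ae_of_ae_map hX.measurable_dyadicField.aemeasurable (hB _ hX.gaussField _ n₀ hT)
  filter_upwards [hA, hgood] with ω hω hωg
  refine le_dimH_of_goodEvent hs0 hω hN hT (fun k y hy => ?_) hωg
  exact ((mem_dyadicGrid Metric.isBounded_closedBall).1 hy).1

/-- Open sets are covered by countably many small balls. -/
lemma exists_mem_closedBall_denseSeq (hD : IsOpen D) {x : EuclideanSpace ℝ (Fin d)}
    (hx : x ∈ D) :
    ∃ i n : ℕ, 2 ≤ n ∧
      Metric.closedBall (TopologicalSpace.denseSeq (EuclideanSpace ℝ (Fin d)) i) (2 * rad n) ⊆ D ∧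
      x ∈ Metric.closedBall (TopologicalSpace.denseSeq (EuclideanSpace ℝ (Fin d)) i)
        (rad (n + 1)) := by
  obtain ⟨ε, hε, hball⟩ := Metric.isOpen_iff.1 hD x hx
  obtain ⟨n, hn, hn2⟩ :=
    ((eventually_mul_rad_le 4 hε).and (eventually_ge_atTop 2)).exists
  obtain ⟨i, hi⟩ := (TopologicalSpace.denseRange_denseSeq
    (EuclideanSpace ℝ (Fin d))).exists_dist_lt x (rad_pos (n + 1))
  refine ⟨i, n, hn2, fun y hy => hball ?_, hi.le⟩
  have h1 := rad_succ n
  have h2 := rad_pos n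
  have := dist_triangle y (TopologicalSpace.denseSeq (EuclideanSpace ℝ (Fin d)) i) x
  rw [dist_comm] at hi
  rw [Metric.mem_closedBall] at hy
  exact Metric.mem_ball.2 (by linarith)

end Main

/-- **Hausdorff dimension of the multifractal level sets.** Let `D ⊆ ℝ^d` be nonempty bounded
open, `f ≡ 1`, `γ ∈ (0, √(2d))`, `q ∈ (0, √(2d)/γ)`, and `M` the Gaussian multiplicative chaos
measure on `D`. Then almost surely the set
`K_{γ,q} = {x ∈ D : lim_{ε→0⁺} ln M(B(x,ε)) / ln ε = d + (1/2 - q) γ²}`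
has Hausdorff dimension `d - γ² q² / 2`. -/
theorem gmc_level_set_dimension (hd : 1 ≤ d)
    (g : EuclideanSpace ℝ (Fin d) → EuclideanSpace ℝ (Fin d) → ℝ) (hg : IsBoundedMeasurable g)
    (θ : EuclideanSpace ℝ (Fin d) → ℝ) (hθ : IsMollifier θ)
    {Ω : Type*} [MeasurableSpace Ω] (P : Measure Ω) [IsProbabilityMeasure P]
    (X : ℝ → EuclideanSpace ℝ (Fin d) → Ω → ℝ)
    (hX : IsGaussianFamily P X (mollifiedCov (logKernel g) θ θ))
    (γ : ℝ) (hγ0 : 0 < γ) (hγ2 : γ < Real.sqrt (2 * d))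
    (q : ℝ) (hq0 : 0 < q) (hq : q < Real.sqrt (2 * d) / γ)
    (D : Set (EuclideanSpace ℝ (Fin d))) (hD : IsOpen D) (hDne : D.Nonempty)
    (hDbdd : Bornology.IsBounded D)
    (M : Ω → Measure (EuclideanSpace ℝ (Fin d)))
    (hM : IsGMCMeasure P γ X (mollifiedCov (logKernel g) θ θ) (fun _ => 1) D M) :
    ∀ᵐ ω ∂P,
      dimH {x | x ∈ D ∧
        Tendsto (fun ε : ℝ => Real.log ((M ω (Metric.ball x ε)).toReal) / Real.log ε)
          (𝓝[>] (0 : ℝ)) (𝓝 (d + (1 / 2 - q) * γ ^ 2))} =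
      ENNReal.ofReal (d - γ ^ 2 * q ^ 2 / 2) := by
  set R := Real.sqrt (2 * d) with hR
  have hR0 : 0 < R := hγ0.trans hγ2
  have hRR : R ^ 2 = 2 * d := Real.sq_sqrt (by positivity)
  have hβ : γ * q < R := by rwa [lt_div_iff₀ hγ0, mul_comm] at hq
  have hβ0 : 0 < γ * q := mul_pos hγ0 hq0
  have hγd : γ ^ 2 < 2 * d := hRR ▸ pow_lt_pow_left₀ hγ2 hγ0.le two_ne_zero
  have hβd : (γ * q) ^ 2 < 2 * d := hRR ▸ pow_lt_pow_left₀ hβ hβ0.le two_ne_zero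
  have hγq : γ ^ 2 * q < 2 * d := by nlinarith
  have hα0 : 0 < d + (1 / 2 - q) * γ ^ 2 := by
    nlinarith [mul_pos hγ0 (sub_pos.2 hβ), pow_pos (sub_pos.2 hγ2) 2]
  have ht0 : 0 < d - γ ^ 2 * q ^ 2 / 2 := by nlinarith
  have hlim : Tendsto (fun j : ℕ => 1 / ((j : ℝ) + 1)) atTop (𝓝 0) :=
    tendsto_one_div_add_atTop_nhds_zero_nat
  have hpos : ∀ j : ℕ, 0 < 1 / ((j : ℝ) + 1) := fun j => Nat.one_div_pos_of_nat
  let ι := {p : ℕ × ℕ // 2 ≤ p.2 ∧ Metric.closedBall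
    (TopologicalSpace.denseSeq (EuclideanSpace ℝ (Fin d)) p.1) (2 * rad p.2) ⊆ D}
  have hupper : ∀ᵐ ω ∂P, ∀ (j : ℕ) (i : ι), dimH {x |
      x ∈ Metric.closedBall (TopologicalSpace.denseSeq (EuclideanSpace ℝ (Fin d)) i.1.1)
        (rad (i.1.2 + 1)) ∧
      Tendsto (fun ε : ℝ => Real.log (M ω (Metric.ball x ε)).toReal / Real.log ε)
        (𝓝[>] (0 : ℝ)) (𝓝 (d + (1 / 2 - q) * γ ^ 2))} ≤
      ENNReal.ofReal (d - γ ^ 2 * q ^ 2 / 2 + 1 / ((j : ℝ) + 1)) :=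
    ae_all_iff.2 fun j => ae_all_iff.2 fun i =>
      ae_dimH_levelSet_le hd hθ hg hX hM hγ0 hq0 hγq i.2.1 i.2.2 rfl hα0
        (by linarith [hpos j]) (by linarith [hpos j])
  obtain ⟨x, hx⟩ := hDne
  obtain ⟨i, n, hn, hball, -⟩ := exists_mem_closedBall_denseSeq hD hx
  have hlower : ∀ᵐ ω ∂P, ∀ j : ℕ, 0 < d - γ ^ 2 * q ^ 2 / 2 - 1 / ((j : ℝ) + 1) →
      ENNReal.ofReal (d - γ ^ 2 * q ^ 2 / 2 - 1 / ((j : ℝ) + 1)) ≤ dimH {x |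
      x ∈ Metric.closedBall (TopologicalSpace.denseSeq (EuclideanSpace ℝ (Fin d)) i) (rad n) ∧
      Tendsto (fun ε : ℝ => Real.log (M ω (Metric.ball x ε)).toReal / Real.log ε)
        (𝓝[>] (0 : ℝ)) (𝓝 (d + (1 / 2 - q) * γ ^ 2))} :=
    ae_all_iff.2 fun j => eventually_imp_distrib_left.2 fun hj =>
      ae_le_dimH_levelSet hd hθ hg hX hM hγ0 hγd hβ0 hβd hn hball (by ring) hα0 hj
        (by rw [mul_pow]; linarith [hpos j])
  filter_upwards [hupper, hlower] with ω hu hl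
  apply le_antisymm
  · have h : Tendsto (fun j : ℕ => ENNReal.ofReal (d - γ ^ 2 * q ^ 2 / 2 + 1 / ((j : ℝ) + 1)))
        atTop (𝓝 (ENNReal.ofReal (d - γ ^ 2 * q ^ 2 / 2))) :=
      ENNReal.tendsto_ofReal (by simpa using hlim.const_add (d - γ ^ 2 * q ^ 2 / 2))
    refine ge_of_tendsto' h fun j => ?_
    refine le_trans (dimH_mono fun y hy => ?_)
      ((dimH_iUnion _).trans_le (iSup_le fun i : ι => hu j i))
    obtain ⟨i', n', hn', hb', hy'⟩ := exists_mem_closedBall_denseSeq hD hy.1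
    exact Set.mem_iUnion.2 ⟨⟨(i', n'), hn', hb'⟩, hy', hy.2⟩
  · have h : Tendsto (fun j : ℕ => ENNReal.ofReal (d - γ ^ 2 * q ^ 2 / 2 - 1 / ((j : ℝ) + 1)))
        atTop (𝓝 (ENNReal.ofReal (d - γ ^ 2 * q ^ 2 / 2))) :=
      ENNReal.tendsto_ofReal (by simpa using hlim.const_sub (d - γ ^ 2 * q ^ 2 / 2))
    refine le_of_tendsto' h fun j => ?_
    rcases le_or_gt (d - γ ^ 2 * q ^ 2 / 2 - 1 / ((j : ℝ) + 1)) 0 with hj | hj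
    · rw [ENNReal.ofReal_of_nonpos hj]; exact zero_le
    · refine (hl j hj).trans (dimH_mono fun y hy => ⟨hball ?_, hy.2⟩)
      exact Metric.closedBall_subset_closedBall (by linarith [rad_pos n]) hy.1

end
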